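/- Uniformly for real X ≥ 2 and integers q with 1 ≤ q ≤ X, one has M₂(X,q) = C·∏_{p∣q}(1+2p^{-1})^{-1}·X^{1/2}q^{1/2} + O(d(q)·X^{1/3}q^{2/3} + X^{23/15}q^{-13/15}(log X)^{15}), where d(q) denotes the number of divisors of q and the implied constant is absolute. -/

import Mathlib

open scoped BigOperators

/-- The singular constant `C(q) = (6/π²)·∏_{p∣q}(1−p^{-2})^{-1}`. -/
noncomputable def Cq (q : ℕ) : ℝ :=
  (6 / Real.pi ^ 2) * ∏ p ∈ q.primeFactors, (1 - ((p : ℝ))⁻¹ ^ 2)⁻¹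

/-- The error term `E(X,q,a)` in the count of squarefree numbers `≤ X` congruent
to `a` modulo `q`. -/
noncomputable def Eterm (X : ℝ) (q a : ℕ) : ℝ :=
  (∑ n ∈ (Finset.Icc 1 ⌊X⌋₊).filter (fun n => n % q = a % q),
    ((ArithmeticFunction.moebius n : ℤ) : ℝ) ^ 2) - Cq q * X / q

/-- The variance `M₂(X,q) = Σ*_{a mod q} |E(X,q,a)|²`. -/
noncomputable def M2 (X : ℝ) (q : ℕ) : ℝ :=
  ∑ a ∈ (Finset.range q).filter (fun a => Nat.Coprime a q), (Eterm X q a) ^ 2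

/-- The constant `C = (ζ(3/2)/π)·∏_p (p³−3p+2)/p³`. -/
noncomputable def Cmain : ℝ :=
  ((riemannZeta (3 / 2)).re / Real.pi) *
    ∏' p : Nat.Primes, ((((p : ℕ) : ℝ) ^ 3 - 3 * ((p : ℕ) : ℝ) + 2) / ((p : ℕ) : ℝ) ^ 3)



namespace Nun

/-- real-valued Moebius function -/
noncomputable def mu (n : ℕ) : ℝ := ((ArithmeticFunction.moebius n : ℤ) : ℝ)

/-- coprimality indicator -/
noncomputable def cp (q n : ℕ) : ℝ := if Nat.Coprime n q then 1 else 0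

lemma mu_zero : mu 0 = 0 := by simp [mu]

lemma mu_one : mu 1 = 1 := by simp [mu]

lemma mu_abs_le (n : ℕ) : |mu n| ≤ 1 := by
  unfold mu
  have := ArithmeticFunction.abs_moebius_le_one (n := n)
  exact_mod_cast this

lemma mu_sq_le (n : ℕ) : mu n ^ 2 ≤ 1 := by
  have := mu_abs_le n
  rw [← sq_abs]
  nlinarith [abs_nonneg (mu n)]

lemma cp_nonneg (q n : ℕ) : 0 ≤ cp q n := by unfold cp; split_ifs <;> norm_num

lemma cp_le_one (q n : ℕ) : cp q n ≤ 1 := by unfold cp; split_ifs <;> norm_num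

lemma mu_mul {m n : ℕ} (h : Nat.Coprime m n) : mu (m * n) = mu m * mu n := by
  unfold mu
  rw [ArithmeticFunction.isMultiplicative_moebius.map_mul_of_coprime h]
  push_cast; ring

lemma sum_mu_divisors (n : ℕ) : ∑ d ∈ n.divisors, mu d = if n = 1 then 1 else 0 := by
  have h := congrArg (fun f : ArithmeticFunction ℤ => f n)
    ArithmeticFunction.coe_zeta_mul_moebius
  simp only [ArithmeticFunction.coe_zeta_mul_apply, ArithmeticFunction.one_apply] at h
  unfold mu
  have h2 := congrArg (fun z : ℤ => (z : ℝ)) h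
  push_cast at h2
  simpa using h2

lemma cp_eq {m : ℕ} (hm : m ≠ 0) (n : ℕ) :
    cp m n = ∑ c ∈ m.divisors.filter (fun c => c ∣ n), mu c := by
  have h1 : m.divisors.filter (fun c => c ∣ n) = (Nat.gcd n m).divisors := by
    ext c
    simp only [Finset.mem_filter, Nat.mem_divisors, Nat.dvd_gcd_iff]
    constructor
    · rintro ⟨⟨a, b⟩, d⟩
      exact ⟨⟨d, a⟩, Nat.gcd_ne_zero_right hm⟩
    · rintro ⟨⟨a, b⟩, d⟩
      exact ⟨⟨b, hm⟩, a⟩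
  rw [h1, sum_mu_divisors]
  rfl

lemma sum_mu_div {m : ℕ} (hm : m ≠ 0) :
    ∑ c ∈ m.divisors, mu c / c = (Nat.totient m : ℝ) / m := by
  have h := (ArithmeticFunction.sum_eq_iff_sum_mul_moebius_eq (R := ℝ)
    (f := fun n => (Nat.totient n : ℝ)) (g := fun n => (n : ℝ))).1 (by
      intro n hn
      exact_mod_cast Nat.sum_totient n) m (Nat.pos_of_ne_zero hm)
  have hm' : (m : ℝ) ≠ 0 := by exact_mod_cast hm
  rw [eq_div_iff hm', ← h, Finset.sum_mul, Nat.sum_divisorsAntidiagonal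
    (f := fun a b => ((ArithmeticFunction.moebius a : ℤ) : ℝ) * (b : ℝ))]
  refine Finset.sum_congr rfl fun c hc => ?_
  have hc1 := Nat.dvd_of_mem_divisors hc
  have hc0 : (c : ℝ) ≠ 0 := by
    have := Nat.pos_of_mem_divisors hc
    positivity
  rw [Nat.cast_div hc1 hc0]
  unfold mu
  ring

lemma sq_identity {n K : ℕ} (hn : n ≠ 0) (hK : n ≤ K) :
    ∑ d ∈ (Finset.Icc 1 K).filter (fun d => d ^ 2 ∣ n), mu d = mu n ^ 2 := by
  obtain ⟨a, b, hab, ha⟩ := Nat.sq_mul_squarefree n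
  have hb : b ≠ 0 := by rintro rfl; simp at hab; exact hn hab.symm
  have ha0 : a ≠ 0 := ha.ne_zero
  have h1 : (Finset.Icc 1 K).filter (fun d => d ^ 2 ∣ n) = b.divisors := by
    ext d
    simp only [Finset.mem_filter, Finset.mem_Icc, Nat.mem_divisors]
    have key : d ^ 2 ∣ n → d ∣ b := by
      intro h
      rw [← hab] at h
      by_cases hd0 : d = 0
      · subst hd0; simp at h; exact absurd h (by simp [hb, ha0])
      set g := Nat.gcd d b with hg
      have hgpos : 0 < g := Nat.gcd_pos_of_pos_right _ (Nat.pos_of_ne_zero hb)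
      obtain ⟨d', b', hcop, hd', hb'⟩ : ∃ d' b' : ℕ, Nat.Coprime d' b' ∧ d = d' * g ∧ b = b' * g := by
        obtain ⟨d', b', h1, h2, h3⟩ := Nat.exists_coprime d b
        exact ⟨d', b', h1, h2, h3⟩
      have h2 : d' ^ 2 ∣ b' ^ 2 * a := by
        have : (d' ^ 2) * g ^ 2 ∣ (b' ^ 2 * a) * g ^ 2 := by
          rw [hd', hb'] at h
          convert h using 1 <;> ring
        exact Nat.dvd_of_mul_dvd_mul_right (by positivity) this
      have h3 : d' ^ 2 ∣ a := (Nat.Coprime.pow 2 2 hcop).dvd_of_dvd_mul_left h2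
      have h4 : d' = 1 := by
        have := ha d' (by rwa [← sq])
        exact Nat.isUnit_iff.1 this
      rw [hd', h4, one_mul]
      exact Nat.gcd_dvd_right d b
    constructor
    · rintro ⟨_, h⟩
      exact ⟨key h, hb⟩
    · rintro ⟨h, _⟩
      have h5 : d ^ 2 ∣ n := by
        rw [← hab]; exact Dvd.dvd.mul_right (pow_dvd_pow_of_dvd h 2) a
      have hd : 0 < d := Nat.pos_of_dvd_of_pos h (Nat.pos_of_ne_zero hb)
      refine ⟨⟨hd, ?_⟩, h5⟩
      have := Nat.le_of_dvd (Nat.pos_of_ne_zero hn) h5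
      nlinarith
  rw [h1, sum_mu_divisors]
  unfold mu
  split_ifs with hb1
  · subst hb1
    have : Squarefree n := by rw [← hab]; simpa using ha
    have h6 := ArithmeticFunction.moebius_sq_eq_one_of_squarefree this
    exact_mod_cast h6.symm
  · have : ¬ Squarefree n := by
      intro hs
      have := hs b (by rw [← hab, sq]; exact Dvd.intro a rfl)
      exact hb1 (Nat.isUnit_iff.1 this)
    rw [ArithmeticFunction.moebius_eq_zero_of_not_squarefree this]
    simp

lemma divisor_bound (ε : ℝ) (hε : 0 < ε) :
    ∃ C : ℝ, 1 ≤ C ∧ ∀ n : ℕ, n ≠ 0 → (n.divisors.card : ℝ) ≤ C * (n : ℝ) ^ ε := by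
  set K : ℝ := max 1 (1 / (ε * Real.log 2)) with hK
  have hl2 : 0 < Real.log 2 := Real.log_pos (by norm_num)
  have hK1 : 1 ≤ K := le_max_left _ _
  have hK2 : 1 ≤ K * (ε * Real.log 2) := by
    have : 1 / (ε * Real.log 2) ≤ K := le_max_right _ _
    rwa [div_le_iff₀ (by positivity)] at this
  set P0 : ℕ := ⌈(2 : ℝ) ^ (1 / ε)⌉₊ with hP0
  refine ⟨K ^ P0, one_le_pow₀ hK1, fun n hn => ?_⟩
  rw [Nat.card_divisors hn]
  have hn1 : (n : ℝ) ^ ε = ∏ p ∈ n.primeFactors, ((p : ℝ) ^ ε) ^ (n.factorization p) := by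
    conv_lhs => rw [← Nat.prod_factorization_pow_eq_self hn]
    rw [Finsupp.prod, Nat.support_factorization]
    push_cast
    rw [← Real.finsetProd_rpow _ _ (fun i _ => by positivity)]
    refine Finset.prod_congr rfl fun p _ => ?_
    rw [← Real.rpow_natCast, ← Real.rpow_natCast, ← Real.rpow_mul (by positivity),
      ← Real.rpow_mul (by positivity), mul_comm]
  have hb : ∀ p ∈ n.primeFactors, ((n.factorization p + 1 : ℕ) : ℝ) ≤
      (if p < P0 then K else 1) * ((p : ℝ) ^ ε) ^ (n.factorization p) := by
    intro p hp
    have hp2 : (2 : ℝ) ≤ p := by exact_mod_cast (Nat.prime_of_mem_primeFactors hp).two_le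
    set a := n.factorization p
    split_ifs with h
    · have h1 : (2 : ℝ) ^ ε ≤ (p : ℝ) ^ ε := Real.rpow_le_rpow (by norm_num) hp2 hε.le
      have h2 : 1 + (a : ℝ) * (ε * Real.log 2) ≤ ((2 : ℝ) ^ ε) ^ a := by
        have e1 : ((2 : ℝ) ^ ε) ^ a = Real.exp (a * (ε * Real.log 2)) := by
          rw [Real.rpow_def_of_pos (by norm_num), ← Real.exp_nat_mul]
          ring_nf
        rw [e1]
        linarith [Real.add_one_le_exp ((a : ℝ) * (ε * Real.log 2))]
      have h3 : ((2 : ℝ) ^ ε) ^ a ≤ ((p : ℝ) ^ ε) ^ a := pow_le_pow_left₀ (by positivity) h1 a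
      have ha : (0 : ℝ) ≤ a := by positivity
      push_cast
      calc (a : ℝ) + 1 ≤ K * (1 + (a : ℝ) * (ε * Real.log 2)) := by nlinarith
        _ ≤ _ := by gcongr; exact h2.trans h3
    · have hp3 : (2 : ℝ) ^ (1 / ε) ≤ p := by
        have : P0 ≤ p := not_lt.1 h
        exact (Nat.le_ceil _).trans (by exact_mod_cast this)
      have h1 : (2 : ℝ) ≤ (p : ℝ) ^ ε := by
        have := Real.rpow_le_rpow (by positivity) hp3 hε.le
        rw [← Real.rpow_mul (by norm_num)] at this
        have e : 1 / ε * ε = 1 := by field_simp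
        rw [e, Real.rpow_one] at this
        exact this
      rw [one_mul]
      have h2 : ((a + 1 : ℕ) : ℝ) ≤ (2 : ℝ) ^ a := by
        exact_mod_cast Nat.lt_two_pow_self (n := a)
      exact h2.trans (pow_le_pow_left₀ (by norm_num) h1 a)
  push_cast at hb ⊢
  calc ∏ p ∈ n.primeFactors, ((n.factorization p : ℝ) + 1)
      ≤ ∏ p ∈ n.primeFactors, ((if p < P0 then K else 1) * ((p : ℝ) ^ ε) ^ (n.factorization p)) :=
        Finset.prod_le_prod (fun i _ => by positivity) hb
    _ = (∏ p ∈ n.primeFactors, (if p < P0 then K else 1)) * (n : ℝ) ^ ε := by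
        rw [Finset.prod_mul_distrib, hn1]
    _ ≤ K ^ P0 * (n : ℝ) ^ ε := by
        gcongr
        rw [Finset.prod_ite]
        simp only [Finset.prod_const, one_pow, mul_one]
        refine pow_le_pow_right₀ hK1 ?_
        calc (n.primeFactors.filter (fun p => p < P0)).card ≤ (Finset.range P0).card :=
              Finset.card_le_card (by intro x hx; simp at hx ⊢; exact hx.2)
          _ = P0 := Finset.card_range _

lemma card_divisors_mul_le {m n : ℕ} (hm : m ≠ 0) (hn : n ≠ 0) :
    ((m * n).divisors.card : ℝ) ≤ m.divisors.card * n.divisors.card := by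
  have h : (m * n).divisors = (m.divisors ×ˢ n.divisors).image (fun x => x.1 * x.2) := by
    rw [Nat.divisors_mul]; rfl
  rw [h]
  have := Finset.card_image_le (s := m.divisors ×ˢ n.divisors) (f := fun x => x.1 * x.2)
  rw [Finset.card_product] at this
  exact_mod_cast this

end Nun


namespace Nun

/-- the multiplicative function `μ(n) ∏_{p ∣ n} a(p)` -/
noncomputable def wf (a : ℕ → ℝ) (n : ℕ) : ℝ := mu n * ∏ p ∈ n.primeFactors, a p

lemma wf_abs_le {a : ℕ → ℝ} (ha : ∀ p : ℕ, p.Prime → 0 ≤ a p ∧ a p ≤ 1 / (p : ℝ) ^ 2) (n : ℕ) :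
    |wf a n| ≤ 1 / (n : ℝ) ^ 2 := by
  unfold wf
  by_cases hs : Squarefree n
  · have h1 : ∏ p ∈ n.primeFactors, a p ≤ ∏ p ∈ n.primeFactors, (1 / (p : ℝ) ^ 2) :=
      Finset.prod_le_prod (fun p hp => (ha p (Nat.prime_of_mem_primeFactors hp)).1)
        (fun p hp => (ha p (Nat.prime_of_mem_primeFactors hp)).2)
    have h0 : 0 ≤ ∏ p ∈ n.primeFactors, a p :=
      Finset.prod_nonneg (fun p hp => (ha p (Nat.prime_of_mem_primeFactors hp)).1)
    have h2 : ∏ p ∈ n.primeFactors, (1 / (p : ℝ) ^ 2) = 1 / (n : ℝ) ^ 2 := by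
      conv_rhs => rw [← Nat.prod_primeFactors_of_squarefree hs]
      push_cast
      rw [Finset.prod_div_distrib, Finset.prod_pow]
      simp
    rw [abs_mul, abs_of_nonneg h0]
    calc |mu n| * ∏ p ∈ n.primeFactors, a p ≤ 1 * (1 / (n : ℝ) ^ 2) := by
          gcongr
          · exact mu_abs_le n
          · exact h1.trans h2.le
      _ = _ := one_mul _
  · have : mu n = 0 := by
      unfold mu; rw [ArithmeticFunction.moebius_eq_zero_of_not_squarefree hs]; simp
    rw [this]; simp

lemma summable_inv_sq : Summable (fun n : ℕ => 1 / (n : ℝ) ^ 2) :=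
  Real.summable_one_div_nat_pow.2 (by norm_num)

lemma cpwf_abs_le {a : ℕ → ℝ} (ha : ∀ p : ℕ, p.Prime → 0 ≤ a p ∧ a p ≤ 1 / (p : ℝ) ^ 2) (m n : ℕ) :
    |cp m n * wf a n| ≤ 1 / (n : ℝ) ^ 2 := by
  rw [abs_mul, abs_of_nonneg (cp_nonneg m n)]
  have := wf_abs_le ha n
  nlinarith [cp_nonneg m n, cp_le_one m n, abs_nonneg (wf a n)]

lemma cpwf_summable {a : ℕ → ℝ} (ha : ∀ p : ℕ, p.Prime → 0 ≤ a p ∧ a p ≤ 1 / (p : ℝ) ^ 2) (m : ℕ) :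
    Summable (fun n => cp m n * wf a n) :=
  Summable.of_norm_bounded summable_inv_sq (fun n => cpwf_abs_le ha m n)

lemma wf_mul (a : ℕ → ℝ) {m n : ℕ} (h : Nat.Coprime m n) : wf a (m * n) = wf a m * wf a n := by
  unfold wf
  rw [mu_mul h, Nat.Coprime.primeFactors_mul h,
    Finset.prod_union h.disjoint_primeFactors]
  ring

lemma euler_restricted {a : ℕ → ℝ}
    (ha : ∀ p : ℕ, p.Prime → 0 ≤ a p ∧ a p ≤ 1 / (p : ℝ) ^ 2) (m : ℕ) :
    HasProd (fun p : Nat.Primes => if (p : ℕ) ∣ m then 1 else 1 - a p)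
      (∑' n, cp m n * wf a n) := by
  have h := EulerProduct.eulerProduct_hasProd (f := fun n => cp m n * wf a n)
    (by simp [cp, wf, mu_one])
    (by
      intro k n hkn
      rw [wf_mul a hkn]
      have : cp m (k * n) = cp m k * cp m n := by
        unfold cp
        simp only [Nat.Coprime]
        by_cases h1 : Nat.gcd k m = 1 <;> by_cases h2 : Nat.gcd n m = 1
        · simp [h1, h2, Nat.Coprime.mul_left (show Nat.Coprime k m from h1) h2]
        all_goals
          have : ¬ (k * n).gcd m = 1 := by
            intro h
            have := Nat.coprime_mul_iff_left.1 (show Nat.Coprime (k * n) m from h)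
            tauto
          simp [h1, h2, this]
      rw [this]; ring)
    (by
      refine Summable.of_nonneg_of_le (fun _ => norm_nonneg _) (fun n => cpwf_abs_le ha m n)
        summable_inv_sq)
    (by simp [wf, mu_zero])
  suffices hh : (fun p : Nat.Primes => if (p : ℕ) ∣ m then 1 else 1 - a p) =
      fun p : Nat.Primes => ∑' e : ℕ, cp m ((p : ℕ) ^ e) * wf a ((p : ℕ) ^ e) by
    rw [hh]; exact h
  funext p
  have hp := p.2
  rw [tsum_eq_sum (s := {0, 1})]
  · rw [Finset.sum_pair (by norm_num)]
    have : mu p = -1 := by unfold mu; rw [ArithmeticFunction.moebius_apply_prime hp]; simp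
    simp only [pow_zero, pow_one, wf, this, mu_one, Nat.primeFactors_one, Finset.prod_empty,
      Nat.Prime.primeFactors hp, Finset.prod_singleton, cp, Nat.coprime_one_left_iff]
    by_cases hd : (p : ℕ) ∣ m
    · have : ¬ Nat.Coprime p m := by rw [Nat.Prime.coprime_iff_not_dvd hp]; simpa using hd
      simp [hd, this]
    · have : Nat.Coprime p m := by rwa [Nat.Prime.coprime_iff_not_dvd hp]
      rw [if_neg hd, if_pos trivial, if_pos this]; ring
  · intro e he
    have he2 : 2 ≤ e := by
      simp only [Finset.mem_insert, Finset.mem_singleton, not_or] at he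
      omega
    have : mu ((p : ℕ) ^ e) = 0 := by
      unfold mu
      rw [ArithmeticFunction.moebius_eq_zero_of_not_squarefree]
      · simp
      · intro hs
        have := hs p (by rw [← sq]; exact pow_dvd_pow _ he2)
        exact hp.one_lt.ne' (Nat.isUnit_iff.1 this)
    simp [wf, this]

lemma euler_full {a : ℕ → ℝ}
    (ha : ∀ p : ℕ, p.Prime → 0 ≤ a p ∧ a p ≤ 1 / (p : ℝ) ^ 2) :
    HasProd (fun p : Nat.Primes => 1 - a p) (∑' n, wf a n) := by
  have h := euler_restricted ha 1
  have e1 : (fun n => wf a n) = fun n => cp 1 n * wf a n := by funext n; simp [cp]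
  rw [e1]
  convert h using 2 with p
  · have : ¬ (p : ℕ) ∣ 1 := by rw [Nat.dvd_one]; exact p.2.one_lt.ne'
    simp [this]

lemma one_sub_pos {a : ℕ → ℝ}
    (ha : ∀ p : ℕ, p.Prime → 0 ≤ a p ∧ a p ≤ 1 / (p : ℝ) ^ 2) {p : ℕ} (hp : p.Prime) :
    0 < 1 - a p := by
  have h2 : (2 : ℝ) ≤ p := by exact_mod_cast hp.two_le
  have : 1 / (p : ℝ) ^ 2 ≤ 1 / 4 := by
    rw [div_le_div_iff₀ (by positivity) (by norm_num)]; nlinarith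
  linarith [(ha p hp).2]

lemma hasProd_primeFactors (b : ℕ → ℝ) {m : ℕ} (hm : m ≠ 0) :
    HasProd (fun p : Nat.Primes => if (p : ℕ) ∣ m then b p else 1) (∏ p ∈ m.primeFactors, b p) := by
  have h := hasProd_prod_of_ne_finset_one (L := SummationFilter.unconditional _) (f := fun p : Nat.Primes => if (p : ℕ) ∣ m then b p else 1)
    (s := m.primeFactors.subtype Nat.Prime) (by
      intro p hp
      have : ¬ (p : ℕ) ∣ m := by
        intro hd
        apply hp
        refine Finset.mem_subtype.2 ?_
        exact Nat.mem_primeFactors.2 ⟨p.2, hd, hm⟩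
      simp [this])
  convert h using 1
  refine Eq.trans ?_ (Finset.prod_subtype_of_mem (p := Nat.Prime) (fun p => if p ∣ m then b p else 1)
    (fun x hx => Nat.prime_of_mem_primeFactors hx)).symm
  refine Finset.prod_congr rfl fun p hp => ?_
  simp [Nat.dvd_of_mem_primeFactors hp]

lemma euler_cop {a : ℕ → ℝ}
    (ha : ∀ p : ℕ, p.Prime → 0 ≤ a p ∧ a p ≤ 1 / (p : ℝ) ^ 2) {m : ℕ} (hm : m ≠ 0) :
    ∑' n, cp m n * wf a n = (∑' n, wf a n) * ∏ p ∈ m.primeFactors, (1 - a p)⁻¹ := by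
  have h1 := euler_full ha
  have h2 := (euler_restricted ha m).mul (hasProd_primeFactors (fun p => 1 - a p) hm)
  have h3 : (fun p : Nat.Primes => (if (p : ℕ) ∣ m then 1 else 1 - a p) *
      (if (p : ℕ) ∣ m then 1 - a p else 1)) = fun p : Nat.Primes => 1 - a p := by
    funext p; split_ifs <;> simp
  rw [h3] at h2
  have h4 := h2.unique h1
  rw [Finset.prod_inv_distrib, ← h4, mul_assoc, mul_inv_cancel₀, mul_one]
  exact (Finset.prod_pos (fun p hp => one_sub_pos ha (Nat.prime_of_mem_primeFactors hp))).ne'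

lemma wf_sq (n : ℕ) : wf (fun p => 1 / (p : ℝ) ^ 2) n = mu n / (n : ℝ) ^ 2 := by
  unfold wf
  by_cases hs : Squarefree n
  · have h2 : ∏ p ∈ n.primeFactors, (1 / (p : ℝ) ^ 2) = 1 / (n : ℝ) ^ 2 := by
      conv_rhs => rw [← Nat.prod_primeFactors_of_squarefree hs]
      push_cast
      rw [Finset.prod_div_distrib, Finset.prod_pow]
      simp
    rw [h2]; ring
  · have : mu n = 0 := by
      unfold mu; rw [ArithmeticFunction.moebius_eq_zero_of_not_squarefree hs]; simp
    rw [this]; simp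

lemma ha_sq : ∀ p : ℕ, p.Prime → 0 ≤ (fun p : ℕ => 1 / (p : ℝ) ^ 2) p ∧
    (fun p : ℕ => 1 / (p : ℝ) ^ 2) p ≤ 1 / (p : ℝ) ^ 2 := fun p _ => ⟨by positivity, le_rfl⟩

lemma tsum_mu_sq : ∑' n : ℕ, mu n / (n : ℝ) ^ 2 = 6 / Real.pi ^ 2 := by
  have h1 := euler_full ha_sq
  simp only [wf_sq] at h1
  have h2 := riemannZeta_eulerProduct_hasProd (s := 2) (by norm_num)
  rw [riemannZeta_two] at h2
  have h3 : HasProd (fun p : Nat.Primes => (((1 - 1 / ((p : ℕ) : ℝ) ^ 2 : ℝ)) : ℂ))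
      ((∑' n : ℕ, mu n / (n : ℝ) ^ 2 : ℝ) : ℂ) := by
    have := h1.map Complex.ofRealHom Complex.continuous_ofReal
    exact this
  have h4 := h3.mul h2
  have h5 : (fun p : Nat.Primes => (((1 - 1 / ((p : ℕ) : ℝ) ^ 2 : ℝ)) : ℂ) *
      (1 - ((p : ℕ) : ℂ) ^ (-(2 : ℂ)))⁻¹) = fun _ => 1 := by
    funext p
    have e : ((p : ℕ) : ℂ) ^ (-(2 : ℂ)) = ((1 / ((p : ℕ) : ℝ) ^ 2 : ℝ) : ℂ) := by
      rw [Complex.cpow_neg]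
      push_cast
      rw [one_div]
      congr 1
      exact_mod_cast Complex.cpow_natCast ((p : ℕ) : ℂ) 2
    rw [e]
    have hne : (((1 - 1 / ((p : ℕ) : ℝ) ^ 2 : ℝ)) : ℂ) ≠ 0 := by
      exact_mod_cast (one_sub_pos ha_sq p.2).ne'
    push_cast at hne ⊢
    exact mul_inv_cancel₀ hne
  rw [h5] at h4
  have h6 := h4.unique hasProd_one
  have hpi : (Real.pi : ℂ) ≠ 0 := by exact_mod_cast Real.pi_ne_zero
  have h7 : ((∑' n : ℕ, mu n / (n : ℝ) ^ 2 : ℝ) : ℂ) = ((6 / Real.pi ^ 2 : ℝ) : ℂ) := by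
    push_cast at h6 ⊢
    field_simp at h6 ⊢
    linear_combination h6
  exact_mod_cast h7

lemma tsum_cp_mu_sq {m : ℕ} (hm : m ≠ 0) : ∑' n : ℕ, cp m n * (mu n / (n : ℝ) ^ 2) =
    (6 / Real.pi ^ 2) * ∏ p ∈ m.primeFactors, (1 - ((p : ℝ))⁻¹ ^ 2)⁻¹ := by
  have h := euler_cop ha_sq hm
  simp only [wf_sq, tsum_mu_sq] at h
  rw [h]
  simp

end Nun


namespace Nun

open MeasureTheory Filter Topology

/-- `F(u) = {u}(1-{u})` -/
noncomputable def FF (u : ℝ) : ℝ := Int.fract u * (1 - Int.fract u)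

lemma FF_nonneg (u : ℝ) : 0 ≤ FF u :=
  mul_nonneg (Int.fract_nonneg u) (by linarith [Int.fract_lt_one u])

lemma FF_le (u : ℝ) : FF u ≤ 1 / 4 := by
  unfold FF; nlinarith [sq_nonneg (Int.fract u - 1 / 2)]

lemma FF_zero : FF 0 = 0 := by simp [FF]

lemma FF_le_self {u : ℝ} (hu : 0 ≤ u) : FF u ≤ u := by
  have h0 := Int.fract_nonneg u
  have h1 : Int.fract u ≤ u := by
    have : (0 : ℝ) ≤ (⌊u⌋ : ℝ) := by exact_mod_cast Int.floor_nonneg.2 hu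
    rw [Int.fract]; linarith
  unfold FF; nlinarith

lemma FF_ge (x : ℝ) (n : ℤ) : (x - n) * (n + 1 - x) ≤ FF x := by
  unfold FF
  set f := Int.fract x
  have hf0 : 0 ≤ f := Int.fract_nonneg x
  have hf1 : f < 1 := Int.fract_lt_one x
  have hx : x = ⌊x⌋ + f := (Int.floor_add_fract x).symm
  set m := ⌊x⌋
  have key : 0 ≤ ((m : ℝ) - n) * ((m : ℝ) - n - 1 + 2 * f) := by
    rcases lt_trichotomy m n with h | h | h
    · have : (m : ℝ) + 1 ≤ n := by exact_mod_cast h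
      nlinarith
    · rw [h]; simp
    · have : (n : ℝ) + 1 ≤ m := by exact_mod_cast h
      apply mul_nonneg <;> linarith
  rw [hx]
  nlinarith

lemma FF_sub_le (x y : ℝ) : FF x - FF y ≤ 2 * |x - y| := by
  by_cases h : 1 / 4 ≤ |x - y|
  · linarith [FF_le x, FF_nonneg y]
  · push Not at h
    have h1 := FF_ge y ⌊x⌋
    have h2 : FF x = (x - ⌊x⌋) * (⌊x⌋ + 1 - x) := by
      unfold FF; rw [Int.fract]; ring
    have hf0 := Int.fract_nonneg x
    have hf1 := Int.fract_lt_one x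
    rw [Int.fract] at hf0 hf1
    have h3 : FF x - FF y ≤ (x - y) * (2 * ⌊x⌋ + 1 - x - y) := by rw [h2]; nlinarith
    refine h3.trans ((le_abs_self _).trans ?_)
    rw [abs_mul, mul_comm]
    gcongr
    rw [abs_lt] at h
    rw [abs_le]
    constructor <;> linarith

lemma FF_lip (x y : ℝ) : |FF x - FF y| ≤ 2 * |x - y| := by
  rw [abs_le]
  have h1 := FF_sub_le x y
  have h2 := FF_sub_le y x
  rw [abs_sub_comm] at h2
  constructor <;> linarith

lemma FF_continuous : Continuous FF := by
  have : LipschitzWith 2 FF := LipschitzWith.of_dist_le_mul (by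
    intro x y
    rw [Real.dist_eq, Real.dist_eq]
    exact FF_lip x y)
  exact this.continuous

lemma FF_fourier (v : ℝ) :
    HasSum (fun n : ℕ => 1 / (n : ℝ) ^ 2 * (1 - Real.cos (2 * Real.pi * n * v))) (Real.pi ^ 2 * FF v) := by
  have h0 := hasSum_one_div_nat_pow_mul_cos (k := 1) one_ne_zero (x := 0) (by simp)
  have h1 := hasSum_one_div_nat_pow_mul_cos (k := 1) one_ne_zero (x := Int.fract v)
    ⟨Int.fract_nonneg v, (Int.fract_lt_one v).le⟩
  have h2 := h0.sub h1
  have hB : ∀ x : ℝ, Polynomial.eval x (Polynomial.map (algebraMap ℚ ℝ) (Polynomial.bernoulli 2))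
      = x ^ 2 - x + 1 / 6 := by
    intro x
    simp [Polynomial.bernoulli_def, Finset.sum_range_succ, bernoulli_one, bernoulli_two,
      bernoulli_zero]
    ring
  simp only [mul_one, hB] at h2
  have e1 : (fun n : ℕ => 1 / (n : ℝ) ^ 2 * (1 - Real.cos (2 * Real.pi * n * v))) =
      (fun n : ℕ => 1 / (n : ℝ) ^ 2 * Real.cos (2 * Real.pi * n * 0) -
        1 / (n : ℝ) ^ 2 * Real.cos (2 * Real.pi * n * Int.fract v)) := by
    funext n
    have : Real.cos (2 * Real.pi * n * Int.fract v) = Real.cos (2 * Real.pi * n * v) := by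
      have e : 2 * Real.pi * n * Int.fract v = 2 * Real.pi * n * v - ((n * ⌊v⌋ : ℤ) : ℝ) * (2 * Real.pi) := by
        rw [Int.fract]; push_cast; ring
      rw [e, Real.cos_sub_int_mul_two_pi]
    rw [this, mul_zero, Real.cos_zero]
    ring
  have e2 : Real.pi ^ 2 * FF v =
    (-1) ^ (1 + 1) * (2 * Real.pi) ^ 2 / 2 / ((Nat.factorial 2 : ℕ) : ℝ) * (0 ^ 2 - 0 + 1 / 6) -
      (-1) ^ (1 + 1) * (2 * Real.pi) ^ 2 / 2 / ((Nat.factorial 2 : ℕ) : ℝ) *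
        (Int.fract v ^ 2 - Int.fract v + 1 / 6) := by
    unfold FF
    simp [Nat.factorial]
    ring
  rw [e1, e2]
  exact h2

lemma norm_one_sub_exp (w : ℂ) (hw : 0 ≤ w.re) : ‖1 - Complex.exp (-w)‖ ≤ min 2 (2 * ‖w‖) := by
  have h2 : ‖1 - Complex.exp (-w)‖ ≤ 2 := by
    refine (norm_sub_le _ _).trans ?_
    have : ‖Complex.exp (-w)‖ ≤ 1 := by
      rw [Complex.norm_exp]; simpa using hw
    rw [norm_one]; linarith
  refine le_min h2 ?_
  by_cases h : ‖w‖ ≤ 1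
  · have := Complex.norm_exp_sub_one_le (x := -w) (by simpa using h)
    rw [norm_sub_rev]; simpa using this
  · push Not at h; linarith

lemma norm_integrand (b : ℂ) (B : ℝ) (hB1 : 1 ≤ B) (hB : ‖b‖ ≤ B) (hb : 0 ≤ b.re) (x : ℝ) :
    ‖(1 - Complex.exp (-b * (x : ℂ) ^ 2)) / (x : ℂ) ^ 2‖ ≤ 4 * B * (1 + x ^ 2)⁻¹ := by
  by_cases hx : x = 0
  · subst hx; simp; linarith
  have hx2 : 0 < x ^ 2 := by positivity
  have h := norm_one_sub_exp (b * (x : ℂ) ^ 2) (by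
    have : (b * (x : ℂ) ^ 2).re = b.re * x ^ 2 := by
      rw [← Complex.ofReal_pow, Complex.re_mul_ofReal]
    rw [this]; positivity)
  rw [← neg_mul] at h
  rw [norm_div]
  have e1 : ‖(x : ℂ) ^ 2‖ = x ^ 2 := by
    rw [← Complex.ofReal_pow, Complex.norm_real, Real.norm_of_nonneg hx2.le]
  rw [norm_mul, e1] at h
  rw [e1, div_le_iff₀ hx2, ← div_eq_mul_inv, div_mul_eq_mul_div, le_div_iff₀ (by positivity)]
  have ha := h.trans (min_le_left _ _)
  have hb2 := h.trans (min_le_right _ _)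
  have hn := norm_nonneg (1 - Complex.exp (-b * (x : ℂ) ^ 2))
  by_cases hx1 : x ^ 2 ≤ 1
  · nlinarith
  · push Not at hx1
    nlinarith

lemma integrable_bd (B : ℝ) : IntegrableOn (fun x : ℝ => 4 * B * (1 + x ^ 2)⁻¹) (Set.Ioi 0) :=
  (integrable_inv_one_add_sq.const_mul _).integrableOn

lemma meas_integrand (b : ℂ) : AEStronglyMeasurable
    (fun x : ℝ => (1 - Complex.exp (-b * (x : ℂ) ^ 2)) / (x : ℂ) ^ 2) (volume.restrict (Set.Ioi 0)) := by
  apply Measurable.aestronglyMeasurable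
  fun_prop

lemma J_pos (b : ℂ) (hb : 0 < b.re) :
    ∫ x in Set.Ioi (0 : ℝ), (1 - Complex.exp (-b * (x : ℂ) ^ 2)) / (x : ℂ) ^ 2
      = b * ((Real.pi : ℂ) / b) ^ (1 / 2 : ℂ) := by
  set B : ℝ := max 1 ‖b‖
  have hi1 : IntegrableOn (fun x : ℝ => (1 - Complex.exp (-b * (x : ℂ) ^ 2)) / (x : ℂ) ^ 2)
      (Set.Ioi 0) :=
    Integrable.mono' (integrable_bd B) (meas_integrand b)
      (Eventually.of_forall fun x => norm_integrand b B (le_max_left _ _) (le_max_right _ _) hb.le x)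
  have hi2 : IntegrableOn (fun x : ℝ => 2 * b * Complex.exp (-b * (x : ℂ) ^ 2)) (Set.Ioi 0) :=
    ((integrable_cexp_neg_mul_sq hb).const_mul (2 * b)).integrableOn
  set f : ℝ → ℂ := fun x => -((1 - Complex.exp (-b * (x : ℂ) ^ 2)) / (x : ℂ)) with hf
  have hfn : ∀ x : ℝ, ‖f x‖ ≤ 4 * B * (1 + x ^ 2)⁻¹ * |x| := by
    intro x
    by_cases hx : x = 0
    · subst hx; simp [hf]
    have e : f x = -((1 - Complex.exp (-b * (x : ℂ) ^ 2)) / (x : ℂ) ^ 2 * (x : ℂ)) := by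
      have : (x : ℂ) ≠ 0 := by exact_mod_cast hx
      rw [hf]; field_simp
    rw [e, norm_neg, norm_mul, Complex.norm_real, Real.norm_eq_abs]
    gcongr
    exact norm_integrand b B (le_max_left _ _) (le_max_right _ _) hb.le x
  have hB0 : 0 ≤ B := le_trans zero_le_one (le_max_left _ _)
  have h := integral_Ioi_of_hasDerivAt_of_tendsto (a := 0) (m := 0) (f := f)
    (f' := fun x : ℝ => (1 - Complex.exp (-b * (x : ℂ) ^ 2)) / (x : ℂ) ^ 2
      - 2 * b * Complex.exp (-b * (x : ℂ) ^ 2)) ?_ ?_ (hi1.sub hi2) ?_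
  · rw [integral_sub hi1 hi2, integral_const_mul, integral_gaussian_complex_Ioi hb] at h
    have f0 : f 0 = 0 := by simp [hf]
    rw [f0] at h
    linear_combination h
  · have f0 : f 0 = 0 := by simp [hf]
    apply ContinuousAt.continuousWithinAt
    rw [ContinuousAt, f0]
    refine squeeze_zero_norm (a := fun x => 4 * B * |x|) (fun x => (hfn x).trans ?_) ?_
    · have : (1 + x ^ 2)⁻¹ ≤ 1 := inv_le_one_of_one_le₀ (by nlinarith)
      have h4 : 4 * B * (1 + x ^ 2)⁻¹ ≤ 4 * B := by nlinarith
      exact mul_le_mul_of_nonneg_right h4 (abs_nonneg x)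
    · have : Continuous (fun x : ℝ => 4 * B * |x|) := by fun_prop
      simpa using this.tendsto 0
  · intro x hx
    have hx0 : (x : ℂ) ≠ 0 := by
      have : x ≠ 0 := ne_of_gt hx
      exact_mod_cast this
    have hid : HasDerivAt (fun x : ℝ => (x : ℂ)) 1 x := Complex.ofRealCLM.hasDerivAt
    have he : HasDerivAt (fun x : ℝ => Complex.exp (-b * (x : ℂ) ^ 2))
        (Complex.exp (-b * (x : ℂ) ^ 2) * (-b * (2 * x))) x := by
      have h1 : HasDerivAt (fun x : ℝ => -b * (x : ℂ) ^ 2) (-b * (2 * x)) x := by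
        have := (hid.pow 2).const_mul (-b)
        simpa using this
      exact h1.cexp
    have := (((hasDerivAt_const x (1 : ℂ)).sub he).div hid hx0).neg
    convert this using 1
    · rfl
    · simp only [Pi.sub_apply]
      field_simp
      ring
  · refine squeeze_zero_norm' (a := fun x => 4 * B * x⁻¹) ?_ ?_
    · filter_upwards [eventually_gt_atTop 0] with x hx
      refine (hfn x).trans ?_
      rw [abs_of_pos hx, mul_assoc]
      gcongr
      rw [inv_mul_le_iff₀ (by positivity)]
      rw [add_mul]
      have : x ^ 2 * x⁻¹ = x := by field_simp
      rw [this]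
      have : 0 < x⁻¹ := by positivity
      linarith
    · simpa using (tendsto_inv_atTop_zero).const_mul (4 * B)

lemma cos_integrable (A : ℝ) :
    IntegrableOn (fun x : ℝ => (1 - Real.cos (A * x ^ 2)) / x ^ 2) (Set.Ioi 0) ∧
    (0 < A → ∫ x in Set.Ioi (0 : ℝ), (1 - Real.cos (A * x ^ 2)) / x ^ 2 = Real.sqrt (Real.pi * A / 2)) := by
  set b : ℂ := A * Complex.I with hb
  have hre : ∀ x : ℝ, ((1 - Complex.exp (-b * (x : ℂ) ^ 2)) / (x : ℂ) ^ 2).re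
      = (1 - Real.cos (A * x ^ 2)) / x ^ 2 := by
    intro x
    rw [← Complex.ofReal_pow, Complex.div_ofReal_re]
    congr 1
    have : -b * ((x ^ 2 : ℝ) : ℂ) = ((-(A * x ^ 2) : ℝ) : ℂ) * Complex.I := by
      rw [hb]; push_cast; ring
    rw [this, Complex.sub_re, Complex.exp_ofReal_mul_I_re, Real.cos_neg]
    simp
  set B : ℝ := 1 + |A|
  have hB1 : 1 ≤ B := by have := abs_nonneg A; simp [B]
  have hi1 : IntegrableOn (fun x : ℝ => (1 - Complex.exp (-b * (x : ℂ) ^ 2)) / (x : ℂ) ^ 2)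
      (Set.Ioi 0) :=
    Integrable.mono' (integrable_bd B) (meas_integrand b)
      (Eventually.of_forall fun x => norm_integrand b B hB1 (by simp [hb, B]) (by simp [hb]) x)
  constructor
  · have := hi1.re
    refine this.congr (Eventually.of_forall fun x => ?_)
    exact hre x
  intro hA
  have hlim : Tendsto (fun k : ℕ => ∫ x in Set.Ioi (0 : ℝ),
      (1 - Complex.exp (-(((1 / ((k : ℝ) + 1) : ℝ) : ℂ) + b) * (x : ℂ) ^ 2)) / (x : ℂ) ^ 2) atTop
      (𝓝 (∫ x in Set.Ioi (0 : ℝ), (1 - Complex.exp (-b * (x : ℂ) ^ 2)) / (x : ℂ) ^ 2)) := by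
    refine tendsto_integral_of_dominated_convergence (fun x : ℝ => 4 * B * (1 + x ^ 2)⁻¹)
      (fun k => meas_integrand _) (integrable_bd B) ?_ ?_
    · intro k
      refine Eventually.of_forall fun x => norm_integrand _ B hB1 ?_ ?_ x
      · refine (norm_add_le _ _).trans ?_
        have : (1 / ((k : ℝ) + 1)) ≤ 1 := by
          rw [div_le_one (by positivity)]
          have : (0 : ℝ) ≤ k := by positivity
          linarith
        rw [Complex.norm_real, Real.norm_of_nonneg (by positivity)]
        simp only [hb, B, norm_mul, Complex.norm_real, Complex.norm_I, mul_one, Real.norm_eq_abs]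
        linarith
      · have : (0 : ℝ) ≤ 1 / ((k : ℝ) + 1) := by positivity
        rw [Complex.add_re, Complex.ofReal_re, hb]
        simpa using this
    · refine Eventually.of_forall fun x => ?_
      have h1 : Tendsto (fun k : ℕ => (((1 / ((k : ℝ) + 1) : ℝ) : ℂ) + b)) atTop (𝓝 b) := by
        have := (Complex.continuous_ofReal.tendsto 0).comp tendsto_one_div_add_atTop_nhds_zero_nat
        simpa using this.add_const b
      have hc : Continuous (fun c : ℂ => (1 - Complex.exp (-c * (x : ℂ) ^ 2)) / (x : ℂ) ^ 2) := by
        fun_prop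
      exact (hc.tendsto b).comp h1
  have hb0 : b ≠ 0 := by
    rw [hb]; simp [hA.ne']
  have hlim2 : Tendsto (fun k : ℕ => ∫ x in Set.Ioi (0 : ℝ),
      (1 - Complex.exp (-(((1 / ((k : ℝ) + 1) : ℝ) : ℂ) + b) * (x : ℂ) ^ 2)) / (x : ℂ) ^ 2) atTop
      (𝓝 (b * ((Real.pi : ℂ) / b) ^ (1 / 2 : ℂ))) := by
    have h1 : Tendsto (fun k : ℕ => (((1 / ((k : ℝ) + 1) : ℝ) : ℂ) + b)) atTop (𝓝 b) := by
      have := (Complex.continuous_ofReal.tendsto 0).comp tendsto_one_div_add_atTop_nhds_zero_nat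
      simpa using this.add_const b
    have hc : ContinuousAt (fun c : ℂ => c * ((Real.pi : ℂ) / c) ^ (1 / 2 : ℂ)) b := by
      refine continuousAt_id.mul (ContinuousAt.cpow (continuousAt_const.div continuousAt_id hb0)
        continuousAt_const ?_)
      right
      have : (Real.pi : ℂ) / b = ((-(Real.pi / A) : ℝ) : ℂ) * Complex.I := by
        rw [hb]
        have : (A : ℂ) ≠ 0 := by exact_mod_cast hA.ne'
        push_cast
        field_simp
        rw [Complex.I_sq]; ring
      rw [this]
      have hp := Real.pi_pos
      simp [hA.ne']
    refine (hc.tendsto.comp h1).congr fun k => ?_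
    rw [J_pos]
    · rfl
    · have : (0 : ℝ) < 1 / ((k : ℝ) + 1) := by positivity
      rw [Complex.add_re, Complex.ofReal_re, hb]
      simpa using this
  have h3 := tendsto_nhds_unique hlim hlim2
  have h4 : ∫ x in Set.Ioi (0 : ℝ), (1 - Real.cos (A * x ^ 2)) / x ^ 2 =
      (∫ x in Set.Ioi (0 : ℝ), (1 - Complex.exp (-b * (x : ℂ) ^ 2)) / (x : ℂ) ^ 2).re := by
    have := integral_re (𝕜 := ℂ) hi1
    refine Eq.trans ?_ this
    refine integral_congr_ae (Eventually.of_forall fun x => ?_)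
    exact (hre x).symm
  rw [h4, h3]
  set r : ℝ := Real.sqrt (Real.pi / (2 * A)) with hr
  have hr2 : r ^ 2 = Real.pi / (2 * A) := Real.sq_sqrt (by have := Real.pi_pos; positivity)
  have hrpos : 0 < r := Real.sqrt_pos.2 (by have := Real.pi_pos; positivity)
  have hs : (Real.pi : ℂ) / b = ((r : ℂ) - r * Complex.I) ^ 2 := by
    have hA' : (A : ℂ) ≠ 0 := by exact_mod_cast hA.ne'
    have hr2' : (r : ℂ) ^ 2 = Real.pi / (2 * A) := by exact_mod_cast congrArg (fun t : ℝ => (t : ℂ)) hr2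
    have : ((r : ℂ) - r * Complex.I) ^ 2 = (r : ℂ) ^ 2 * (-2 * Complex.I) := by
      ring_nf; rw [Complex.I_sq]; ring
    rw [this, hr2', hb]
    field_simp
    rw [Complex.I_sq]; ring
  rw [hs]
  have h5 : (((r : ℂ) - r * Complex.I) ^ 2) ^ (1 / 2 : ℂ) = (r : ℂ) - r * Complex.I := by
    rw [one_div]
    apply Complex.sq_cpow_two_inv
    simp [hrpos]
  rw [h5]
  have h6 : (b * ((r : ℂ) - r * Complex.I)).re = A * r := by
    rw [hb]; simp
  rw [h6]
  symm
  rw [Real.sqrt_eq_iff_mul_self_eq (by have := Real.pi_pos; positivity) (by positivity)]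
  have : A * r * (A * r) = A ^ 2 * r ^ 2 := by ring
  rw [this, hr2]; field_simp

end Nun


namespace Nun

open MeasureTheory Filter Topology

lemma cosinv_integrable (A : ℝ) :
    IntegrableOn (fun t : ℝ => 1 - Real.cos (A * (1 / t ^ 2))) (Set.Ioi 0) ∧
    (0 < A → ∫ t in Set.Ioi (0 : ℝ), (1 - Real.cos (A * (1 / t ^ 2))) = Real.sqrt (Real.pi * A / 2)) := by
  obtain ⟨h1, h2⟩ := cos_integrable A
  have hcong : Set.EqOn (fun x : ℝ => (|(-1 : ℝ)| * x ^ ((-1 : ℝ) - 1)) •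
      ((fun t : ℝ => 1 - Real.cos (A * (1 / t ^ 2))) (x ^ (-1 : ℝ))))
      (fun x : ℝ => (1 - Real.cos (A * x ^ 2)) / x ^ 2) (Set.Ioi 0) := by
    intro x hx
    have hx' : (0 : ℝ) < x := hx
    have e : x ^ ((-1 : ℝ) - 1) = (x ^ 2)⁻¹ := by
      rw [show (-1 : ℝ) - 1 = -((2 : ℕ) : ℝ) by norm_num, Real.rpow_neg hx'.le, Real.rpow_natCast]
    simp only [e, Real.rpow_neg_one, smul_eq_mul, abs_neg, abs_one, one_mul, inv_pow, one_div, inv_inv]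
    field_simp
  constructor
  · rw [← integrableOn_Ioi_comp_rpow_iff (fun t : ℝ => 1 - Real.cos (A * (1 / t ^ 2)))
      (p := -1) (by norm_num)]
    exact (integrableOn_congr_fun hcong measurableSet_Ioi).2 h1
  · intro hA
    rw [← h2 hA, ← integral_comp_rpow_Ioi (fun t : ℝ => 1 - Real.cos (A * (1 / t ^ 2)))
      (p := -1) (by norm_num)]
    exact setIntegral_congr_fun measurableSet_Ioi hcong

/-- the constant -/
noncomputable def cF : ℝ := ∫ t in Set.Ioi (0 : ℝ), FF (1 / t ^ 2)

lemma cF_eq : cF = (riemannZeta (3 / 2)).re / Real.pi := by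
  have hpi := Real.pi_pos
  have hF : ∀ n : ℕ, IntegrableOn (fun t : ℝ => 1 / (n : ℝ) ^ 2 *
      (1 - Real.cos (2 * Real.pi * n * (1 / t ^ 2)))) (Set.Ioi 0) := fun n =>
    (cosinv_integrable (2 * Real.pi * n)).1.const_mul _
  have hI : ∀ n : ℕ, ∫ t in Set.Ioi (0 : ℝ), 1 / (n : ℝ) ^ 2 *
      (1 - Real.cos (2 * Real.pi * n * (1 / t ^ 2))) = Real.pi * (1 / (n : ℝ) ^ (3 / 2 : ℝ)) := by
    intro n
    rw [integral_const_mul]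
    rcases Nat.eq_zero_or_pos n with h | h
    · subst h; simp
    · have hn : (0 : ℝ) < n := by exact_mod_cast h
      rw [(cosinv_integrable (2 * Real.pi * n)).2 (by positivity)]
      have : Real.pi * (2 * Real.pi * n) / 2 = Real.pi ^ 2 * n := by ring
      rw [this, Real.sqrt_mul (by positivity), Real.sqrt_sq hpi.le, Real.sqrt_eq_rpow]
      have e : (n : ℝ) ^ (3 / 2 : ℝ) * (n : ℝ) ^ (1 / 2 : ℝ) = (n : ℝ) ^ 2 := by
        rw [← Real.rpow_add hn, ← Real.rpow_natCast]; norm_num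
      have h1 : (0 : ℝ) < (n : ℝ) ^ (3 / 2 : ℝ) := by positivity
      have h2 : (0 : ℝ) < (n : ℝ) ^ (1 / 2 : ℝ) := by positivity
      rw [← e]; field_simp
  have hs : Summable fun n : ℕ => Real.pi * (1 / (n : ℝ) ^ (3 / 2 : ℝ)) :=
    (Real.summable_one_div_nat_rpow.2 (by norm_num)).mul_left _
  have h := hasSum_integral_of_summable_integral_norm hF (by
    refine hs.congr fun n => ?_
    rw [← hI n]
    refine integral_congr_ae (Eventually.of_forall fun t => ?_)
    have : (0:ℝ) ≤ 1 / (n : ℝ) ^ 2 * (1 - Real.cos (2 * Real.pi * n * (1 / t ^ 2))) :=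
      mul_nonneg (by positivity) (by linarith [Real.cos_le_one (2 * Real.pi * n * (1 / t ^ 2))])
    exact (Real.norm_of_nonneg this).symm)
  have e1 : (fun t : ℝ => ∑' n : ℕ, 1 / (n : ℝ) ^ 2 *
      (1 - Real.cos (2 * Real.pi * n * (1 / t ^ 2)))) = fun t => Real.pi ^ 2 * FF (1 / t ^ 2) := by
    funext t
    exact (FF_fourier (1 / t ^ 2)).tsum_eq
  rw [e1, integral_const_mul] at h
  have e2 : (fun n : ℕ => ∫ t in Set.Ioi (0 : ℝ), 1 / (n : ℝ) ^ 2 *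
      (1 - Real.cos (2 * Real.pi * n * (1 / t ^ 2)))) = fun n : ℕ => Real.pi * (1 / (n : ℝ) ^ (3 / 2 : ℝ)) :=
    funext hI
  rw [e2] at h
  have hz : (riemannZeta (3 / 2)).re = ∑' n : ℕ, 1 / (n : ℝ) ^ (3 / 2 : ℝ) := by
    rw [zeta_eq_tsum_one_div_nat_cpow (by norm_num)]
    have : ∀ n : ℕ, (1 : ℂ) / (n : ℂ) ^ (3 / 2 : ℂ) = ((1 / (n : ℝ) ^ (3 / 2 : ℝ) : ℝ) : ℂ) := by
      intro n
      rw [Complex.ofReal_div, Complex.ofReal_cpow (by positivity)]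
      push_cast; rfl
    simp_rw [this]
    rw [← Complex.ofReal_tsum, Complex.ofReal_re]
  have h3 := h.tsum_eq
  rw [tsum_mul_left, ← hz] at h3
  change Real.pi * _ = Real.pi ^ 2 * cF at h3
  rw [eq_div_iff hpi.ne']
  have : Real.pi * (cF * Real.pi - (riemannZeta (3 / 2)).re) = 0 := by linarith
  rcases mul_eq_zero.1 this with h | h
  · exact absurd h hpi.ne'
  · linarith

lemma FFsq_integrable {u : ℝ} (hu : 0 ≤ u) :
    IntegrableOn (fun t : ℝ => FF (u / t ^ 2)) (Set.Ioi 0) := by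
  refine Integrable.mono' (integrable_bd (1 + u)) ?_ ?_
  · refine Measurable.aestronglyMeasurable ?_
    exact FF_continuous.measurable.comp (by fun_prop)
  · refine Eventually.of_forall fun t => ?_
    rw [Real.norm_of_nonneg (FF_nonneg _), ← div_eq_mul_inv, le_div_iff₀ (by positivity)]
    by_cases ht : t ^ 2 ≤ 1
    · nlinarith [FF_le (u / t ^ 2), FF_nonneg (u / t ^ 2)]
    · push Not at ht
      have h1 := FF_le_self (u := u / t ^ 2) (by positivity)
      rw [le_div_iff₀ (by positivity)] at h1
      nlinarith [FF_nonneg (u / t ^ 2), FF_le (u / t ^ 2)]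

lemma FFsq_integral {u : ℝ} (hu : 0 < u) :
    ∫ t in Set.Ioi (0 : ℝ), FF (u / t ^ 2) = Real.sqrt u * cF := by
  have hs : 0 < Real.sqrt u := Real.sqrt_pos.2 hu
  have h := integral_comp_mul_left_Ioi (fun t : ℝ => FF (u / t ^ 2)) 0 hs
  rw [mul_zero, smul_eq_mul] at h
  have e : (fun x : ℝ => FF (u / (Real.sqrt u * x) ^ 2)) = fun x : ℝ => FF (1 / x ^ 2) := by
    funext x
    rw [mul_pow, Real.sq_sqrt hu.le, ← div_div, div_self hu.ne']
  rw [e] at h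
  change cF = _ at h
  rw [h]; field_simp

lemma cF_nonneg : 0 ≤ cF := by
  unfold cF
  exact integral_nonneg fun t => FF_nonneg _

/-- the sum over squares -/
noncomputable def Phi (u : ℝ) : ℝ := ∑' j : ℕ, FF (u / (j : ℝ) ^ 2)

lemma FFsq_le {u : ℝ} (hu : 0 ≤ u) (j : ℕ) : FF (u / (j : ℝ) ^ 2) ≤ u * (1 / (j : ℝ) ^ 2) := by
  have := FF_le_self (u := u / (j : ℝ) ^ 2) (by positivity)
  rwa [div_eq_mul_one_div] at this ⊢

lemma Phi_summable {u : ℝ} (hu : 0 ≤ u) : Summable fun j : ℕ => FF (u / (j : ℝ) ^ 2) :=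
  Summable.of_nonneg_of_le (fun j => FF_nonneg _) (fun j => FFsq_le hu j)
    ((Real.summable_one_div_nat_pow.2 (by norm_num)).mul_left u)

lemma Phi_step {u : ℝ} (hu : 0 ≤ u) (j : ℕ) :
    |FF (u / ((j + 1 : ℕ) : ℝ) ^ 2) - ∫ t in (j : ℝ)..((j + 1 : ℕ) : ℝ), FF (u / t ^ 2)| ≤ 1 / 4 ∧
    (1 ≤ j → |FF (u / ((j + 1 : ℕ) : ℝ) ^ 2) - ∫ t in (j : ℝ)..((j + 1 : ℕ) : ℝ), FF (u / t ^ 2)|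
      ≤ 2 * (u / (j : ℝ) ^ 2 - u / ((j + 1 : ℕ) : ℝ) ^ 2)) := by
  have hi : IntervalIntegrable (fun t : ℝ => FF (u / t ^ 2)) volume j ((j + 1 : ℕ) : ℝ) := by
    rw [intervalIntegrable_iff_integrableOn_Ioc_of_le (by push_cast; linarith)]
    refine (FFsq_integrable hu).mono_set fun t ht => ?_
    have : (0 : ℝ) ≤ j := by positivity
    exact lt_of_le_of_lt this ht.1
  have e : FF (u / ((j + 1 : ℕ) : ℝ) ^ 2) - ∫ t in (j : ℝ)..((j + 1 : ℕ) : ℝ), FF (u / t ^ 2)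
      = ∫ t in (j : ℝ)..((j + 1 : ℕ) : ℝ), (FF (u / ((j + 1 : ℕ) : ℝ) ^ 2) - FF (u / t ^ 2)) := by
    rw [intervalIntegral.integral_sub intervalIntegrable_const hi]
    simp
  rw [e, ← Real.norm_eq_abs]
  have hle : (j : ℝ) ≤ ((j + 1 : ℕ) : ℝ) := by push_cast; linarith
  have key : ∀ c : ℝ, (∀ t ∈ Set.Ioc (j : ℝ) ((j + 1 : ℕ) : ℝ),
      ‖FF (u / ((j + 1 : ℕ) : ℝ) ^ 2) - FF (u / t ^ 2)‖ ≤ c) →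
      ‖∫ t in (j : ℝ)..((j + 1 : ℕ) : ℝ), (FF (u / ((j + 1 : ℕ) : ℝ) ^ 2) - FF (u / t ^ 2))‖ ≤ c := by
    intro c hc
    have := intervalIntegral.norm_integral_le_of_norm_le_const (a := (j : ℝ)) (b := ((j + 1 : ℕ) : ℝ))
      (f := fun t => FF (u / ((j + 1 : ℕ) : ℝ) ^ 2) - FF (u / t ^ 2)) (C := c) (by
        rw [Set.uIoc_of_le hle]; exact hc)
    refine this.trans (le_of_eq ?_)
    push_cast; simp
  constructor
  · apply key
    intro t _
    rw [Real.norm_eq_abs, abs_le]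
    constructor <;> linarith [FF_nonneg (u / t ^ 2), FF_le (u / t ^ 2),
      FF_nonneg (u / ((j + 1 : ℕ) : ℝ) ^ 2), FF_le (u / ((j + 1 : ℕ) : ℝ) ^ 2)]
  · intro hj
    have hj0 : (0 : ℝ) < j := by exact_mod_cast hj
    apply key
    intro t ht
    have ht0 : 0 < t := lt_trans hj0 ht.1
    refine (FF_lip _ _).trans ?_
    have h1 : u / t ^ 2 ≤ u / (j : ℝ) ^ 2 := by gcongr; exact ht.1.le
    have h2 : u / ((j + 1 : ℕ) : ℝ) ^ 2 ≤ u / t ^ 2 := by gcongr; exact ht.2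
    rw [abs_sub_comm, abs_of_nonneg (by linarith)]
    linarith

lemma Phi_approx_J {u : ℝ} (hu : 0 < u) {J : ℕ} (hJ : 1 ≤ J) :
    |Phi u - Real.sqrt u * cF| ≤ J / 4 + 2 * (u / (J : ℝ) ^ 2) := by
  set b : ℕ → ℝ := fun j => FF (u / ((j + 1 : ℕ) : ℝ) ^ 2) -
    ∫ t in (j : ℝ)..((j + 1 : ℕ) : ℝ), FF (u / t ^ 2) with hb
  have h1 : ∀ n, ∑ j ∈ Finset.range n, |b j| ≤ n / 4 := by
    intro n
    refine (Finset.sum_le_card_nsmul _ _ (1 / 4) fun j _ => (Phi_step hu.le j).1).trans (le_of_eq ?_)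
    simp; ring
  have h2 : ∀ n, J ≤ n → ∑ j ∈ Finset.range n, |b j| ≤ J / 4 + 2 * (u / (J : ℝ) ^ 2) - 2 * (u / (n : ℝ) ^ 2) := by
    intro n hn
    induction n, hn using Nat.le_induction with
    | base => linarith [h1 J]
    | succ n hn ih =>
      rw [Finset.sum_range_succ]
      have := (Phi_step hu.le n).2 (hJ.trans hn)
      change |b n| ≤ _ at this
      linarith
  have h3 : Tendsto (fun n => ∑ j ∈ Finset.range n, b j) atTop (𝓝 (Phi u - Real.sqrt u * cF)) := by
    have e : ∀ n, ∑ j ∈ Finset.range n, b j = ∑ j ∈ Finset.range n, FF (u / ((j + 1 : ℕ) : ℝ) ^ 2)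
        - ∫ t in (0 : ℝ)..(n : ℝ), FF (u / t ^ 2) := by
      intro n
      rw [hb, Finset.sum_sub_distrib]
      congr 1
      have := intervalIntegral.sum_integral_adjacent_intervals (f := fun t : ℝ => FF (u / t ^ 2))
        (μ := volume) (a := fun k : ℕ => (k : ℝ)) (n := n) (by
          intro k _
          rw [intervalIntegrable_iff_integrableOn_Ioc_of_le (by push_cast; linarith)]
          refine (FFsq_integrable hu.le).mono_set fun t ht => ?_
          have : (0 : ℝ) ≤ k := by positivity
          exact lt_of_le_of_lt this ht.1)
      simpa using this
    simp_rw [e]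
    refine Tendsto.sub ?_ ?_
    · have hs := (Phi_summable hu.le).hasSum
      have := (hasSum_nat_add_iff' 1).2 hs
      have h := this.tendsto_sum_nat
      simpa [FF_zero, Phi] using h
    · rw [← FFsq_integral hu]
      exact intervalIntegral_tendsto_integral_Ioi 0 (FFsq_integrable hu.le) tendsto_natCast_atTop_atTop
  refine le_of_tendsto h3.abs ?_
  filter_upwards [eventually_ge_atTop J] with n hn
  refine (Finset.abs_sum_le_sum_abs _ _).trans ((h2 n hn).trans ?_)
  have : 0 ≤ u / (n : ℝ) ^ 2 := by positivity
  linarith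

lemma Phi_approx : ∃ C : ℝ, 0 < C ∧ ∀ u : ℝ, 0 < u → |Phi u - Real.sqrt u * cF| ≤ C * u ^ (1 / 3 : ℝ) := by
  set Z : ℝ := ∑' j : ℕ, 1 / (j : ℝ) ^ 2 with hZ
  have hZ0 : 0 ≤ Z := tsum_nonneg fun j => by positivity
  refine ⟨3 + Z + cF, by linarith [cF_nonneg], fun u hu => ?_⟩
  have hu3 : 0 < u ^ (1 / 3 : ℝ) := by positivity
  have hc := cF_nonneg
  by_cases h1 : 1 ≤ u
  · set J := ⌈u ^ (1 / 3 : ℝ)⌉₊ with hJ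
    have hv : 1 ≤ u ^ (1 / 3 : ℝ) := Real.one_le_rpow h1 (by norm_num)
    have hJ1 : 1 ≤ J := Nat.one_le_iff_ne_zero.2 (by
      have : 0 < J := Nat.ceil_pos.2 (by positivity)
      omega)
    have hJ2 : u ^ (1 / 3 : ℝ) ≤ J := Nat.le_ceil _
    have hJ3 : (J : ℝ) < u ^ (1 / 3 : ℝ) + 1 := Nat.ceil_lt_add_one (by positivity)
    have h := Phi_approx_J hu hJ1
    set v := u ^ (1 / 3 : ℝ) with hvd
    have huv : u = v ^ 3 := by
      rw [hvd, ← Real.rpow_natCast, ← Real.rpow_mul hu.le]; norm_num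
    have h4 : u / (J : ℝ) ^ 2 ≤ v := by
      rw [div_le_iff₀ (by positivity), huv]
      have : v ^ 2 ≤ (J : ℝ) ^ 2 := by gcongr
      nlinarith
    nlinarith
  · push Not at h1
    have hΦ0 : 0 ≤ Phi u := tsum_nonneg fun j => FF_nonneg _
    have hΦ : Phi u ≤ u * Z := by
      rw [hZ, ← tsum_mul_left]
      exact (Phi_summable hu.le).tsum_le_tsum (fun j => FFsq_le hu.le j)
        ((Real.summable_one_div_nat_pow.2 (by norm_num)).mul_left u)
    have e1 : u ≤ u ^ (1 / 3 : ℝ) := by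
      conv_lhs => rw [← Real.rpow_one u]
      exact Real.rpow_le_rpow_of_exponent_ge hu h1.le (by norm_num)
    have e2 : Real.sqrt u ≤ u ^ (1 / 3 : ℝ) := by
      rw [Real.sqrt_eq_rpow]
      exact Real.rpow_le_rpow_of_exponent_ge hu h1.le (by norm_num)
    have e3 := Real.sqrt_nonneg u
    rw [abs_le]
    constructor <;> nlinarith

end Nun


namespace Nun

open MeasureTheory Filter Topology

lemma cp_mul (m a b : ℕ) : cp m (a * b) = cp m a * cp m b := by
  unfold cp
  have h := @Nat.coprime_mul_iff_left a b m
  split_ifs <;> simp_all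

lemma cp_sq (m a : ℕ) : cp m a * cp m a = cp m a := by
  unfold cp; split_ifs <;> simp

lemma tsum_dvd (f : ℕ → ℝ) {c : ℕ} (hc : c ≠ 0) :
    ∑' g : ℕ, (if c ∣ g then f g else 0) = ∑' j : ℕ, f (c * j) := by
  have hinj : Function.Injective (fun j : ℕ => c * j) := fun a b h => by
    exact Nat.eq_of_mul_eq_mul_left (Nat.pos_of_ne_zero hc) h
  rw [← hinj.tsum_eq (f := fun g : ℕ => if c ∣ g then f g else 0)]
  · simp
  · intro g hg
    rw [Function.mem_support] at hg
    by_cases h : c ∣ g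
    · obtain ⟨j, rfl⟩ := h; exact ⟨j, rfl⟩
    · simp [h] at hg

/-- coprime version of Phi -/
lemma Phi_cop {m : ℕ} (hm : m ≠ 0) {u : ℝ} (hu : 0 ≤ u) :
    ∑' j : ℕ, cp m j * FF (u / (j : ℝ) ^ 2) = ∑ c ∈ m.divisors, mu c * Phi (u / (c : ℝ) ^ 2) := by
  have e : ∀ j : ℕ, cp m j * FF (u / (j : ℝ) ^ 2) =
      ∑ c ∈ m.divisors, mu c * (if c ∣ j then FF (u / (j : ℝ) ^ 2) else 0) := by
    intro j
    rw [cp_eq hm, Finset.sum_mul, Finset.sum_filter]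
    refine Finset.sum_congr rfl fun c _ => ?_
    split_ifs <;> simp
  simp_rw [e]
  have hs : ∀ c : ℕ, Summable fun j : ℕ => (if c ∣ j then FF (u / (j : ℝ) ^ 2) else 0) := by
    intro c
    refine Summable.of_nonneg_of_le (fun j => ?_) (fun j => ?_) (Phi_summable hu)
    · split_ifs
      · exact FF_nonneg _
      · exact le_rfl
    · split_ifs
      · exact le_rfl
      · exact FF_nonneg _
  rw [Summable.tsum_finsetSum (fun c _ => (hs c).mul_left _)]
  refine Finset.sum_congr rfl fun c hc => ?_
  rw [tsum_mul_left, tsum_dvd _ (Nat.pos_of_mem_divisors hc).ne']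
  congr 1
  unfold Phi
  refine tsum_congr fun j => ?_
  congr 1
  push_cast
  rw [mul_pow, div_div]

lemma Phi_cop_approx : ∃ C : ℝ, 0 < C ∧ ∀ (m : ℕ), m ≠ 0 → ∀ u : ℝ, 0 < u →
    |∑' j : ℕ, cp m j * FF (u / (j : ℝ) ^ 2) - Real.sqrt u * cF * ((m.totient : ℝ) / m)|
      ≤ C * m.divisors.card * u ^ (1 / 3 : ℝ) := by
  obtain ⟨C, hC, h⟩ := Phi_approx
  refine ⟨C, hC, fun m hm u hu => ?_⟩
  rw [Phi_cop hm hu.le, ← sum_mu_div hm, Finset.mul_sum, ← Finset.sum_sub_distrib]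
  refine (Finset.abs_sum_le_sum_abs _ _).trans ?_
  have : ∀ c ∈ m.divisors, |mu c * Phi (u / (c : ℝ) ^ 2) - Real.sqrt u * cF * (mu c / c)|
      ≤ C * u ^ (1 / 3 : ℝ) := by
    intro c hc
    have hc0 : 0 < c := Nat.pos_of_mem_divisors hc
    have hc1 : (1 : ℝ) ≤ c := by exact_mod_cast hc0
    have e : mu c * Phi (u / (c : ℝ) ^ 2) - Real.sqrt u * cF * (mu c / c) =
        mu c * (Phi (u / (c : ℝ) ^ 2) - Real.sqrt (u / (c : ℝ) ^ 2) * cF) := by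
      rw [Real.sqrt_div hu.le, Real.sqrt_sq (by positivity)]; ring
    rw [e, abs_mul]
    have h1 := h (u / (c : ℝ) ^ 2) (by positivity)
    have h2 : (u / (c : ℝ) ^ 2) ^ (1 / 3 : ℝ) ≤ u ^ (1 / 3 : ℝ) := by
      apply Real.rpow_le_rpow (by positivity) _ (by norm_num)
      exact div_le_self hu.le (one_le_pow₀ hc1)
    calc _ ≤ 1 * (C * u ^ (1 / 3 : ℝ)) := by
          gcongr
          · exact mu_abs_le c
          · exact h1.trans (by gcongr)
      _ = _ := one_mul _
  refine (Finset.sum_le_card_nsmul _ _ _ this).trans (le_of_eq ?_)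
  rw [nsmul_eq_mul]; ring

/-- the function Psi -/
noncomputable def Psi (m : ℕ) (Y : ℝ) : ℝ := ∑' g : ℕ, cp m g * mu g ^ 2 * FF (Y / (g : ℝ) ^ 2)

noncomputable def lam (m : ℕ) : ℝ := (m.totient : ℝ) / m * ∑' n : ℕ, cp m n * (mu n / (n : ℝ) ^ 2)

lemma tsum_sq_mu {g : ℕ} (hg : g ≠ 0) : ∑' b : ℕ, (if b ^ 2 ∣ g then mu b else 0) = mu g ^ 2 := by
  rw [← sq_identity hg le_rfl, tsum_eq_sum (s := Finset.Icc 1 g), Finset.sum_filter]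
  intro b hb
  split_ifs with h
  · by_cases hb0 : b = 0
    · rw [hb0, mu_zero]
    · exfalso
      apply hb
      rw [Finset.mem_Icc]
      refine ⟨Nat.pos_of_ne_zero hb0, ?_⟩
      have := Nat.le_of_dvd (Nat.pos_of_ne_zero hg) h
      nlinarith [Nat.pos_of_ne_zero hb0]
  · rfl

lemma Psi_eq (m : ℕ) {Y : ℝ} (hY : 0 ≤ Y) :
    Summable (fun b : ℕ => mu b * cp m b * ∑' j : ℕ, cp m j * FF ((Y / (b : ℝ) ^ 4) / (j : ℝ) ^ 2)) ∧
    Psi m Y = ∑' b : ℕ, mu b * cp m b * ∑' j : ℕ, cp m j * FF ((Y / (b : ℝ) ^ 4) / (j : ℝ) ^ 2) := by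
  set H : ℕ → ℕ → ℝ := fun g b => cp m g * (if b ^ 2 ∣ g then mu b else 0) * FF (Y / (g : ℝ) ^ 2) with hH
  have hs : Summable (Function.uncurry H) := by
    have h1 : Summable fun g : ℕ => 1 / (g : ℝ) ^ (5 / 4 : ℝ) :=
      Real.summable_one_div_nat_rpow.2 (by norm_num)
    have h2 : Summable fun g : ℕ => 1 / (g : ℝ) ^ (3 / 2 : ℝ) :=
      Real.summable_one_div_nat_rpow.2 (by norm_num)
    have h3 := (h1.mul_of_nonneg h2 (fun g => by positivity) (fun g => by positivity)).mul_left Y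
    refine Summable.of_norm_bounded h3 ?_
    rintro ⟨g, b⟩
    change ‖H g b‖ ≤ Y * (1 / (g : ℝ) ^ (5 / 4 : ℝ) * (1 / (b : ℝ) ^ (3 / 2 : ℝ)))
    have hR : 0 ≤ Y * (1 / (g : ℝ) ^ (5 / 4 : ℝ) * (1 / (b : ℝ) ^ (3 / 2 : ℝ))) := by positivity
    by_cases hg : g = 0
    · simp only [hH, hg]; simp [FF_zero]
    by_cases hb : b = 0
    · simp only [hH, hb]; simp [mu_zero]
    by_cases hd : b ^ 2 ∣ g
    · have hgp : (0 : ℝ) < g := by exact_mod_cast Nat.pos_of_ne_zero hg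
      have hbp : (0 : ℝ) < b := by exact_mod_cast Nat.pos_of_ne_zero hb
      have hle : ((b : ℝ) ^ 2) ≤ g := by exact_mod_cast Nat.le_of_dvd (Nat.pos_of_ne_zero hg) hd
      have hF : FF (Y / (g : ℝ) ^ 2) ≤ Y / (g : ℝ) ^ 2 := FF_le_self (by positivity)
      simp only [hH, hd, if_true, norm_mul, Real.norm_eq_abs]
      rw [abs_of_nonneg (cp_nonneg _ _), abs_of_nonneg (FF_nonneg _)]
      calc cp m g * |mu b| * FF (Y / (g : ℝ) ^ 2) ≤ 1 * 1 * (Y / (g : ℝ) ^ 2) := by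
            have := cp_nonneg m g
            have := FF_nonneg (Y / (g : ℝ) ^ 2)
            gcongr
            · exact cp_le_one _ _
            · exact mu_abs_le b
        _ = Y * (1 / (g : ℝ) ^ 2) := by ring
        _ ≤ _ := by
            gcongr
            rw [one_div_mul_one_div]
            apply one_div_le_one_div_of_le (by positivity)
            have e1 : (b : ℝ) ^ (3 / 2 : ℝ) ≤ (g : ℝ) ^ (3 / 4 : ℝ) := by
              have : (b : ℝ) ^ (3 / 2 : ℝ) = ((b : ℝ) ^ 2) ^ (3 / 4 : ℝ) := by
                rw [← Real.rpow_natCast, ← Real.rpow_mul hbp.le]; norm_num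
              rw [this]
              exact Real.rpow_le_rpow (by positivity) hle (by norm_num)
            calc _ ≤ (g : ℝ) ^ (5 / 4 : ℝ) * (g : ℝ) ^ (3 / 4 : ℝ) := by gcongr
              _ = (g : ℝ) ^ 2 := by
                rw [← Real.rpow_add hgp, ← Real.rpow_natCast]; norm_num
    · simpa [hH, hd] using hR
  have hrow : ∀ b : ℕ, ∑' g : ℕ, H g b =
      mu b * cp m b * ∑' j : ℕ, cp m j * FF ((Y / (b : ℝ) ^ 4) / (j : ℝ) ^ 2) := by
    intro b
    by_cases hb : b = 0
    · simp [hH, hb, mu_zero]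
    have e : ∀ g : ℕ, H g b = mu b * (if b ^ 2 ∣ g then cp m g * FF (Y / (g : ℝ) ^ 2) else 0) := by
      intro g
      simp only [hH]
      split_ifs <;> ring
    simp_rw [e]
    rw [tsum_mul_left, tsum_dvd _ (pow_ne_zero 2 hb), mul_assoc, ← tsum_mul_left (a := cp m b)]
    refine congrArg (fun x => mu b * x) (tsum_congr fun j => ?_)
    rw [cp_mul, pow_two, cp_mul, cp_sq, mul_assoc]
    congr 3
    push_cast
    rw [div_div]; ring_nf
  have hs2 : Summable (Function.uncurry fun b g => H g b) := by
    have := hs.prod_symm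
    exact this
  constructor
  · have := hs2.prod
    exact this.congr hrow
  · have h1 := hs.tsum_comm
    have h2 : ∑' b : ℕ, mu b * cp m b * ∑' j : ℕ, cp m j * FF ((Y / (b : ℝ) ^ 4) / (j : ℝ) ^ 2)
        = ∑' b : ℕ, ∑' g : ℕ, H g b := tsum_congr fun b => (hrow b).symm
    rw [h2, h1]
    unfold Psi
    refine tsum_congr fun g => ?_
    by_cases hg : g = 0
    · simp [hH, hg, FF_zero]
    · simp only [hH]
      rw [tsum_mul_right, tsum_mul_left, tsum_sq_mu hg]

lemma Psi_approx : ∃ C : ℝ, 0 < C ∧ ∀ (m : ℕ), m ≠ 0 → ∀ Y : ℝ, 0 < Y →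
    |Psi m Y - cF * Real.sqrt Y * lam m| ≤ C * m.divisors.card * Y ^ (1 / 3 : ℝ) := by
  obtain ⟨C, hC, h⟩ := Phi_cop_approx
  have hZs : Summable fun b : ℕ => 1 / (b : ℝ) ^ (4 / 3 : ℝ) :=
    Real.summable_one_div_nat_rpow.2 (by norm_num)
  set Z : ℝ := ∑' b : ℕ, 1 / (b : ℝ) ^ (4 / 3 : ℝ) with hZ
  have hZ0 : 0 ≤ Z := tsum_nonneg fun b => by positivity
  refine ⟨C * (Z + 1), by positivity, fun m hm Y hY => ?_⟩
  obtain ⟨hs, he⟩ := Psi_eq m hY.le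
  have hs2 : Summable fun b : ℕ => cp m b * (mu b / (b : ℝ) ^ 2) := by
    have := cpwf_summable ha_sq m
    refine this.congr fun b => ?_
    rw [wf_sq]
  have e2 : cF * Real.sqrt Y * lam m = ∑' b : ℕ, cF * Real.sqrt Y * ((m.totient : ℝ) / m) * (cp m b * (mu b / (b : ℝ) ^ 2)) := by
    rw [lam, tsum_mul_left]; ring
  rw [he, e2, ← Summable.tsum_sub hs (hs2.mul_left _)]
  have hbd : ∀ b : ℕ, ‖mu b * cp m b * ∑' j : ℕ, cp m j * FF ((Y / (b : ℝ) ^ 4) / (j : ℝ) ^ 2)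
      - cF * Real.sqrt Y * ((m.totient : ℝ) / m) * (cp m b * (mu b / (b : ℝ) ^ 2))‖
      ≤ C * m.divisors.card * Y ^ (1 / 3 : ℝ) * (1 / (b : ℝ) ^ (4 / 3 : ℝ)) := by
    intro b
    by_cases hb : b = 0
    · subst hb; simp [mu_zero]
    have hbp : (0 : ℝ) < b := by exact_mod_cast Nat.pos_of_ne_zero hb
    have h1 := h m hm (Y / (b : ℝ) ^ 4) (by positivity)
    have e3 : Real.sqrt (Y / (b : ℝ) ^ 4) = Real.sqrt Y / (b : ℝ) ^ 2 := by
      rw [Real.sqrt_div hY.le, show (b : ℝ) ^ 4 = ((b : ℝ) ^ 2) ^ 2 by ring, Real.sqrt_sq (by positivity)]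
    have e4 : (Y / (b : ℝ) ^ 4) ^ (1 / 3 : ℝ) = Y ^ (1 / 3 : ℝ) * (1 / (b : ℝ) ^ (4 / 3 : ℝ)) := by
      rw [Real.div_rpow hY.le (by positivity), ← Real.rpow_natCast (b : ℝ) 4, ← Real.rpow_mul hbp.le]
      norm_num
      ring
    rw [e3, e4] at h1
    have e5 : mu b * cp m b * ∑' j : ℕ, cp m j * FF ((Y / (b : ℝ) ^ 4) / (j : ℝ) ^ 2)
      - cF * Real.sqrt Y * ((m.totient : ℝ) / m) * (cp m b * (mu b / (b : ℝ) ^ 2)) =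
      (mu b * cp m b) * (∑' j : ℕ, cp m j * FF ((Y / (b : ℝ) ^ 4) / (j : ℝ) ^ 2) -
        Real.sqrt Y / (b : ℝ) ^ 2 * cF * ((m.totient : ℝ) / m)) := by ring
    rw [e5, norm_mul, Real.norm_eq_abs, Real.norm_eq_abs]
    have e6 : |mu b * cp m b| ≤ 1 := by
      rw [abs_mul, abs_of_nonneg (cp_nonneg _ _)]
      have := mu_abs_le b
      have := cp_le_one m b
      have := cp_nonneg m b
      have := abs_nonneg (mu b)
      nlinarith
    calc _ ≤ 1 * _ := mul_le_mul e6 h1 (abs_nonneg _) zero_le_one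
      _ = _ := by ring
  have hfin := tsum_of_norm_bounded ((hZs.mul_left (C * m.divisors.card * Y ^ (1 / 3 : ℝ))).hasSum) hbd
  rw [tsum_mul_left, ← hZ, Real.norm_eq_abs] at hfin
  refine hfin.trans ?_
  have : 0 ≤ C * m.divisors.card * Y ^ (1 / 3 : ℝ) := by positivity
  nlinarith

end Nun


namespace Nun

open MeasureTheory Filter Topology

noncomputable def aa (p : ℕ) : ℝ := 1 / ((p : ℝ) * (p + 1))
noncomputable def aa' (p : ℕ) : ℝ := 1 / ((p : ℝ) ^ 2 + p - 1)

lemma ha_aa : ∀ p : ℕ, p.Prime → 0 ≤ aa p ∧ aa p ≤ 1 / (p : ℝ) ^ 2 := by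
  intro p hp
  have h : (0 : ℝ) < p := by exact_mod_cast hp.pos
  unfold aa
  refine ⟨by positivity, one_div_le_one_div_of_le (by positivity) (by nlinarith)⟩

lemma ha_aa' : ∀ p : ℕ, p.Prime → 0 ≤ aa' p ∧ aa' p ≤ 1 / (p : ℝ) ^ 2 := by
  intro p hp
  have h : (2 : ℝ) ≤ p := by exact_mod_cast hp.two_le
  unfold aa'
  refine ⟨?_, one_div_le_one_div_of_le (by positivity) (by nlinarith)⟩
  apply div_nonneg zero_le_one; nlinarith

lemma aa_rel {p : ℕ} (hp : p.Prime) : aa p * (1 - aa p)⁻¹ = aa' p ∧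
    (1 - aa p) * (1 - aa' p) = ((p : ℝ) - 1) * (p + 2) / (p * (p + 1)) := by
  have h : (2 : ℝ) ≤ p := by exact_mod_cast hp.two_le
  have h1 : (0 : ℝ) < (p : ℝ) ^ 2 + p - 1 := by nlinarith
  have h2 : (0 : ℝ) < (p : ℝ) * (p + 1) := by positivity
  have e1 : 1 - aa p = ((p : ℝ) ^ 2 + p - 1) / (p * (p + 1)) := by
    unfold aa; field_simp
  have e2 : 1 - aa' p = ((p : ℝ) - 1) * (p + 2) / ((p : ℝ) ^ 2 + p - 1) := by
    unfold aa'
    rw [eq_div_iff h1.ne', sub_mul, div_mul_cancel₀ _ h1.ne']; ring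
  constructor
  · rw [e1, inv_div]; unfold aa aa'; field_simp
  · rw [e1, e2, div_mul_div_comm, mul_comm ((p : ℝ) * (p + 1)), mul_div_mul_left _ _ h1.ne']

lemma prod_primeFactors_mul (f : ℕ → ℝ) {m n : ℕ} (h : Nat.Coprime m n) :
    ∏ p ∈ (m * n).primeFactors, f p = (∏ p ∈ m.primeFactors, f p) * ∏ p ∈ n.primeFactors, f p := by
  rw [h.primeFactors_mul, Finset.prod_union h.disjoint_primeFactors]

lemma totient_real (m : ℕ) : (m.totient : ℝ) = m * ∏ p ∈ m.primeFactors, (1 - (p : ℝ)⁻¹) := by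
  have := Nat.totient_eq_mul_prod_factors m
  have h2 := congrArg (fun x : ℚ => (x : ℝ)) this
  push_cast at h2
  exact h2

lemma lam_eq {m : ℕ} (hm : m ≠ 0) :
    lam m = 6 / Real.pi ^ 2 * ∏ p ∈ m.primeFactors, ((p : ℝ) / (p + 1)) := by
  have hm' : (m : ℝ) ≠ 0 := by exact_mod_cast hm
  rw [lam, tsum_cp_mu_sq hm, totient_real, mul_div_cancel_left₀ _ hm', mul_left_comm,
    ← Finset.prod_mul_distrib]
  congr 1
  refine Finset.prod_congr rfl fun p hp => ?_
  have h : (2 : ℝ) ≤ p := by exact_mod_cast (Nat.prime_of_mem_primeFactors hp).two_le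
  have h1 : (p : ℝ) - 1 ≠ 0 := by intro h0; linarith
  have h2 : (1 - (p : ℝ)⁻¹ ^ 2) = ((p : ℝ) - 1) * (p + 1) / p ^ 2 := by field_simp; ring
  rw [h2, inv_div]
  field_simp

/-- weights -/
noncomputable def WW (q e1 e2 : ℕ) : ℝ :=
  (cp q e1 * (mu e1 / (e1 : ℝ) ^ 2)) * (cp (q * e1) e2 * (mu e2 / (e2 : ℝ) ^ 2))

lemma mu_div_abs (n : ℕ) : |mu n / (n : ℝ) ^ 2| ≤ 1 / (n : ℝ) ^ 2 := by
  rw [abs_div, abs_of_nonneg (by positivity : (0 : ℝ) ≤ (n : ℝ) ^ 2)]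
  gcongr
  exact mu_abs_le n

lemma WW_abs_le (q e1 e2 : ℕ) : |WW q e1 e2| ≤ 1 / (e1 : ℝ) ^ 2 * (1 / (e2 : ℝ) ^ 2) := by
  unfold WW
  rw [abs_mul, abs_mul, abs_mul, abs_of_nonneg (cp_nonneg _ _), abs_of_nonneg (cp_nonneg _ _)]
  have h1 := mu_div_abs e1
  have h2 := mu_div_abs e2
  have := cp_nonneg q e1
  have := cp_nonneg (q * e1) e2
  have a1 := mul_le_mul (cp_le_one q e1) h1 (abs_nonneg _) zero_le_one
  have a2 := mul_le_mul (cp_le_one (q * e1) e2) h2 (abs_nonneg _) zero_le_one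
  rw [one_mul] at a1 a2
  exact mul_le_mul a1 a2 (by positivity) (by positivity)

lemma WW_lam {q : ℕ} (hq : q ≠ 0) (e1 e2 : ℕ) :
    WW q e1 e2 * lam (q * e1 * e2) = lam q * ((cp q e1 * wf aa e1) * (cp (q * e1) e2 * wf aa e2)) := by
  by_cases h1 : Nat.Coprime e1 q
  swap
  · simp [WW, cp, h1]
  by_cases h2 : Nat.Coprime e2 (q * e1)
  swap
  · simp [WW, cp, h2]
  by_cases he1 : e1 = 0
  · simp [WW, wf, he1, mu_zero]
  by_cases he2 : e2 = 0
  · simp [WW, wf, he2, mu_zero]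
  rw [lam_eq (mul_ne_zero (mul_ne_zero hq he1) he2), lam_eq hq,
    prod_primeFactors_mul _ h2.symm, prod_primeFactors_mul _ h1.symm]
  have key : ∀ n : ℕ, wf aa n = mu n / (n : ℝ) ^ 2 * ∏ p ∈ n.primeFactors, ((p : ℝ) / (p + 1)) := by
    intro n
    rw [← wf_sq]
    unfold wf
    rw [mul_assoc, ← Finset.prod_mul_distrib]
    congr 1
    refine Finset.prod_congr rfl fun p hp => ?_
    have h : (0 : ℝ) < p := by exact_mod_cast (Nat.prime_of_mem_primeFactors hp).pos
    unfold aa; field_simp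
  rw [key, key]
  unfold WW
  ring

noncomputable def Pa : ℝ := ∑' n, wf aa n
noncomputable def Pa' : ℝ := ∑' n, wf aa' n

lemma inner_sum {q : ℕ} (hq : q ≠ 0) (e1 : ℕ) :
    ∑' e2 : ℕ, (cp q e1 * wf aa e1) * (cp (q * e1) e2 * wf aa e2) =
      Pa * (∏ p ∈ q.primeFactors, (1 - aa p)⁻¹) * (cp q e1 * wf aa' e1) := by
  by_cases h1 : Nat.Coprime e1 q
  swap
  · simp [cp, h1]
  by_cases he1 : e1 = 0
  · simp [wf, he1, mu_zero]
  rw [tsum_mul_left, euler_cop ha_aa (mul_ne_zero hq he1), prod_primeFactors_mul _ h1.symm]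
  have : wf aa' e1 = wf aa e1 * ∏ p ∈ e1.primeFactors, (1 - aa p)⁻¹ := by
    unfold wf
    rw [mul_assoc, ← Finset.prod_mul_distrib]
    congr 1
    refine Finset.prod_congr rfl fun p hp => ?_
    exact (aa_rel (Nat.prime_of_mem_primeFactors hp)).1.symm
  rw [this, ← Pa]
  ring

lemma summable_pair (f : ℕ × ℕ → ℝ) (K : ℝ) (h : ∀ x, |f x| ≤ K * (1 / (x.1 : ℝ) ^ 2 * (1 / (x.2 : ℝ) ^ 2))) :
    Summable f := by
  have h1 : Summable fun g : ℕ => 1 / (g : ℝ) ^ 2 := Real.summable_one_div_nat_pow.2 (by norm_num)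
  have h3 := (h1.mul_of_nonneg h1 (fun g => by positivity) (fun g => by positivity)).mul_left K
  exact Summable.of_norm_bounded h3 h

lemma kappa_summable (q : ℕ) :
    Summable fun x : ℕ × ℕ => (cp q x.1 * wf aa x.1) * (cp (q * x.1) x.2 * wf aa x.2) := by
  refine summable_pair _ 1 fun x => ?_
  rw [abs_mul, one_mul]
  exact mul_le_mul (cpwf_abs_le ha_aa q x.1) (cpwf_abs_le ha_aa (q * x.1) x.2) (abs_nonneg _) (by positivity)

lemma kappa_eq {q : ℕ} (hq : q ≠ 0) :
    ∑' x : ℕ × ℕ, (cp q x.1 * wf aa x.1) * (cp (q * x.1) x.2 * wf aa x.2) =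
      Pa * Pa' * ((∏ p ∈ q.primeFactors, (1 - aa p)⁻¹) * ∏ p ∈ q.primeFactors, (1 - aa' p)⁻¹) := by
  rw [(kappa_summable q).tsum_prod]
  simp only [inner_sum hq]
  rw [tsum_mul_left, euler_cop ha_aa' hq, ← Pa']
  ring

lemma const_eq : 6 / Real.pi ^ 2 * Pa * Pa' =
    ∏' p : Nat.Primes, ((((p : ℕ) : ℝ) ^ 3 - 3 * ((p : ℕ) : ℝ) + 2) / ((p : ℕ) : ℝ) ^ 3) := by
  have h1 := euler_full ha_sq
  simp only [wf_sq, tsum_mu_sq] at h1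
  have h2 := euler_full ha_aa
  have h3 := euler_full ha_aa'
  have h := (h1.mul h2).mul h3
  have e : (fun p : Nat.Primes => (((p : ℕ) : ℝ) ^ 3 - 3 * ((p : ℕ) : ℝ) + 2) / ((p : ℕ) : ℝ) ^ 3) =
      fun p : Nat.Primes => (1 - 1 / ((p : ℕ) : ℝ) ^ 2) * (1 - aa p) * (1 - aa' p) := by
    funext p
    have h : (2 : ℝ) ≤ (p : ℕ) := by exact_mod_cast p.2.two_le
    rw [mul_assoc, (aa_rel p.2).2]
    field_simp
    ring
  rw [e]
  exact h.tprod_eq.symm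

lemma main_const {q : ℕ} (hq : q ≠ 0) : (q.totient : ℝ) * (lam q *
    ∑' x : ℕ × ℕ, (cp q x.1 * wf aa x.1) * (cp (q * x.1) x.2 * wf aa x.2)) =
    (∏' p : Nat.Primes, ((((p : ℕ) : ℝ) ^ 3 - 3 * ((p : ℕ) : ℝ) + 2) / ((p : ℕ) : ℝ) ^ 3)) *
      (∏ p ∈ q.primeFactors, (1 + 2 * ((p : ℝ))⁻¹)⁻¹) * q := by
  rw [kappa_eq hq, lam_eq hq, ← const_eq, totient_real]
  have : (∏ p ∈ q.primeFactors, (1 + 2 * ((p : ℝ))⁻¹)⁻¹) =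
      (∏ p ∈ q.primeFactors, (1 - (p : ℝ)⁻¹)) * (∏ p ∈ q.primeFactors, ((p : ℝ) / (p + 1))) *
      ((∏ p ∈ q.primeFactors, (1 - aa p)⁻¹) * ∏ p ∈ q.primeFactors, (1 - aa' p)⁻¹) := by
    rw [← Finset.prod_mul_distrib, ← Finset.prod_mul_distrib, ← Finset.prod_mul_distrib]
    refine Finset.prod_congr rfl fun p hp => ?_
    have hp' := Nat.prime_of_mem_primeFactors hp
    have h : (2 : ℝ) ≤ p := by exact_mod_cast hp'.two_le
    have h1 : (p : ℝ) - 1 ≠ 0 := by intro h0; linarith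
    rw [← mul_inv, (aa_rel hp').2, inv_div]
    have e1 : 1 + 2 * (p : ℝ)⁻¹ = (p + 2) / p := by field_simp
    have e2 : 1 - (p : ℝ)⁻¹ = (p - 1) / p := by field_simp
    rw [e1, e2, inv_div]
    field_simp
  rw [this]
  ring

noncomputable def Tinf (q : ℕ) (Y : ℝ) : ℝ := ∑' x : ℕ × ℕ, WW q x.1 x.2 * Psi (q * x.1 * x.2) Y

lemma Psi_abs_le (m : ℕ) {Y : ℝ} (hY : 0 ≤ Y) :
    Summable (fun g : ℕ => cp m g * mu g ^ 2 * FF (Y / (g : ℝ) ^ 2)) ∧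
    |Psi m Y| ≤ Phi Y := by
  have hb : ∀ g : ℕ, cp m g * mu g ^ 2 * FF (Y / (g : ℝ) ^ 2) ≤ FF (Y / (g : ℝ) ^ 2) := by
    intro g
    have h1 : cp m g * mu g ^ 2 ≤ 1 := by
      have := mul_le_mul (cp_le_one m g) (mu_sq_le g) (sq_nonneg _) zero_le_one
      linarith
    have := FF_nonneg (Y / (g : ℝ) ^ 2)
    nlinarith
  have h0 : ∀ g : ℕ, 0 ≤ cp m g * mu g ^ 2 * FF (Y / (g : ℝ) ^ 2) := fun g =>
    mul_nonneg (mul_nonneg (cp_nonneg _ _) (sq_nonneg _)) (FF_nonneg _)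
  have hs := Summable.of_nonneg_of_le h0 hb (Phi_summable hY)
  refine ⟨hs, ?_⟩
  unfold Psi Phi
  rw [abs_of_nonneg (tsum_nonneg h0)]
  exact hs.tsum_le_tsum hb (Phi_summable hY)

lemma Tinf_summable (q : ℕ) {Y : ℝ} (hY : 0 ≤ Y) :
    Summable fun x : ℕ × ℕ => WW q x.1 x.2 * Psi (q * x.1 * x.2) Y := by
  refine summable_pair _ (Phi Y) fun x => ?_
  rw [abs_mul, mul_comm]
  refine mul_le_mul (Psi_abs_le _ hY).2 (WW_abs_le _ _ _) (abs_nonneg _) ?_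
  exact tsum_nonneg fun g => FF_nonneg _

lemma Tinf_approx : ∃ C : ℝ, 0 < C ∧ ∀ (q : ℕ), q ≠ 0 → ∀ Y : ℝ, 0 < Y →
    |(q.totient : ℝ) * Tinf q Y - cF * (∏' p : Nat.Primes, ((((p : ℕ) : ℝ) ^ 3 - 3 * ((p : ℕ) : ℝ) + 2) / ((p : ℕ) : ℝ) ^ 3)) *
      (∏ p ∈ q.primeFactors, (1 + 2 * ((p : ℝ))⁻¹)⁻¹) * q * Real.sqrt Y|
      ≤ C * (q.totient : ℝ) * q.divisors.card * Y ^ (1 / 3 : ℝ) := by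
  obtain ⟨C, hC, h⟩ := Psi_approx
  obtain ⟨D, hD, hd⟩ := divisor_bound (1 / 2) (by norm_num)
  have hZs : Summable fun b : ℕ => 1 / (b : ℝ) ^ (3 / 2 : ℝ) :=
    Real.summable_one_div_nat_rpow.2 (by norm_num)
  have hZs2 := hZs.mul_of_nonneg hZs (fun g => by positivity) (fun g => by positivity)
  set Z : ℝ := ∑' x : ℕ × ℕ, 1 / (x.1 : ℝ) ^ (3 / 2 : ℝ) * (1 / (x.2 : ℝ) ^ (3 / 2 : ℝ)) with hZ
  have hZ0 : 0 ≤ Z := tsum_nonneg fun b => by positivity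
  refine ⟨C * D ^ 2 * (Z + 1), by positivity, fun q hq Y hY => ?_⟩
  have e1 : cF * (∏' p : Nat.Primes, ((((p : ℕ) : ℝ) ^ 3 - 3 * ((p : ℕ) : ℝ) + 2) / ((p : ℕ) : ℝ) ^ 3)) *
      (∏ p ∈ q.primeFactors, (1 + 2 * ((p : ℝ))⁻¹)⁻¹) * q * Real.sqrt Y =
      (q.totient : ℝ) * ∑' x : ℕ × ℕ, cF * Real.sqrt Y * (WW q x.1 x.2 * lam (q * x.1 * x.2)) := by
    have := main_const hq
    simp only [WW_lam hq]
    rw [tsum_mul_left, tsum_mul_left]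
    linear_combination (-cF * Real.sqrt Y) * this
  have hs2 : Summable fun x : ℕ × ℕ => cF * Real.sqrt Y * (WW q x.1 x.2 * lam (q * x.1 * x.2)) := by
    simp only [WW_lam hq]
    exact ((kappa_summable q).mul_left _).mul_left _
  rw [e1, Tinf, ← mul_sub, ← Summable.tsum_sub (Tinf_summable q hY.le) hs2, abs_mul,
    abs_of_nonneg (by positivity : (0 : ℝ) ≤ q.totient)]
  have hbd : ∀ x : ℕ × ℕ, ‖WW q x.1 x.2 * Psi (q * x.1 * x.2) Y -
      cF * Real.sqrt Y * (WW q x.1 x.2 * lam (q * x.1 * x.2))‖ ≤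
      C * D ^ 2 * q.divisors.card * Y ^ (1 / 3 : ℝ) * (1 / (x.1 : ℝ) ^ (3 / 2 : ℝ) * (1 / (x.2 : ℝ) ^ (3 / 2 : ℝ))) := by
    rintro ⟨e1, e2⟩
    simp only
    by_cases he1 : e1 = 0
    · simp [WW, he1, mu_zero]
    by_cases he2 : e2 = 0
    · simp [WW, he2, mu_zero]
    have hp1 : (0 : ℝ) < e1 := by exact_mod_cast Nat.pos_of_ne_zero he1
    have hp2 : (0 : ℝ) < e2 := by exact_mod_cast Nat.pos_of_ne_zero he2
    have e3 : WW q e1 e2 * Psi (q * e1 * e2) Y - cF * Real.sqrt Y * (WW q e1 e2 * lam (q * e1 * e2))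
      = WW q e1 e2 * (Psi (q * e1 * e2) Y - cF * Real.sqrt Y * lam (q * e1 * e2)) := by ring
    rw [e3, norm_mul, Real.norm_eq_abs, Real.norm_eq_abs]
    have h1 := h (q * e1 * e2) (mul_ne_zero (mul_ne_zero hq he1) he2) Y hY
    have h2 : ((q * e1 * e2).divisors.card : ℝ) ≤ q.divisors.card * (D * (e1 : ℝ) ^ (1 / 2 : ℝ)) * (D * (e2 : ℝ) ^ (1 / 2 : ℝ)) := by
      refine (card_divisors_mul_le (mul_ne_zero hq he1) he2).trans ?_
      refine mul_le_mul ((card_divisors_mul_le hq he1).trans ?_) (hd e2 he2) (by positivity) (by positivity)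
      exact mul_le_mul_of_nonneg_left (hd e1 he1) (by positivity)
    have key : ∀ e : ℝ, 0 < e → 1 / e ^ 2 * e ^ (1 / 2 : ℝ) = 1 / e ^ (3 / 2 : ℝ) := by
      intro e he
      have : e ^ (3 / 2 : ℝ) * e ^ (1 / 2 : ℝ) = e ^ 2 := by
        rw [← Real.rpow_add he, ← Real.rpow_natCast]; norm_num
      rw [← this]
      have : 0 < e ^ (1 / 2 : ℝ) := by positivity
      have : 0 < e ^ (3 / 2 : ℝ) := by positivity
      field_simp
    calc _ ≤ (1 / (e1 : ℝ) ^ 2 * (1 / (e2 : ℝ) ^ 2)) * (C * (q.divisors.card * (D * (e1 : ℝ) ^ (1 / 2 : ℝ)) * (D * (e2 : ℝ) ^ (1 / 2 : ℝ))) * Y ^ (1 / 3 : ℝ)) := by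
          refine mul_le_mul (WW_abs_le _ _ _) (h1.trans ?_) (abs_nonneg _) (by positivity)
          gcongr
      _ = _ := by
          rw [← key _ hp1, ← key _ hp2]; ring
  have hfin := tsum_of_norm_bounded ((hZs2.mul_left (C * D ^ 2 * q.divisors.card * Y ^ (1 / 3 : ℝ))).hasSum) hbd
  rw [tsum_mul_left, ← hZ, Real.norm_eq_abs] at hfin
  have h0 : 0 ≤ C * D ^ 2 * q.divisors.card * Y ^ (1 / 3 : ℝ) := by positivity
  have h9 : (0 : ℝ) ≤ q.totient := by positivity
  calc _ ≤ (q.totient : ℝ) * (C * D ^ 2 * q.divisors.card * Y ^ (1 / 3 : ℝ) * Z) := by gcongr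
    _ ≤ (q.totient : ℝ) * (C * D ^ 2 * q.divisors.card * Y ^ (1 / 3 : ℝ) * (Z + 1)) := by gcongr; linarith
    _ = _ := by ring

end Nun


namespace Nun

open MeasureTheory Filter Topology

noncomputable def Fpair (q : ℕ) (Y : ℝ) (d1 d2 : ℕ) : ℝ :=
  (cp q d1 * mu d1) * (cp q d2 * mu d2) * ((Nat.gcd d1 d2 : ℝ) ^ 4 / ((d1 : ℝ) ^ 2 * (d2 : ℝ) ^ 2) *
    FF (Y / (Nat.gcd d1 d2 : ℝ) ^ 2))

noncomputable def Tz (q : ℕ) (Y : ℝ) (z : ℕ) : ℝ :=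
  ∑ d1 ∈ Finset.Icc 1 z, ∑ d2 ∈ Finset.Icc 1 z, Fpair q Y d1 d2

noncomputable def tt (q : ℕ) (Y : ℝ) (x : (ℕ × ℕ) × ℕ) : ℝ :=
  WW q x.1.1 x.1.2 * (cp (q * x.1.1 * x.1.2) x.2 * mu x.2 ^ 2 * FF (Y / (x.2 : ℝ) ^ 2))

lemma tt_abs_le (q : ℕ) {Y : ℝ} (hY : 0 ≤ Y) (x : (ℕ × ℕ) × ℕ) : |tt q Y x| ≤
    Y * ((1 / (x.1.1 : ℝ) ^ 2 * (1 / (x.1.2 : ℝ) ^ 2)) * (1 / (x.2 : ℝ) ^ 2)) := by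
  unfold tt
  rw [abs_mul]
  have h1 := WW_abs_le q x.1.1 x.1.2
  have h2 : |cp (q * x.1.1 * x.1.2) x.2 * mu x.2 ^ 2 * FF (Y / (x.2 : ℝ) ^ 2)| ≤ Y * (1 / (x.2 : ℝ) ^ 2) := by
    rw [abs_of_nonneg (mul_nonneg (mul_nonneg (cp_nonneg _ _) (sq_nonneg _)) (FF_nonneg _))]
    refine le_trans ?_ (FFsq_le hY x.2)
    have h1 := mul_le_mul (cp_le_one (q * x.1.1 * x.1.2) x.2) (mu_sq_le x.2) (sq_nonneg _) zero_le_one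
    have := FF_nonneg (Y / (x.2 : ℝ) ^ 2)
    nlinarith
  calc _ ≤ (1 / (x.1.1 : ℝ) ^ 2 * (1 / (x.1.2 : ℝ) ^ 2)) * (Y * (1 / (x.2 : ℝ) ^ 2)) :=
        mul_le_mul h1 h2 (abs_nonneg _) (by positivity)
    _ = _ := by ring

lemma summable_triple (s : ℝ) (hs : 1 < s) : Summable fun x : (ℕ × ℕ) × ℕ =>
    (1 / (x.1.1 : ℝ) ^ s * (1 / (x.1.2 : ℝ) ^ s)) * (1 / (x.2 : ℝ) ^ s) := by
  have h1 : Summable fun g : ℕ => 1 / (g : ℝ) ^ s := Real.summable_one_div_nat_rpow.2 hs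
  have h2 := h1.mul_of_nonneg h1 (fun g => by positivity) (fun g => by positivity)
  exact h2.mul_of_nonneg h1 (fun g => by positivity) (fun g => by positivity)

lemma tt_summable (q : ℕ) {Y : ℝ} (hY : 0 ≤ Y) : Summable (tt q Y) := by
  have := (summable_triple 2 (by norm_num)).mul_left Y
  refine Summable.of_norm_bounded this fun x => ?_
  have h := tt_abs_le q hY x
  simp only [Real.rpow_ofNat]
  exact h

lemma Tinf_eq (q : ℕ) {Y : ℝ} (hY : 0 ≤ Y) : Tinf q Y = ∑' x, tt q Y x := by
  rw [(tt_summable q hY).tsum_prod]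
  unfold Tinf tt Psi
  refine tsum_congr fun x => ?_
  simp only
  rw [tsum_mul_left]

lemma tt_zero (q : ℕ) (Y : ℝ) (x : (ℕ × ℕ) × ℕ) (h : x.1.1 = 0 ∨ x.1.2 = 0 ∨ x.2 = 0 ∨ ¬ Nat.Coprime x.1.1 x.1.2) :
    tt q Y x = 0 := by
  unfold tt
  rcases h with h | h | h | h
  · simp [WW, h, mu_zero]
  · simp [WW, h, mu_zero]
  · simp [h, mu_zero]
  · have : cp (q * x.1.1) x.1.2 = 0 := by
      unfold cp
      rw [if_neg]
      intro h2
      exact h (Nat.Coprime.coprime_mul_left_right h2).symm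
    simp [WW, this]

lemma tt_Fpair (q : ℕ) (Y : ℝ) {e1 e2 g : ℕ} (h1 : e1 ≠ 0) (h2 : e2 ≠ 0) (hg : g ≠ 0)
    (hc : Nat.Coprime e1 e2) : Fpair q Y (g * e1) (g * e2) = tt q Y ((e1, e2), g) := by
  have hgcd : Nat.gcd (g * e1) (g * e2) = g := by
    rw [Nat.gcd_mul_left, hc.gcd_eq_one, mul_one]
  have hgp : (0 : ℝ) < g := by exact_mod_cast Nat.pos_of_ne_zero hg
  have hp1 : (0 : ℝ) < e1 := by exact_mod_cast Nat.pos_of_ne_zero h1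
  have hp2 : (0 : ℝ) < e2 := by exact_mod_cast Nat.pos_of_ne_zero h2
  have cpm : ∀ a b : ℕ, ∀ n, cp (a * b) n = cp a n * cp b n := by
    intro a b n
    unfold cp
    have h := @Nat.coprime_mul_iff_right n a b
    split_ifs <;> simp_all
  have c12 : cp e1 e2 = 1 := by unfold cp; rw [if_pos hc.symm]
  have musq : ∀ e : ℕ, ¬ Nat.Coprime g e → mu (g * e) = 0 := by
    intro e he
    unfold mu
    rw [ArithmeticFunction.moebius_eq_zero_of_not_squarefree]
    · simp
    · intro hs
      exact he (Nat.coprime_of_squarefree_mul hs)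
  unfold Fpair tt WW
  rw [hgcd]
  simp only [cpm, c12]
  by_cases g1 : Nat.Coprime g e1
  swap
  · rw [musq e1 g1]
    have : cp e1 g = 0 := by unfold cp; rw [if_neg g1]
    rw [this]; ring
  by_cases g2 : Nat.Coprime g e2
  swap
  · rw [musq e2 g2]
    have : cp e2 g = 0 := by unfold cp; rw [if_neg g2]
    rw [this]; ring
  have c1 : cp e1 g = 1 := by unfold cp; rw [if_pos g1]
  have c2 : cp e2 g = 1 := by unfold cp; rw [if_pos g2]
  rw [mu_mul g1, mu_mul g2, c1, c2, cp_mul, cp_mul]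
  have hcc := cp_sq q g
  push_cast
  field_simp
  linear_combination (cp q e1 * mu e1 * cp q e2 * mu e2 * mu g ^ 2 * FF (Y / (g : ℝ) ^ 2)) * hcc

noncomputable def SS (z : ℕ) : Finset ((ℕ × ℕ) × ℕ) :=
  ((Finset.Icc 1 z ×ˢ Finset.Icc 1 z) ×ˢ Finset.Icc 1 z).filter
    (fun x => x.2 * x.1.1 ≤ z ∧ x.2 * x.1.2 ≤ z ∧ Nat.Coprime x.1.1 x.1.2)

lemma Tz_eq (q : ℕ) (Y : ℝ) (z : ℕ) : Tz q Y z = ∑ x ∈ SS z, tt q Y x := by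
  unfold Tz
  rw [← Finset.sum_product' (f := Fpair q Y)]
  symm
  refine Finset.sum_bij' (fun x _ => (x.2 * x.1.1, x.2 * x.1.2))
    (fun d _ => ((d.1 / Nat.gcd d.1 d.2, d.2 / Nat.gcd d.1 d.2), Nat.gcd d.1 d.2)) ?_ ?_ ?_ ?_ ?_
  · rintro ⟨⟨e1, e2⟩, g⟩ hx
    simp only [SS, Finset.mem_filter, Finset.mem_product, Finset.mem_Icc] at hx ⊢
    obtain ⟨⟨⟨⟨a1, _⟩, a2, _⟩, a3, _⟩, b1, b2, _⟩ := hx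
    exact ⟨⟨Nat.mul_pos a3 a1, b1⟩, Nat.mul_pos a3 a2, b2⟩
  · rintro ⟨d1, d2⟩ hx
    simp only [SS, Finset.mem_filter, Finset.mem_product, Finset.mem_Icc] at hx ⊢
    obtain ⟨⟨a1, a2⟩, a3, a4⟩ := hx
    have hg : 0 < Nat.gcd d1 d2 := Nat.gcd_pos_of_pos_left _ a1
    have l1 : Nat.gcd d1 d2 ∣ d1 := Nat.gcd_dvd_left _ _
    have l2 : Nat.gcd d1 d2 ∣ d2 := Nat.gcd_dvd_right _ _
    refine ⟨⟨⟨⟨Nat.div_pos (Nat.le_of_dvd a1 l1) hg, (Nat.div_le_self _ _).trans a2⟩,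
      Nat.div_pos (Nat.le_of_dvd a3 l2) hg, (Nat.div_le_self _ _).trans a4⟩, hg,
      (Nat.le_of_dvd a1 l1).trans a2⟩, ?_, ?_, Nat.coprime_div_gcd_div_gcd hg⟩
    · rw [Nat.mul_div_cancel' l1]; exact a2
    · rw [Nat.mul_div_cancel' l2]; exact a4
  · rintro ⟨⟨e1, e2⟩, g⟩ hx
    simp only [SS, Finset.mem_filter, Finset.mem_product, Finset.mem_Icc] at hx ⊢
    obtain ⟨⟨⟨⟨a1, _⟩, a2, _⟩, a3, _⟩, b1, b2, hc⟩ := hx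
    have hgcd : Nat.gcd (g * e1) (g * e2) = g := by
      rw [Nat.gcd_mul_left, hc.gcd_eq_one, mul_one]
    rw [hgcd, Nat.mul_div_cancel_left _ a3, Nat.mul_div_cancel_left _ a3]
  · rintro ⟨d1, d2⟩ hx
    simp only
    rw [Nat.mul_div_cancel' (Nat.gcd_dvd_left _ _), Nat.mul_div_cancel' (Nat.gcd_dvd_right _ _)]
  · rintro ⟨⟨e1, e2⟩, g⟩ hx
    simp only [SS, Finset.mem_filter, Finset.mem_product, Finset.mem_Icc] at hx ⊢
    obtain ⟨⟨⟨⟨a1, _⟩, a2, _⟩, a3, _⟩, b1, b2, hc⟩ := hx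
    exact (tt_Fpair q Y (by omega) (by omega) (by omega) hc).symm

lemma Tz_approx : ∃ C : ℝ, 0 < C ∧ ∀ (q : ℕ) (Y : ℝ) (z : ℕ), 0 ≤ Y → 1 ≤ z →
    |Tz q Y z - Tinf q Y| ≤ C * Y * (z : ℝ) ^ (-(1 / 2) : ℝ) := by
  have hs := summable_triple (3 / 2) (by norm_num)
  set Z : ℝ := ∑' x : (ℕ × ℕ) × ℕ, (1 / (x.1.1 : ℝ) ^ (3 / 2 : ℝ) * (1 / (x.1.2 : ℝ) ^ (3 / 2 : ℝ))) * (1 / (x.2 : ℝ) ^ (3 / 2 : ℝ)) with hZ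
  have hZ0 : 0 ≤ Z := tsum_nonneg fun x => by positivity
  refine ⟨Z + 1, by positivity, fun q Y z hY hz => ?_⟩
  have hzp : (0 : ℝ) < z := by exact_mod_cast hz
  classical
  have e1 : Tz q Y z = ∑' x, (if x ∈ SS z then tt q Y x else 0) := by
    rw [Tz_eq, tsum_eq_sum (s := SS z)]
    · exact Finset.sum_congr rfl fun x hx => (if_pos hx).symm
    · intro x hx; exact if_neg hx
  have hs1 : Summable fun x => (if x ∈ SS z then tt q Y x else 0) :=
    summable_of_ne_finset_zero (s := SS z) fun x hx => if_neg hx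
  rw [e1, Tinf_eq q hY, ← Summable.tsum_sub hs1 (tt_summable q hY)]
  have hbd : ∀ x : (ℕ × ℕ) × ℕ, ‖(if x ∈ SS z then tt q Y x else 0) - tt q Y x‖ ≤
      Y * (z : ℝ) ^ (-(1 / 2) : ℝ) * ((1 / (x.1.1 : ℝ) ^ (3 / 2 : ℝ) * (1 / (x.1.2 : ℝ) ^ (3 / 2 : ℝ))) * (1 / (x.2 : ℝ) ^ (3 / 2 : ℝ))) := by
    intro x
    have hR : 0 ≤ Y * (z : ℝ) ^ (-(1 / 2) : ℝ) * ((1 / (x.1.1 : ℝ) ^ (3 / 2 : ℝ) * (1 / (x.1.2 : ℝ) ^ (3 / 2 : ℝ))) * (1 / (x.2 : ℝ) ^ (3 / 2 : ℝ))) := by positivity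
    by_cases hx : x ∈ SS z
    · rw [if_pos hx, sub_self, norm_zero]; exact hR
    rw [if_neg hx, zero_sub, norm_neg, Real.norm_eq_abs]
    by_cases h0 : x.1.1 = 0 ∨ x.1.2 = 0 ∨ x.2 = 0 ∨ ¬ Nat.Coprime x.1.1 x.1.2
    · rw [tt_zero q Y x h0, abs_zero]; exact hR
    push Not at h0
    obtain ⟨h1, h2, h3, hc⟩ := h0
    refine (tt_abs_le q hY x).trans ?_
    obtain ⟨⟨e1, e2⟩, g⟩ := x
    simp only at h1 h2 h3 hc ⊢
    have hlt : z ≤ e1 * e2 * g := by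
      by_contra hcon
      push Not at hcon
      apply hx
      have b1 := Nat.pos_of_ne_zero h1
      have b2 := Nat.pos_of_ne_zero h2
      have b3 := Nat.pos_of_ne_zero h3
      have m1 : g * e1 ≤ e1 * e2 * g := by
        calc g * e1 = e1 * 1 * g := by ring
          _ ≤ _ := by gcongr; omega
      have m2 : g * e2 ≤ e1 * e2 * g := by
        calc g * e2 = 1 * e2 * g := by ring
          _ ≤ _ := by gcongr; omega
      simp only [SS, Finset.mem_filter, Finset.mem_product, Finset.mem_Icc]
      refine ⟨⟨⟨⟨b1, ?_⟩, b2, ?_⟩, b3, ?_⟩, by omega, by omega, hc⟩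
      · nlinarith
      · nlinarith
      · nlinarith
    have hgp : (0 : ℝ) < g := by exact_mod_cast Nat.pos_of_ne_zero h3
    have hp1 : (0 : ℝ) < e1 := by exact_mod_cast Nat.pos_of_ne_zero h1
    have hp2 : (0 : ℝ) < e2 := by exact_mod_cast Nat.pos_of_ne_zero h2
    have hltR : (z : ℝ) ≤ e1 * e2 * g := by exact_mod_cast hlt
    set w : ℝ := (e1 : ℝ) * e2 * g with hw
    have hwp : 0 < w := by positivity
    have l1 : (1 / (e1 : ℝ) ^ 2 * (1 / (e2 : ℝ) ^ 2)) * (1 / (g : ℝ) ^ 2) = w ^ (-2 : ℝ) := by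
      rw [Real.rpow_neg hwp.le, Real.rpow_ofNat, hw]; field_simp
    have l2 : (1 / (e1 : ℝ) ^ (3 / 2 : ℝ) * (1 / (e2 : ℝ) ^ (3 / 2 : ℝ))) * (1 / (g : ℝ) ^ (3 / 2 : ℝ)) = w ^ (-(3 / 2) : ℝ) := by
      rw [Real.rpow_neg hwp.le, hw, Real.mul_rpow (by positivity) (by positivity), Real.mul_rpow (by positivity) (by positivity)]
      field_simp
    rw [l1, l2, mul_assoc]
    refine mul_le_mul_of_nonneg_left ?_ hY
    have : w ^ (-2 : ℝ) = w ^ (-(1 / 2) : ℝ) * w ^ (-(3 / 2) : ℝ) := by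
      rw [← Real.rpow_add hwp]; norm_num
    rw [this]
    refine mul_le_mul_of_nonneg_right ?_ (by positivity)
    exact Real.rpow_le_rpow_of_nonpos hzp hltR (by norm_num)
  have hfin := tsum_of_norm_bounded ((hs.mul_left (Y * (z : ℝ) ^ (-(1 / 2) : ℝ))).hasSum) hbd
  rw [tsum_mul_left, ← hZ, Real.norm_eq_abs] at hfin
  refine hfin.trans ?_
  have : 0 ≤ Y * (z : ℝ) ^ (-(1 / 2) : ℝ) := by positivity
  nlinarith

end Nun


namespace Nun

/-- divisibility indicator -/
noncomputable def iV (d : ℕ) (m : ℤ) : ℝ := if (d : ℤ) ∣ m then 1 else 0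

noncomputable def cI (q : ℕ) (m : ℤ) : ℝ := cp q m.natAbs

lemma iV_nonneg (d : ℕ) (m : ℤ) : 0 ≤ iV d m := by unfold iV; split_ifs <;> norm_num

lemma count_mod {r : ℕ} (hr : 0 < r) {A B : ℤ} (hAB : A ≤ B) (v : ℤ) :
    |∑ m ∈ Finset.Ioc A B, iV r (m - v) - ((B : ℝ) - A) / r| ≤ 1 := by
  have h : ∑ m ∈ Finset.Ioc A B, iV r (m - v) = (((Finset.Ioc A B).filter (· ≡ v [ZMOD (r : ℤ)])).card : ℝ) := by
    rw [Finset.card_filter]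
    push_cast
    refine Finset.sum_congr rfl fun m _ => ?_
    unfold iV
    have : (r : ℤ) ∣ m - v ↔ m ≡ v [ZMOD (r : ℤ)] := by
      rw [Int.modEq_comm, Int.modEq_iff_dvd]
    simp only [this]
  have hr' : (0 : ℤ) < r := by exact_mod_cast hr
  have hc := Int.Ioc_filter_modEq_card A B hr' v
  have hrR : (0 : ℝ) < r := by exact_mod_cast hr
  have hmono : ⌊((A - v : ℤ) : ℚ) / ((r : ℤ) : ℚ)⌋ ≤ ⌊((B - v : ℤ) : ℚ) / ((r : ℤ) : ℚ)⌋ := by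
    apply Int.floor_mono
    have : (0 : ℚ) < ((r : ℤ) : ℚ) := by exact_mod_cast hr'
    gcongr
  push_cast at hmono hc
  rw [max_eq_left (by linarith)] at hc
  have hcR : (((Finset.Ioc A B).filter (· ≡ v [ZMOD (r : ℤ)])).card : ℝ) =
      (⌊((B : ℚ) - v) / (r : ℚ)⌋ : ℝ) - (⌊((A : ℚ) - v) / (r : ℚ)⌋ : ℝ) := by
    exact_mod_cast congrArg (fun x : ℤ => (x : ℝ)) hc
  rw [h, hcR]
  have f1 := Int.floor_le (((B : ℚ) - v) / (r : ℚ))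
  have f2 := Int.lt_floor_add_one (((B : ℚ) - v) / (r : ℚ))
  have f3 := Int.floor_le (((A : ℚ) - v) / (r : ℚ))
  have f4 := Int.lt_floor_add_one (((A : ℚ) - v) / (r : ℚ))
  set a := ⌊((A : ℚ) - v) / (r : ℚ)⌋
  set b := ⌊((B : ℚ) - v) / (r : ℚ)⌋
  have g1 : (b : ℝ) ≤ ((B : ℝ) - v) / r := by exact_mod_cast f1
  have g2 : ((B : ℝ) - v) / r < b + 1 := by exact_mod_cast f2
  have g3 : (a : ℝ) ≤ ((A : ℝ) - v) / r := by exact_mod_cast f3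
  have g4 : ((A : ℝ) - v) / r < a + 1 := by exact_mod_cast f4
  have e : ((B : ℝ) - A) / r = ((B : ℝ) - v) / r - ((A : ℝ) - v) / r := by ring
  rw [e, abs_le]
  constructor <;> linarith

lemma iV_mul_coprime {c L : ℕ} (h : Nat.Coprime c L) (v : ℤ) :
    ∃ w : ℤ, ∀ m : ℤ, iV c m * iV L (m - v) = iV (c * L) (m - w) := by
  have hb : (1 : ℤ) = c * Int.gcdA c L + L * Int.gcdB c L := by
    have := Int.gcd_eq_gcd_ab (c : ℤ) (L : ℤ)
    rw [Int.gcd_natCast_natCast, h.gcd_eq_one] at this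
    exact_mod_cast this
  set x := Int.gcdA c L
  set y := Int.gcdB c L
  refine ⟨c * x * v, fun m => ?_⟩
  have h1 : (c : ℤ) ∣ m ↔ (c : ℤ) ∣ m - c * x * v := by
    rw [dvd_sub_left]
    exact ⟨x * v, by ring⟩
  have h2 : (L : ℤ) ∣ m - v ↔ (L : ℤ) ∣ m - c * x * v := by
    have : m - v = (m - c * x * v) - L * (y * v) := by linear_combination -v * hb
    rw [this, dvd_sub_left]
    exact ⟨y * v, rfl⟩
  have h3 : ∀ n : ℤ, ((c * L : ℕ) : ℤ) ∣ n ↔ (c : ℤ) ∣ n ∧ (L : ℤ) ∣ n := by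
    intro n
    simp only [Int.natCast_dvd]
    constructor
    · intro hd; exact ⟨(Dvd.intro _ rfl).trans hd, (Dvd.intro_left _ rfl).trans hd⟩
    · rintro ⟨a, b⟩; exact h.mul_dvd_of_dvd_of_dvd a b
  unfold iV
  rw [← one_mul (1 : ℝ)]
  by_cases a1 : (c : ℤ) ∣ m - c * x * v <;> by_cases a2 : (L : ℤ) ∣ m - c * x * v <;>
    simp only [h1, h2, h3, a1, a2, if_true, if_false, and_true, and_false, mul_one, mul_zero]

lemma count_cop {q L : ℕ} (hq : q ≠ 0) (hL : 0 < L) (hc : Nat.Coprime q L) {A B : ℤ} (hAB : A ≤ B) (v : ℤ) :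
    |∑ m ∈ Finset.Ioc A B, iV L (m - v) * cI q m - (q.totient : ℝ) / q * (((B : ℝ) - A) / L)|
      ≤ q.divisors.card := by
  have e : ∀ m : ℤ, iV L (m - v) * cI q m = ∑ c ∈ q.divisors, mu c * (iV c m * iV L (m - v)) := by
    intro m
    rw [cI, cp_eq hq, Finset.sum_filter, Finset.mul_sum]
    refine Finset.sum_congr rfl fun c _ => ?_
    have : (c : ℤ) ∣ m ↔ c ∣ m.natAbs := Int.natCast_dvd
    by_cases h : c ∣ m.natAbs <;> simp [iV, this, h]
  simp_rw [e]
  rw [Finset.sum_comm, ← sum_mu_div hq, Finset.sum_mul, ← Finset.sum_sub_distrib]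
  refine (Finset.abs_sum_le_sum_abs _ _).trans ?_
  have : ∀ c ∈ q.divisors, |∑ m ∈ Finset.Ioc A B, mu c * (iV c m * iV L (m - v)) -
      mu c / c * (((B : ℝ) - A) / L)| ≤ 1 := by
    intro c hcq
    have hcp : 0 < c := Nat.pos_of_mem_divisors hcq
    obtain ⟨w, hw⟩ := iV_mul_coprime (Nat.Coprime.coprime_dvd_left (Nat.dvd_of_mem_divisors hcq) hc) v
    simp_rw [hw]
    have h1 := count_mod (Nat.mul_pos hcp hL) hAB w
    rw [← Finset.mul_sum]
    have e2 : mu c / c * (((B : ℝ) - A) / L) = mu c * (((B : ℝ) - A) / ((c * L : ℕ) : ℝ)) := by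
      push_cast; field_simp
    rw [e2, ← mul_sub, abs_mul]
    have := mul_le_mul (mu_abs_le c) h1 (abs_nonneg _) zero_le_one
    linarith
  refine (Finset.sum_le_card_nsmul _ _ _ this).trans (le_of_eq ?_)
  simp

lemma pair_v {d1 d2 q : ℕ} (hc : Nat.Coprime (Nat.gcd d1 d2) q) (l : ℤ) :
    (((Nat.gcd d1 d2 : ℕ) : ℤ) ∣ l → ∃ v : ℤ, ∀ m : ℤ, iV d1 m * iV d2 (m + l * q) =
      iV (Nat.lcm d1 d2) (m - v)) ∧
    (¬ ((Nat.gcd d1 d2 : ℕ) : ℤ) ∣ l → ∀ m : ℤ, iV d1 m * iV d2 (m + l * q) = 0) := by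
  constructor
  · rintro ⟨k, hk⟩
    have hb := Int.gcd_eq_gcd_ab (d1 : ℤ) (d2 : ℤ)
    rw [Int.gcd_natCast_natCast] at hb
    set x := Int.gcdA d1 d2
    set y := Int.gcdB d1 d2
    refine ⟨-(d1 * x * k * q), fun m => ?_⟩
    have h1 : (d1 : ℤ) ∣ m ↔ (d1 : ℤ) ∣ m - -(d1 * x * k * q) := by
      rw [dvd_sub_left]
      exact ⟨-(x * k * q), by ring⟩
    have h2 : (d2 : ℤ) ∣ m + l * q ↔ (d2 : ℤ) ∣ m - -(d1 * x * k * q) := by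
      have : m + l * q = (m - -(d1 * x * k * q)) + d2 * (y * k * q) := by
        rw [hk, hb]; ring
      rw [this, dvd_add_left]
      exact ⟨y * k * q, rfl⟩
    have h3 : ∀ n : ℤ, ((Nat.lcm d1 d2 : ℕ) : ℤ) ∣ n ↔ (d1 : ℤ) ∣ n ∧ (d2 : ℤ) ∣ n := by
      intro n
      simp only [Int.natCast_dvd]
      exact Nat.lcm_dvd_iff
    unfold iV
    rw [← one_mul (1 : ℝ)]
    by_cases a1 : (d1 : ℤ) ∣ m - -(d1 * x * k * q) <;> by_cases a2 : (d2 : ℤ) ∣ m - -(d1 * x * k * q) <;>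
      simp only [h1, h2, h3, a1, a2, if_true, if_false, and_true, and_false, mul_one, mul_zero]
  · intro h m
    by_cases a1 : (d1 : ℤ) ∣ m
    swap
    · simp [iV, a1]
    by_cases a2 : (d2 : ℤ) ∣ m + l * q
    swap
    · simp [iV, a2]
    exfalso
    apply h
    have g1 : ((Nat.gcd d1 d2 : ℕ) : ℤ) ∣ d1 := by exact_mod_cast Nat.gcd_dvd_left d1 d2
    have g2 : ((Nat.gcd d1 d2 : ℕ) : ℤ) ∣ d2 := by exact_mod_cast Nat.gcd_dvd_right d1 d2
    have h3 : ((Nat.gcd d1 d2 : ℕ) : ℤ) ∣ l * q := by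
      have := dvd_sub (g2.trans a2) (g1.trans a1)
      rwa [add_sub_cancel_left] at this
    have hcop : IsCoprime ((Nat.gcd d1 d2 : ℕ) : ℤ) (q : ℤ) := Nat.isCoprime_iff_coprime.2 hc
    exact hcop.dvd_of_dvd_mul_right h3

lemma sum_Icc_symm (J : ℕ) (Y G : ℝ) :
    ∑ j ∈ Finset.Icc (-(J : ℤ)) J, (Y - G * |(j : ℝ)|) = (2 * J + 1) * Y - G * (J * (J + 1)) := by
  have hE : Function.Even (fun j : ℤ => Y - G * |(j : ℝ)|) := by
    intro j; simp
  rw [Finset.sum_Icc_of_even_eq_range hE]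
  have : ∀ n : ℕ, ∑ m ∈ Finset.range (n + 1), (Y - G * |((m : ℤ) : ℝ)|) = (n + 1) * Y - G * (n * (n + 1) / 2) := by
    intro n
    induction n with
    | zero => simp
    | succ n ih =>
      rw [Finset.sum_range_succ, ih]
      push_cast
      rw [abs_of_nonneg (by positivity)]
      ring
  rw [this]
  simp
  ring

lemma sum_tri {Y : ℝ} (hY : 0 ≤ Y) {G : ℕ} (hG : 0 < G) :
    ∑ l ∈ Finset.Icc (-(⌊Y⌋₊ : ℤ)) ⌊Y⌋₊, iV G l * (Y - |(l : ℝ)|) =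
      G * ((Y / G) ^ 2 + FF (Y / G)) := by
  have hGR : (0 : ℝ) < G := by exact_mod_cast hG
  set J := ⌊Y / G⌋₊ with hJ
  have h1 : ∑ l ∈ Finset.Icc (-(⌊Y⌋₊ : ℤ)) ⌊Y⌋₊, iV G l * (Y - |(l : ℝ)|) =
      ∑ j ∈ Finset.Icc (-(J : ℤ)) J, (Y - G * |(j : ℝ)|) := by
    have hGZ : (0 : ℤ) < G := by exact_mod_cast hG
    have hJ2 : J = ⌊Y⌋₊ / G := by rw [hJ, Nat.floor_div_natCast]
    have hiff : ∀ n : ℕ, n ≤ J ↔ n * G ≤ ⌊Y⌋₊ := by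
      intro n; rw [hJ2, Nat.le_div_iff_mul_le hG]
    have e : ∀ l : ℤ, iV G l * (Y - |(l : ℝ)|) = if (G : ℤ) ∣ l then (Y - |(l : ℝ)|) else 0 := by
      intro l; unfold iV; split_ifs <;> simp
    simp_rw [e]
    rw [← Finset.sum_filter]
    symm
    refine Finset.sum_bij' (fun j _ => (G : ℤ) * j) (fun l _ => l / G) ?_ ?_ ?_ ?_ ?_
    · intro j hj
      rw [Finset.mem_Icc, ← abs_le] at hj
      rw [Finset.mem_filter, Finset.mem_Icc, ← abs_le]
      refine ⟨?_, Dvd.intro _ rfl⟩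
      have h2 := (hiff j.natAbs).1 (by rw [Int.abs_eq_natAbs] at hj; exact_mod_cast hj)
      rw [abs_mul, Int.abs_eq_natAbs, Int.abs_eq_natAbs]
      rw [mul_comm]
      simpa using (by exact_mod_cast h2 : ((j.natAbs : ℤ) * (G : ℤ)) ≤ ⌊Y⌋₊)
    · intro l hl
      rw [Finset.mem_filter, Finset.mem_Icc, ← abs_le] at hl
      obtain ⟨hl1, j, rfl⟩ := hl
      rw [Int.mul_ediv_cancel_left _ hGZ.ne', Finset.mem_Icc, ← abs_le]
      have h2 := (hiff j.natAbs).2 (by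
        rw [abs_mul, Int.abs_eq_natAbs, Int.abs_eq_natAbs] at hl1
        have : (G : ℤ).natAbs * j.natAbs ≤ ⌊Y⌋₊ := by exact_mod_cast hl1
        rw [mul_comm]; simpa using this)
      rw [Int.abs_eq_natAbs]; exact_mod_cast h2
    · intro j _
      rw [Int.mul_ediv_cancel_left _ hGZ.ne']
    · intro l hl
      rw [Finset.mem_filter] at hl
      exact Int.mul_ediv_cancel' hl.2
    · intro j _
      push_cast
      rw [abs_mul, abs_of_pos hGR]
  rw [h1, sum_Icc_symm]
  have hU0 : 0 ≤ Y / G := by positivity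
  have hfl : (⌊Y / G⌋ : ℝ) = J := by
    have h := Int.natCast_floor_eq_floor hU0
    exact_mod_cast congrArg (fun x : ℤ => (x : ℝ)) h.symm
  have hfr : FF (Y / G) = (Y / G - J) * (1 - (Y / G - J)) := by
    unfold FF; rw [Int.fract, hfl]
  rw [hfr]
  have : Y = (Y / G) * G := by field_simp
  set U := Y / G
  rw [this]
  ring

end Nun


namespace Nun

noncomputable def Nd (N q D a : ℕ) : ℝ :=
  ∑ n ∈ Finset.Icc 1 N, if n % q = a then (if D ∣ n then (1 : ℝ) else 0) else 0

def Us (q : ℕ) : Finset ℕ := (Finset.range q).filter (fun a => Nat.Coprime a q)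

lemma Us_card (q : ℕ) : (Us q).card = q.totient := by
  rw [Nat.totient_eq_card_coprime]
  unfold Us
  congr 1
  ext a
  simp [Nat.coprime_comm]

lemma sum_cast (N : ℕ) (F : ℤ → ℝ) : ∑ n ∈ Finset.Icc 1 N, F (n : ℤ) = ∑ m ∈ Finset.Ioc (0 : ℤ) N, F m := by
  refine Finset.sum_bij' (fun n _ => (n : ℤ)) (fun m _ => m.natAbs) ?_ ?_ ?_ ?_ ?_
  · intro n hn; simp only [Finset.mem_Icc, Finset.mem_Ioc] at *; omega
  · intro n hn; simp only [Finset.mem_Icc, Finset.mem_Ioc] at *; omega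
  · intro n hn; simp
  · intro n hn; simp only [Finset.mem_Icc, Finset.mem_Ioc] at *; omega
  · intro n hn; rfl

lemma sum_Us {q : ℕ} (hq : 0 < q) (n1 : ℕ) (F : ℕ → ℝ) :
    ∑ a ∈ Us q, (if n1 % q = a then F a else 0) = cp q n1 * F (n1 % q) := by
  rw [Finset.sum_ite_eq]
  have : n1 % q ∈ Us q ↔ Nat.Coprime n1 q := by
    unfold Us
    rw [Finset.mem_filter, Finset.mem_range]
    have h1 : Nat.gcd (n1 % q) q = Nat.gcd n1 q := by
      rw [Nat.gcd_comm n1 q, Nat.gcd_rec q n1]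
    unfold Nat.Coprime
    rw [h1]
    exact ⟨fun h => h.2, fun h => ⟨Nat.mod_lt _ hq, h⟩⟩
  unfold cp
  by_cases h : Nat.Coprime n1 q
  · rw [if_pos (this.2 h), if_pos h, one_mul]
  · rw [if_neg (fun h2 => h (this.1 h2)), if_neg h, zero_mul]

lemma sum_Nd {q : ℕ} (hq : 0 < q) (N D : ℕ) :
    ∑ a ∈ Us q, Nd N q D a = ∑ m ∈ Finset.Ioc (0 : ℤ) N, iV D (m - 0) * cI q m := by
  unfold Nd
  rw [Finset.sum_comm, ← sum_cast]
  refine Finset.sum_congr rfl fun n _ => ?_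
  rw [sum_Us hq n (fun _ => if D ∣ n then (1 : ℝ) else 0)]
  unfold cI iV
  simp only [sub_zero, Int.natCast_dvd_natCast, Int.natAbs_natCast]
  ring

lemma sum_NdNd {q : ℕ} (hq : 0 < q) (N D1 D2 : ℕ) :
    ∑ a ∈ Us q, Nd N q D1 a * Nd N q D2 a = ∑ m1 ∈ Finset.Ioc (0 : ℤ) N,
      (iV D1 m1 * cI q m1) * ∑ m2 ∈ Finset.Ioc (0 : ℤ) N, if (q : ℤ) ∣ m2 - m1 then iV D2 m2 else 0 := by
  have e : ∀ a, Nd N q D1 a * Nd N q D2 a = ∑ n ∈ Finset.Icc 1 N,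
      (if n % q = a then (if D1 ∣ n then (1 : ℝ) else 0) * Nd N q D2 a else 0) := by
    intro a
    conv_lhs => rw [Nd]
    rw [Finset.sum_mul]
    refine Finset.sum_congr rfl fun n _ => ?_
    rw [ite_mul, zero_mul]
  simp_rw [e]
  rw [Finset.sum_comm, ← sum_cast]
  refine Finset.sum_congr rfl fun n _ => ?_
  rw [sum_Us hq n (fun a => (if D1 ∣ n then (1 : ℝ) else 0) * Nd N q D2 a), ← sum_cast, Nd]
  have : ∀ k : ℕ, (if k % q = n % q then (if D2 ∣ k then (1 : ℝ) else 0) else 0) =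
      if (q : ℤ) ∣ (k : ℤ) - n then iV D2 k else 0 := by
    intro k
    have h1 : k % q = n % q ↔ (q : ℤ) ∣ (k : ℤ) - n := by
      rw [← Int.modEq_iff_dvd, Int.natCast_modEq_iff]
      exact ⟨fun h => h.symm, fun h => h.symm⟩
    unfold iV
    simp only [h1, Int.natCast_dvd_natCast]
  simp_rw [this]
  unfold cI iV
  simp only [Int.natCast_dvd_natCast, Int.natAbs_natCast]
  ring

lemma sum_shift {q : ℕ} (hq : 0 < q) (N : ℕ) (f : ℤ → ℝ) {m : ℤ} (hm : m ∈ Finset.Ioc (0 : ℤ) N) :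
    ∑ k ∈ Finset.Ioc (0 : ℤ) N, (if (q : ℤ) ∣ k - m then f k else 0) =
    ∑ l ∈ Finset.Icc (-((N / q : ℕ) : ℤ)) ((N / q : ℕ) : ℤ), if (0 < m + l * q ∧ m + l * q ≤ N) then f (m + l * q) else 0 := by
  rw [← Finset.sum_filter, ← Finset.sum_filter]
  have hqZ : (0 : ℤ) < q := by exact_mod_cast hq
  rw [Finset.mem_Ioc] at hm
  symm
  refine Finset.sum_bij' (fun l _ => m + l * q) (fun k _ => (k - m) / q) ?_ ?_ ?_ ?_ ?_
  · intro l hl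
    rw [Finset.mem_filter] at *
    refine ⟨Finset.mem_Ioc.2 hl.2, ⟨l, by ring⟩⟩
  · intro k hk
    rw [Finset.mem_filter, Finset.mem_Ioc] at hk
    obtain ⟨⟨h1, h2⟩, l, hl⟩ := hk
    rw [Finset.mem_filter, hl, Int.mul_ediv_cancel_left _ hqZ.ne']
    have hk : k = m + l * q := by linarith
    refine ⟨?_, ?_⟩
    · rw [Finset.mem_Icc, ← abs_le]
      have h3 : |q * l| ≤ (N : ℤ) := by rw [← hl, abs_le]; constructor <;> linarith
      rw [abs_mul, abs_of_pos hqZ] at h3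
      push_cast
      rw [Int.le_ediv_iff_mul_le hqZ]
      linarith
    · rw [← hk]; exact ⟨h1, h2⟩
  · intro l _
    rw [add_sub_cancel_left, Int.mul_ediv_cancel _ hqZ.ne']
  · intro k hk
    rw [Finset.mem_filter] at hk
    rw [Int.ediv_mul_cancel hk.2]; ring
  · intro l _; rfl

lemma sum_NdNd' {q : ℕ} (hq : 0 < q) (N D1 D2 : ℕ) :
    ∑ a ∈ Us q, Nd N q D1 a * Nd N q D2 a =
      ∑ l ∈ Finset.Icc (-((N / q : ℕ) : ℤ)) ((N / q : ℕ) : ℤ),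
        ∑ m ∈ Finset.Ioc (max 0 (-(l * q))) (min (N : ℤ) (N - l * q)),
          (iV D1 m * iV D2 (m + l * q)) * cI q m := by
  rw [sum_NdNd hq]
  have e : ∀ m ∈ Finset.Ioc (0 : ℤ) N, (iV D1 m * cI q m) * ∑ k ∈ Finset.Ioc (0 : ℤ) N, (if (q : ℤ) ∣ k - m then iV D2 k else 0)
      = ∑ l ∈ Finset.Icc (-((N / q : ℕ) : ℤ)) ((N / q : ℕ) : ℤ), if (0 < m + l * q ∧ m + l * q ≤ N) then
        (iV D1 m * iV D2 (m + l * q)) * cI q m else 0 := by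
    intro m hm
    rw [sum_shift hq N _ hm, Finset.mul_sum]
    refine Finset.sum_congr rfl fun l _ => ?_
    split_ifs <;> ring
  rw [Finset.sum_congr rfl e, Finset.sum_comm]
  refine Finset.sum_congr rfl fun l _ => ?_
  rw [← Finset.sum_filter]
  refine Finset.sum_congr ?_ fun _ _ => rfl
  ext m
  simp only [Finset.mem_filter, Finset.mem_Ioc, max_lt_iff, le_min_iff]
  constructor
  · rintro ⟨⟨a, b⟩, c, d⟩; exact ⟨⟨a, by linarith⟩, b, by linarith⟩
  · rintro ⟨⟨a, b⟩, c, d⟩; exact ⟨⟨a, c⟩, by linarith, by linarith⟩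

lemma one_le_card_div {q : ℕ} (hq : 0 < q) : (1 : ℝ) ≤ q.divisors.card := by
  have : 0 < q.divisors.card := Finset.card_pos.2 ⟨1, Nat.one_mem_divisors.2 hq.ne'⟩
  exact_mod_cast this

lemma tot_div {q : ℕ} (hq : 0 < q) : 0 ≤ (q.totient : ℝ) / q ∧ (q.totient : ℝ) / q ≤ 1 := by
  have hqR : (0 : ℝ) < q := by exact_mod_cast hq
  refine ⟨by positivity, ?_⟩
  rw [div_le_one hqR]
  exact_mod_cast Nat.totient_le q

lemma pairs_approx {q : ℕ} (hq : 0 < q) {X : ℝ} (hX : (q : ℝ) ≤ X) {D1 D2 : ℕ} (h1 : 0 < D1) (h2 : 0 < D2)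
    (hc1 : Nat.Coprime q D1) (hc2 : Nat.Coprime q D2) :
    |∑ a ∈ Us q, Nd ⌊X⌋₊ q D1 a * Nd ⌊X⌋₊ q D2 a - (q.totient : ℝ) *
      ((Nat.gcd D1 D2 : ℝ) ^ 2 / (D1 * D2) * ((X / q / (Nat.gcd D1 D2 : ℝ)) ^ 2 + FF (X / q / (Nat.gcd D1 D2 : ℝ))))|
      ≤ 6 * (q.divisors.card : ℝ) * (X / q) := by
  have hqR : (0 : ℝ) < q := by exact_mod_cast hq
  have hX0 : 0 ≤ X := hqR.le.trans hX
  set N := ⌊X⌋₊ with hN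
  set G := Nat.gcd D1 D2 with hG
  set L := Nat.lcm D1 D2 with hL
  have hGp : 0 < G := Nat.gcd_pos_of_pos_left _ h1
  have hLp : 0 < L := Nat.lcm_pos h1 h2
  have hGL : (G : ℝ) * L = D1 * D2 := by exact_mod_cast Nat.gcd_mul_lcm D1 D2
  have hGR : (0 : ℝ) < G := by exact_mod_cast hGp
  have hLR : (1 : ℝ) ≤ L := by exact_mod_cast hLp
  have hcL : Nat.Coprime q L := by
    have : L ∣ D1 * D2 := Nat.lcm_dvd (Dvd.intro _ rfl) (Dvd.intro_left _ rfl)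
    exact Nat.Coprime.coprime_dvd_right this (Nat.Coprime.mul_right hc1 hc2)
  have hcG : Nat.Coprime G q := (Nat.Coprime.coprime_dvd_right (Nat.gcd_dvd_left D1 D2) hc1).symm
  set Y := X / q with hY
  have hY1 : 1 ≤ Y := by rw [hY, le_div_iff₀ hqR]; linarith
  have hK : N / q = ⌊Y⌋₊ := by rw [hY, Nat.floor_div_natCast]
  set K := N / q with hKd
  have hKY : (K : ℝ) ≤ Y := by rw [hK]; exact Nat.floor_le (by linarith)
  obtain ⟨t0, t1⟩ := tot_div hq
  have hd1 := one_le_card_div hq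
  rw [sum_NdNd' hq, ← hKd]
  have hcard : ((Finset.Icc (-(K : ℤ)) (K : ℤ)).card : ℝ) = 2 * K + 1 := by
    rw [Int.card_Icc]
    have : ((K : ℤ) + 1 - -(K : ℤ)).toNat = 2 * K + 1 := by omega
    rw [this]; push_cast; ring
  have hstep : ∀ l ∈ Finset.Icc (-(K : ℤ)) (K : ℤ),
      |∑ m ∈ Finset.Ioc (max 0 (-(l * q))) (min (N : ℤ) (N - l * q)), (iV D1 m * iV D2 (m + l * q)) * cI q m
        - (q.totient : ℝ) / L * (iV G l * (Y - |(l : ℝ)|))| ≤ 2 * q.divisors.card := by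
    intro l hl
    rw [Finset.mem_Icc, ← abs_le] at hl
    have hlq : |l| * q ≤ N := by
      have h3 : K * q ≤ N := Nat.div_mul_le_self _ _
      have h4 : (K : ℤ) * q ≤ N := by exact_mod_cast h3
      have h5 : |l| * q ≤ K * q := by
        apply mul_le_mul_of_nonneg_right hl; positivity
      linarith
    have hlen : min (N : ℤ) (N - l * q) - max 0 (-(l * q)) = N - |l| * q := by
      have hqZ : (0 : ℤ) < q := by exact_mod_cast hq
      rcases le_total 0 l with h | h
      · have : 0 ≤ l * q := by positivity
        rw [abs_of_nonneg h, min_eq_right (by linarith), max_eq_left (by linarith)]; ring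
      · have : l * q ≤ 0 := mul_nonpos_of_nonpos_of_nonneg h hqZ.le
        rw [abs_of_nonpos h, min_eq_left (by linarith), max_eq_right (by linarith)]; ring
    have hAB : max 0 (-(l * q)) ≤ min (N : ℤ) (N - l * q) := by linarith
    by_cases hGl : (G : ℤ) ∣ l
    · obtain ⟨v, hv⟩ := (pair_v hcG l).1 hGl
      simp_rw [hv]
      have h5 := count_cop hq.ne' hLp hcL hAB v
      have h6 : ((min (N : ℤ) (N - l * q) : ℤ) : ℝ) - ((max 0 (-(l * q)) : ℤ) : ℝ) = N - |(l : ℝ)| * q := by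
        rw [← Int.cast_sub, hlen]; push_cast; rfl
      rw [h6] at h5
      have h7 : iV G l = 1 := if_pos hGl
      rw [h7, one_mul]
      have h8 : |(q.totient : ℝ) / q * (((N : ℝ) - |(l : ℝ)| * q) / L) - (q.totient : ℝ) / L * (Y - |(l : ℝ)|)| ≤ 1 := by
        have e : (q.totient : ℝ) / q * (((N : ℝ) - |(l : ℝ)| * q) / L) - (q.totient : ℝ) / L * (Y - |(l : ℝ)|)
            = (q.totient : ℝ) / q * ((N - X) / L) := by
          rw [hY]; field_simp; ring
        rw [e, abs_mul, abs_of_nonneg t0]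
        have h9 : |((N : ℝ) - X) / L| ≤ 1 := by
          rw [abs_div, abs_of_pos (by linarith : (0 : ℝ) < L), div_le_one (by linarith)]
          have a1 := Nat.floor_le hX0
          have a2 := Nat.lt_floor_add_one X
          rw [abs_le]; constructor <;> linarith
        have := mul_le_mul t1 h9 (abs_nonneg _) zero_le_one
        linarith
      rw [hL] at *
      have := abs_sub_le (∑ m ∈ Finset.Ioc (max 0 (-(l * q))) (min (N : ℤ) (N - l * q)), iV (Nat.lcm D1 D2) (m - v) * cI q m)
        ((q.totient : ℝ) / q * (((N : ℝ) - |(l : ℝ)| * q) / (Nat.lcm D1 D2 : ℕ))) ((q.totient : ℝ) / (Nat.lcm D1 D2 : ℕ) * (Y - |(l : ℝ)|))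
      linarith
    · have h5 := (pair_v hcG l).2 hGl
      have h7 : iV G l = 0 := if_neg hGl
      rw [h7]
      simp_rw [h5]
      simp
  have htri := sum_tri (Y := Y) (by linarith) hGp
  rw [← hK] at htri
  have e : (q.totient : ℝ) * ((G : ℝ) ^ 2 / (D1 * D2) * ((Y / G) ^ 2 + FF (Y / G))) =
      ∑ l ∈ Finset.Icc (-(K : ℤ)) (K : ℤ), (q.totient : ℝ) / L * (iV G l * (Y - |(l : ℝ)|)) := by
    rw [← Finset.mul_sum, htri, ← hGL]
    field_simp
  rw [e, ← Finset.sum_sub_distrib]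
  refine (Finset.abs_sum_le_sum_abs _ _).trans ?_
  refine (Finset.sum_le_card_nsmul _ _ _ hstep).trans ?_
  rw [nsmul_eq_mul, hcard]
  nlinarith

lemma single_approx {q : ℕ} (hq : 0 < q) {X : ℝ} (hX : (q : ℝ) ≤ X) {D : ℕ} (h1 : 0 < D)
    (hc1 : Nat.Coprime q D) :
    |∑ a ∈ Us q, Nd ⌊X⌋₊ q D a - (q.totient : ℝ) * (X / q / D)| ≤ 2 * (q.divisors.card : ℝ) := by
  have hqR : (0 : ℝ) < q := by exact_mod_cast hq
  have hX0 : 0 ≤ X := hqR.le.trans hX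
  have hDR : (1 : ℝ) ≤ D := by exact_mod_cast h1
  obtain ⟨t0, t1⟩ := tot_div hq
  have hd1 := one_le_card_div hq
  rw [sum_Nd hq]
  have h5 := count_cop hq.ne' h1 hc1 (A := 0) (B := (⌊X⌋₊ : ℤ)) (by positivity) 0
  have h8 : |(q.totient : ℝ) / q * ((((⌊X⌋₊ : ℤ) : ℝ) - ((0 : ℤ) : ℝ)) / D) - (q.totient : ℝ) * (X / q / D)| ≤ 1 := by
    have e : (q.totient : ℝ) / q * ((((⌊X⌋₊ : ℤ) : ℝ) - ((0 : ℤ) : ℝ)) / D) - (q.totient : ℝ) * (X / q / D)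
        = (q.totient : ℝ) / q * (((⌊X⌋₊ : ℝ) - X) / D) := by
      push_cast; field_simp; ring
    rw [e, abs_mul, abs_of_nonneg t0]
    have h9 : |((⌊X⌋₊ : ℝ) - X) / D| ≤ 1 := by
      rw [abs_div, abs_of_pos (by linarith : (0 : ℝ) < D), div_le_one (by linarith)]
      have a1 := Nat.floor_le hX0
      have a2 := Nat.lt_floor_add_one X
      rw [abs_le]; constructor <;> linarith
    have := mul_le_mul t1 h9 (abs_nonneg _) zero_le_one
    linarith
  have := abs_sub_le (∑ m ∈ Finset.Ioc (0 : ℤ) (⌊X⌋₊ : ℤ), iV D (m - 0) * cI q m)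
    ((q.totient : ℝ) / q * ((((⌊X⌋₊ : ℤ) : ℝ) - ((0 : ℤ) : ℝ)) / D)) ((q.totient : ℝ) * (X / q / D))
  linarith

lemma var_pair {q : ℕ} (hq : 0 < q) {X : ℝ} (hX : (q : ℝ) ≤ X) {D1 D2 : ℕ} (h1 : 0 < D1) (h2 : 0 < D2)
    (hc1 : Nat.Coprime q D1) (hc2 : Nat.Coprime q D2) :
    |∑ a ∈ Us q, (Nd ⌊X⌋₊ q D1 a - X / q / D1) * (Nd ⌊X⌋₊ q D2 a - X / q / D2) - (q.totient : ℝ) *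
      ((Nat.gcd D1 D2 : ℝ) ^ 2 / (D1 * D2) * FF (X / q / (Nat.gcd D1 D2 : ℝ)))|
      ≤ 10 * (q.divisors.card : ℝ) * (X / q) := by
  have hqR : (0 : ℝ) < q := by exact_mod_cast hq
  have hX0 : 0 ≤ X := hqR.le.trans hX
  have a0 := pairs_approx hq hX h1 h2 hc1 hc2
  have a1 := single_approx hq hX h1 hc1
  have a2 := single_approx hq hX h2 hc2
  have hD1 : (1 : ℝ) ≤ D1 := by exact_mod_cast h1
  have hD2 : (1 : ℝ) ≤ D2 := by exact_mod_cast h2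
  have hGR : (0 : ℝ) < (Nat.gcd D1 D2 : ℝ) := by exact_mod_cast Nat.gcd_pos_of_pos_left _ h1
  have hd1 := one_le_card_div hq
  set Y := X / q with hY
  have hY1 : 1 ≤ Y := by rw [hY, le_div_iff₀ hqR]; linarith
  have e : ∑ a ∈ Us q, (Nd ⌊X⌋₊ q D1 a - Y / D1) * (Nd ⌊X⌋₊ q D2 a - Y / D2) =
      ∑ a ∈ Us q, Nd ⌊X⌋₊ q D1 a * Nd ⌊X⌋₊ q D2 a - Y / D2 * ∑ a ∈ Us q, Nd ⌊X⌋₊ q D1 a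
      - Y / D1 * ∑ a ∈ Us q, Nd ⌊X⌋₊ q D2 a + q.totient * (Y / D1 * (Y / D2)) := by
    have : ∀ a, (Nd ⌊X⌋₊ q D1 a - Y / D1) * (Nd ⌊X⌋₊ q D2 a - Y / D2) =
      Nd ⌊X⌋₊ q D1 a * Nd ⌊X⌋₊ q D2 a - Y / D2 * Nd ⌊X⌋₊ q D1 a - Y / D1 * Nd ⌊X⌋₊ q D2 a + Y / D1 * (Y / D2) := by
      intro a; ring
    simp_rw [this]
    rw [Finset.sum_add_distrib, Finset.sum_sub_distrib, Finset.sum_sub_distrib, ← Finset.mul_sum, ← Finset.mul_sum,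
      Finset.sum_const, Us_card, nsmul_eq_mul]
  rw [e]
  set S0 := ∑ a ∈ Us q, Nd ⌊X⌋₊ q D1 a * Nd ⌊X⌋₊ q D2 a
  set S1 := ∑ a ∈ Us q, Nd ⌊X⌋₊ q D1 a
  set S2 := ∑ a ∈ Us q, Nd ⌊X⌋₊ q D2 a
  set G : ℝ := (Nat.gcd D1 D2 : ℝ)
  set M := FF (Y / G)
  set ph : ℝ := (q.totient : ℝ)
  have e2 : S0 - Y / D2 * S1 - Y / D1 * S2 + ph * (Y / D1 * (Y / D2)) - ph * (G ^ 2 / (D1 * D2) * M) =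
      (S0 - ph * (G ^ 2 / (D1 * D2) * ((Y / G) ^ 2 + M))) - Y / D2 * (S1 - ph * (Y / D1))
        - Y / D1 * (S2 - ph * (Y / D2)) := by
    field_simp; ring
  rw [e2]
  have b1 : |Y / D2 * (S1 - ph * (Y / D1))| ≤ Y * (2 * q.divisors.card) := by
    rw [abs_mul, abs_of_nonneg (by positivity)]
    refine mul_le_mul (div_le_self (by linarith) hD2) a1 (abs_nonneg _) (by linarith)
  have b2 : |Y / D1 * (S2 - ph * (Y / D2))| ≤ Y * (2 * q.divisors.card) := by
    rw [abs_mul, abs_of_nonneg (by positivity)]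
    refine mul_le_mul (div_le_self (by linarith) hD1) a2 (abs_nonneg _) (by linarith)
  rw [abs_le] at *
  constructor <;> linarith [a0.1, a0.2, b1.1, b1.2, b2.1, b2.2]

noncomputable def Es (X : ℝ) (q z a : ℕ) : ℝ :=
  ∑ d ∈ Finset.Icc 1 z, cp q d * mu d * (Nd ⌊X⌋₊ q (d ^ 2) a - X / q / ((d ^ 2 : ℕ) : ℝ))

lemma Es_var {q : ℕ} (hq : 0 < q) {X : ℝ} (hX : (q : ℝ) ≤ X) (z : ℕ) :
    |∑ a ∈ Us q, Es X q z a ^ 2 - (q.totient : ℝ) * Tz q (X / q) z| ≤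
      10 * (q.divisors.card : ℝ) * (X / q) * (z : ℝ) ^ 2 := by
  have hqR : (0 : ℝ) < q := by exact_mod_cast hq
  have hX0 : 0 ≤ X := hqR.le.trans hX
  have e1 : ∑ a ∈ Us q, Es X q z a ^ 2 = ∑ d1 ∈ Finset.Icc 1 z, ∑ d2 ∈ Finset.Icc 1 z,
      (cp q d1 * mu d1) * (cp q d2 * mu d2) * ∑ a ∈ Us q, (Nd ⌊X⌋₊ q (d1 ^ 2) a - X / q / ((d1 ^ 2 : ℕ) : ℝ)) *
        (Nd ⌊X⌋₊ q (d2 ^ 2) a - X / q / ((d2 ^ 2 : ℕ) : ℝ)) := by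
    simp_rw [Finset.mul_sum]
    have : ∀ a, Es X q z a ^ 2 = ∑ d1 ∈ Finset.Icc 1 z, ∑ d2 ∈ Finset.Icc 1 z,
      (cp q d1 * mu d1) * (cp q d2 * mu d2) * ((Nd ⌊X⌋₊ q (d1 ^ 2) a - X / q / ((d1 ^ 2 : ℕ) : ℝ)) *
        (Nd ⌊X⌋₊ q (d2 ^ 2) a - X / q / ((d2 ^ 2 : ℕ) : ℝ))) := by
      intro a
      unfold Es
      rw [pow_two, Finset.sum_mul_sum]
      refine Finset.sum_congr rfl fun d1 _ => Finset.sum_congr rfl fun d2 _ => ?_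
      ring
    simp_rw [this]
    rw [Finset.sum_comm]
    refine Finset.sum_congr rfl fun d1 _ => ?_
    rw [Finset.sum_comm]
  rw [e1, Tz, Finset.mul_sum, ← Finset.sum_sub_distrib]
  have key : ∀ d1 ∈ Finset.Icc 1 z, ∀ d2 ∈ Finset.Icc 1 z,
      |(cp q d1 * mu d1) * (cp q d2 * mu d2) * ∑ a ∈ Us q, (Nd ⌊X⌋₊ q (d1 ^ 2) a - X / q / ((d1 ^ 2 : ℕ) : ℝ)) *
        (Nd ⌊X⌋₊ q (d2 ^ 2) a - X / q / ((d2 ^ 2 : ℕ) : ℝ)) - q.totient * Fpair q (X / q) d1 d2| ≤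
      10 * (q.divisors.card : ℝ) * (X / q) := by
    intro d1 hd1 d2 hd2
    rw [Finset.mem_Icc] at hd1 hd2
    have hR : 0 ≤ 10 * (q.divisors.card : ℝ) * (X / q) := by positivity
    by_cases c1 : Nat.Coprime d1 q
    swap
    · have : cp q d1 = 0 := if_neg c1
      simp only [Fpair, this]; simpa using hR
    by_cases c2 : Nat.Coprime d2 q
    swap
    · have : cp q d2 = 0 := if_neg c2
      simp only [Fpair, this]; simpa using hR
    have h := var_pair hq hX (D1 := d1 ^ 2) (D2 := d2 ^ 2) (by have := hd1.1; positivity) (by have := hd2.1; positivity)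
      (Nat.Coprime.pow_right 2 c1.symm) (Nat.Coprime.pow_right 2 c2.symm)
    have hg : Nat.gcd (d1 ^ 2) (d2 ^ 2) = Nat.gcd d1 d2 ^ 2 := Nat.pow_gcd_pow
    rw [hg] at h
    set S := ∑ a ∈ Us q, (Nd ⌊X⌋₊ q (d1 ^ 2) a - X / q / ((d1 ^ 2 : ℕ) : ℝ)) *
        (Nd ⌊X⌋₊ q (d2 ^ 2) a - X / q / ((d2 ^ 2 : ℕ) : ℝ))
    have e3 : (cp q d1 * mu d1) * (cp q d2 * mu d2) * S - q.totient * Fpair q (X / q) d1 d2 =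
      ((cp q d1 * mu d1) * (cp q d2 * mu d2)) * (S - (q.totient : ℝ) *
      (((Nat.gcd d1 d2 ^ 2 : ℕ) : ℝ) ^ 2 / ((d1 ^ 2 : ℕ) * (d2 ^ 2 : ℕ)) * FF (X / q / ((Nat.gcd d1 d2 ^ 2 : ℕ) : ℝ)))) := by
      unfold Fpair
      push_cast
      ring
    rw [e3, abs_mul]
    have hb : ∀ d, |cp q d * mu d| ≤ 1 := by
      intro d
      rw [abs_mul, abs_of_nonneg (cp_nonneg _ _)]
      have := mul_le_mul (cp_le_one q d) (mu_abs_le d) (abs_nonneg _) zero_le_one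
      linarith
    have h4 : |(cp q d1 * mu d1) * (cp q d2 * mu d2)| ≤ 1 := by
      rw [abs_mul]
      have := mul_le_mul (hb d1) (hb d2) (abs_nonneg _) zero_le_one
      linarith
    have := mul_le_mul h4 h (abs_nonneg _) zero_le_one
    linarith
  refine (Finset.abs_sum_le_sum_abs _ _).trans ?_
  have k2 : ∀ d1 ∈ Finset.Icc 1 z, |∑ d2 ∈ Finset.Icc 1 z,
      (cp q d1 * mu d1) * (cp q d2 * mu d2) * ∑ a ∈ Us q, (Nd ⌊X⌋₊ q (d1 ^ 2) a - X / q / ((d1 ^ 2 : ℕ) : ℝ)) *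
        (Nd ⌊X⌋₊ q (d2 ^ 2) a - X / q / ((d2 ^ 2 : ℕ) : ℝ)) - q.totient * ∑ d2 ∈ Finset.Icc 1 z, Fpair q (X / q) d1 d2| ≤
      z * (10 * (q.divisors.card : ℝ) * (X / q)) := by
    intro d1 hd1
    rw [Finset.mul_sum, ← Finset.sum_sub_distrib]
    refine (Finset.abs_sum_le_sum_abs _ _).trans ?_
    refine (Finset.sum_le_card_nsmul _ _ _ (key d1 hd1)).trans (le_of_eq ?_)
    simp
  refine (Finset.sum_le_card_nsmul _ _ _ k2).trans (le_of_eq ?_)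
  simp
  ring

end Nun


namespace Nun

lemma fiber_sum {α β G : Type*} [Fintype G] [DecidableEq G] (P : Finset α) (Q : Finset β)
    (f : α → G) (g : β → G) :
    (∑ x ∈ P, ∑ y ∈ Q, if f x = g y then (1 : ℝ) else 0) =
      ∑ t : G, (∑ x ∈ P, if f x = t then (1 : ℝ) else 0) * (∑ y ∈ Q, if g y = t then (1 : ℝ) else 0) := by
  simp_rw [Finset.sum_mul_sum]
  rw [Finset.sum_comm (s := Finset.univ)]
  refine Finset.sum_congr rfl fun x _ => ?_
  rw [Finset.sum_comm]
  refine Finset.sum_congr rfl fun y _ => ?_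
  rw [Finset.sum_eq_single (f x)]
  · by_cases h : f x = g y
    · simp [h]
    · simp [h, Ne.symm h]
  · intro b _ hb; simp [Ne.symm hb]
  · simp

lemma cs_fiber {α β G : Type*} [Fintype G] [DecidableEq G] (P : Finset α) (Q : Finset β)
    (f : α → G) (g : β → G) :
    (∑ x ∈ P, ∑ y ∈ Q, if f x = g y then (1 : ℝ) else 0) ^ 2 ≤
      (∑ x ∈ P, ∑ x' ∈ P, if f x = f x' then (1 : ℝ) else 0) *
      (∑ y ∈ Q, ∑ y' ∈ Q, if g y = g y' then (1 : ℝ) else 0) := by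
  rw [fiber_sum P Q, fiber_sum P P, fiber_sum Q Q]
  refine (Finset.sum_mul_sq_le_sq_mul_sq _ _ _).trans (le_of_eq ?_)
  simp only [pow_two]

lemma sum_prod_le {q M : ℕ} (S : Finset ℕ) (hS : ∀ m ∈ S, 1 ≤ m ∧ m ≤ M ∧ Nat.Coprime m q) {T : ℝ}
    (hT : ∀ n, 1 ≤ n → n ≤ M ^ 2 → (n.divisors.card : ℝ) ≤ T) (F : ℕ → ℝ) (hF : ∀ n, 0 ≤ F n) :
    ∑ a ∈ S, ∑ b ∈ S, F (a * b) ≤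
      T * ∑ n ∈ (Finset.Icc 1 (M ^ 2)).filter (fun n => Nat.Coprime n q), F n := by
  rw [← Finset.sum_product']
  have hm : ∀ x ∈ S ×ˢ S, x.1 * x.2 ∈ (Finset.Icc 1 (M ^ 2)).filter (fun n => Nat.Coprime n q) := by
    intro x hx
    rw [Finset.mem_product] at hx
    obtain ⟨h1, h2, h3⟩ := hS _ hx.1
    obtain ⟨h4, h5, h6⟩ := hS _ hx.2
    simp only [Finset.mem_filter, Finset.mem_Icc]
    refine ⟨⟨Nat.mul_pos h1 h4, ?_⟩, Nat.Coprime.mul_left h3 h6⟩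
    rw [pow_two]; exact Nat.mul_le_mul h2 h5
  rw [← Finset.sum_fiberwise_of_maps_to hm, Finset.mul_sum]
  refine Finset.sum_le_sum fun n hn => ?_
  simp only [Finset.mem_filter, Finset.mem_Icc] at hn
  have : ∑ x ∈ (S ×ˢ S).filter (fun x => x.1 * x.2 = n), F (x.1 * x.2) =
      (((S ×ˢ S).filter (fun x => x.1 * x.2 = n)).card : ℝ) * F n := by
    rw [Finset.sum_congr rfl (g := fun _ => F n)]
    · simp
    · intro x hx; rw [(Finset.mem_filter.1 hx).2]
  rw [this]
  refine mul_le_mul_of_nonneg_right ?_ (hF n)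
  refine le_trans ?_ (hT n hn.1.1 hn.1.2)
  have : ((S ×ˢ S).filter (fun x => x.1 * x.2 = n)).card ≤ n.divisors.card := by
    refine Finset.card_le_card_of_injOn (fun x => x.1) ?_ ?_
    · intro x hx
      have hx := (Finset.mem_filter.1 hx).2
      simp only [Finset.mem_coe, Nat.mem_divisors]
      exact ⟨⟨x.2, hx.symm⟩, by omega⟩
    · intro x hx y hy hxy
      have hx := (Finset.mem_filter.1 hx).2
      have hy := (Finset.mem_filter.1 hy).2
      simp only at hxy
      have h0 : 0 < x.1 := by
        rcases Nat.eq_zero_or_pos x.1 with h | h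
        · rw [h, zero_mul] at hx; omega
        · exact h
      refine Prod.ext hxy ?_
      rw [← hxy] at hy
      exact Nat.eq_of_mul_eq_mul_left h0 (hx.trans hy.symm)
  exact_mod_cast this

lemma card_modeq {q K : ℕ} (hq : 0 < q) (s : Finset ℕ) (hs : ∀ x ∈ s, x ≤ K)
    (h : ∀ x ∈ s, ∀ y ∈ s, x % q = y % q) : (s.card : ℝ) ≤ (K : ℝ) / q + 1 := by
  have h1 : s.card ≤ (Finset.range (K / q + 1)).card := by
    refine Finset.card_le_card_of_injOn (fun x => x / q) ?_ ?_
    · intro x hx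
      have := Nat.div_le_div_right (c := q) (hs x hx)
      simp; omega
    · intro x hx y hy hxy
      simp only at hxy
      rw [← Nat.div_add_mod x q, ← Nat.div_add_mod y q, hxy, h x hx y hy]
  rw [Finset.card_range] at h1
  have h2 : ((K / q : ℕ) : ℝ) ≤ (K : ℝ) / q := Nat.cast_div_le
  have h3 : (s.card : ℝ) ≤ ((K / q + 1 : ℕ) : ℝ) := by exact_mod_cast h1
  push_cast at h3
  linarith

lemma count_eq {q K : ℕ} [NeZero q] :
    ∑ n ∈ (Finset.Icc 1 K).filter (fun n => Nat.Coprime n q),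
      ∑ n' ∈ (Finset.Icc 1 K).filter (fun n => Nat.Coprime n q),
        (if (n : ZMod q) = (n' : ZMod q) then (1 : ℝ) else 0) ≤ K * (K / q + 1) := by
  have hq : 0 < q := Nat.pos_of_ne_zero (NeZero.ne q)
  have : ∀ n ∈ (Finset.Icc 1 K).filter (fun n => Nat.Coprime n q),
      ∑ n' ∈ (Finset.Icc 1 K).filter (fun n => Nat.Coprime n q),
        (if (n : ZMod q) = (n' : ZMod q) then (1 : ℝ) else 0) ≤ ((K : ℝ) / q + 1) := by
    intro n _
    rw [← Finset.sum_filter, Finset.sum_const, nsmul_eq_mul, mul_one]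
    refine card_modeq hq _ ?_ ?_
    · intro x hx; simp only [Finset.mem_filter, Finset.mem_Icc] at hx; omega
    · intro x hx y hy
      simp only [Finset.mem_filter] at hx hy
      have := hx.2.symm.trans hy.2
      exact (ZMod.natCast_eq_natCast_iff' _ _ _).1 this
  refine (Finset.sum_le_sum this).trans ?_
  rw [Finset.sum_const, nsmul_eq_mul]
  refine mul_le_mul_of_nonneg_right ?_ (by positivity)
  have := Finset.card_filter_le (Finset.Icc 1 K) (fun n => Nat.Coprime n q)
  rw [Nat.card_Icc] at this
  exact_mod_cast this

lemma count_sq {q K : ℕ} [NeZero q] :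
    ∑ n ∈ (Finset.Icc 1 K).filter (fun n => Nat.Coprime n q),
      ∑ n' ∈ (Finset.Icc 1 K).filter (fun n => Nat.Coprime n q),
        (if (n : ZMod q) ^ 2 = (n' : ZMod q) ^ 2 then (1 : ℝ) else 0) ≤
          q.divisors.card * (K * (2 * K / q + 1)) := by
  have hq : 0 < q := Nat.pos_of_ne_zero (NeZero.ne q)
  have : ∀ n ∈ (Finset.Icc 1 K).filter (fun n => Nat.Coprime n q),
      ∑ n' ∈ (Finset.Icc 1 K).filter (fun n => Nat.Coprime n q),
        (if (n : ZMod q) ^ 2 = (n' : ZMod q) ^ 2 then (1 : ℝ) else 0) ≤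
          (q.divisors.card : ℝ) * (2 * (K : ℝ) / q + 1) := by
    intro n hn
    simp only [Finset.mem_filter, Finset.mem_Icc] at hn
    rw [← Finset.sum_filter, Finset.sum_const, nsmul_eq_mul, mul_one]
    set s := ((Finset.Icc 1 K).filter (fun n => Nat.Coprime n q)).filter
      (fun n' : ℕ => (n : ZMod q) ^ 2 = (n' : ZMod q) ^ 2) with hs
    have hm : ∀ x ∈ s, Int.gcd ((x : ℤ) - n) q ∈ q.divisors := by
      intro x _
      rw [Nat.mem_divisors]
      refine ⟨?_, hq.ne'⟩
      have := Int.gcd_dvd_right ((x : ℤ) - n) q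
      exact_mod_cast this
    rw [Finset.card_eq_sum_card_fiberwise hm]
    push_cast
    rw [← nsmul_eq_mul]
    refine Finset.sum_le_card_nsmul _ _ _ fun g hg => ?_
    rw [Nat.mem_divisors] at hg
    have hinj : Set.InjOn (fun x : ℕ => 2 * x) (s.filter (fun x : ℕ => Int.gcd ((x : ℤ) - n) q = g) : Finset ℕ) := by
      intro x _ y _ h; simp only at h; omega
    rw [← Finset.card_image_of_injOn hinj]
    have := card_modeq (K := 2 * K) hq ((s.filter (fun x : ℕ => Int.gcd ((x : ℤ) - n) q = g)).image
      (fun x : ℕ => 2 * x)) ?_ ?_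
    · push_cast at this; exact this
    · intro x hx
      simp only [hs, Finset.mem_image, Finset.mem_filter, Finset.mem_Icc] at hx
      omega
    · obtain ⟨k, hk⟩ := hg.1
      have hg0 : 0 < g := Nat.pos_of_dvd_of_pos hg.1 hq
      have hk0 : 0 < k := by
        rcases Nat.eq_zero_or_pos k with h | h
        · subst h; omega
        · exact h
      have hcl : ∀ x ∈ s.filter (fun x : ℕ => Int.gcd ((x : ℤ) - n) q = g),
          (g : ℤ) ∣ (x : ℤ) - n ∧ (k : ℤ) ∣ (x : ℤ) + n := by
        intro x hx
        simp only [hs, Finset.mem_filter] at hx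
        obtain ⟨⟨_, h2⟩, h3⟩ := hx
        have h4 : (g : ℤ) ∣ (x : ℤ) - n := by rw [← h3]; exact Int.gcd_dvd_left _ _
        refine ⟨h4, ?_⟩
        have h5 : (q : ℤ) ∣ ((x : ℤ) - n) * ((x : ℤ) + n) := by
          rw [← ZMod.intCast_zmod_eq_zero_iff_dvd]
          push_cast
          linear_combination -h2
        obtain ⟨e, he⟩ := h4
        rw [he, hk] at h5
        have h6 : (k : ℤ) ∣ e * ((x : ℤ) + n) := by
          have : (g : ℤ) * k ∣ g * (e * ((x : ℤ) + n)) := by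
            have h7 := h5
            push_cast at h7
            rwa [mul_assoc] at h7
          exact Int.dvd_of_mul_dvd_mul_left (by exact_mod_cast hg0.ne') this
        have h7 : IsCoprime (k : ℤ) e := by
          rw [Int.isCoprime_iff_gcd_eq_one]
          rw [he, hk] at h3
          push_cast at h3
          rw [Int.gcd_mul_left] at h3
          simp only [Int.natAbs_natCast] at h3
          have : g * Int.gcd e k = g * 1 := by rw [h3, mul_one]
          have := Nat.eq_of_mul_eq_mul_left hg0 this
          rw [Int.gcd_comm]; exact this
        exact h7.dvd_of_dvd_mul_left h6
      have hgcd : ∀ x ∈ s.filter (fun x : ℕ => Int.gcd ((x : ℤ) - n) q = g), Nat.gcd g k ∣ 2 := by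
        intro x hx
        obtain ⟨h1, h2⟩ := hcl x hx
        have h3 : ((Nat.gcd g k : ℕ) : ℤ) ∣ 2 * n := by
          have ha : ((Nat.gcd g k : ℕ) : ℤ) ∣ (g : ℤ) := by exact_mod_cast Nat.gcd_dvd_left g k
          have hb : ((Nat.gcd g k : ℕ) : ℤ) ∣ (k : ℤ) := by exact_mod_cast Nat.gcd_dvd_right g k
          have := dvd_sub (hb.trans h2) (ha.trans h1)
          ring_nf at this ⊢
          exact this
        have h4 : Nat.gcd g k ∣ 2 * n := by exact_mod_cast h3
        have h5 : Nat.Coprime (Nat.gcd g k) n := by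
          refine Nat.Coprime.coprime_dvd_left ((Nat.gcd_dvd_left g k).trans hg.1) hn.2.symm
        exact h5.dvd_of_dvd_mul_right h4
      intro x hx y hy
      simp only [Finset.mem_image] at hx hy
      obtain ⟨x, hx, rfl⟩ := hx
      obtain ⟨y, hy, rfl⟩ := hy
      obtain ⟨h1, h2⟩ := hcl x hx
      obtain ⟨h3, h4⟩ := hcl y hy
      have h5 : (g : ℤ) ∣ (x : ℤ) - y := by have := dvd_sub h1 h3; ring_nf at this ⊢; exact this
      have h6 : (k : ℤ) ∣ (x : ℤ) - y := by have := dvd_sub h2 h4; ring_nf at this ⊢; exact this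
      have h7 : ((Nat.lcm g k : ℕ) : ℤ) ∣ (x : ℤ) - y := by
        have := Int.coe_lcm_dvd h5 h6
        simpa [Int.lcm] using this
      have h8 : (q : ℤ) ∣ 2 * ((x : ℤ) - y) := by
        have : (q : ℤ) = ((Nat.gcd g k : ℕ) : ℤ) * ((Nat.lcm g k : ℕ) : ℤ) := by
          rw [hk]; exact_mod_cast (Nat.gcd_mul_lcm g k).symm
        rw [this]
        exact mul_dvd_mul (by exact_mod_cast hgcd x hx) h7
      have h9 : ((2 * y : ℕ)) ≡ (2 * x : ℕ) [MOD q] := by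
        rw [Nat.modEq_iff_dvd]; push_cast; rw [← mul_sub]; exact h8
      exact h9.symm
  refine (Finset.sum_le_sum this).trans ?_
  rw [Finset.sum_const, nsmul_eq_mul]
  have h1 : ((((Finset.Icc 1 K).filter (fun n => Nat.Coprime n q)).card : ℕ) : ℝ) ≤ K := by
    have := Finset.card_filter_le (Finset.Icc 1 K) (fun n => Nat.Coprime n q)
    rw [Nat.card_Icc] at this
    exact_mod_cast this
  calc _ ≤ (K : ℝ) * ((q.divisors.card : ℝ) * (2 * (K : ℝ) / q + 1)) :=
        mul_le_mul_of_nonneg_right h1 (by positivity)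
    _ = _ := by ring

end Nun


namespace Nun

lemma quad_le {q M : ℕ} (S : Finset ℕ) (hS : ∀ m ∈ S, 1 ≤ m ∧ m ≤ M ∧ Nat.Coprime m q) {T : ℝ}
    (hT : ∀ n, 1 ≤ n → n ≤ M ^ 2 → (n.divisors.card : ℝ) ≤ T) (hT0 : 0 ≤ T)
    (r : ℕ → ℕ → ℝ) (hr : ∀ a b, 0 ≤ r a b) :
    ∑ x ∈ S ×ˢ S, ∑ y ∈ S ×ˢ S, r (x.1 * y.2) (y.1 * x.2) ≤
      T ^ 2 * ∑ n ∈ (Finset.Icc 1 (M ^ 2)).filter (fun n => Nat.Coprime n q),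
        ∑ n' ∈ (Finset.Icc 1 (M ^ 2)).filter (fun n => Nat.Coprime n q), r n n' := by
  have h1 : ∑ x ∈ S ×ˢ S, ∑ y ∈ S ×ˢ S, r (x.1 * y.2) (y.1 * x.2) =
      ∑ a ∈ S, ∑ d ∈ S, ∑ c ∈ S, ∑ b ∈ S, r (a * d) (c * b) := by
    simp only [Finset.sum_product]
    refine Finset.sum_congr rfl fun a _ => ?_
    calc _ = ∑ b ∈ S, ∑ d ∈ S, ∑ c ∈ S, r (a * d) (c * b) :=
          Finset.sum_congr rfl fun b _ => Finset.sum_comm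
      _ = ∑ d ∈ S, ∑ b ∈ S, ∑ c ∈ S, r (a * d) (c * b) := Finset.sum_comm
      _ = _ := Finset.sum_congr rfl fun d _ => Finset.sum_comm
  rw [h1]
  refine (sum_prod_le S hS hT (fun n => ∑ c ∈ S, ∑ b ∈ S, r n (c * b))
    (fun n => Finset.sum_nonneg fun _ _ => Finset.sum_nonneg fun _ _ => hr _ _)).trans ?_
  rw [pow_two T, mul_assoc]
  refine mul_le_mul_of_nonneg_left ?_ hT0
  rw [Finset.mul_sum]
  refine Finset.sum_le_sum fun n _ => ?_
  exact sum_prod_le S hS hT (fun m => r n m) (fun m => hr _ _)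

lemma div_iff {R : Type*} [CommRing R] {a b c d b' d' : R} (hb : b * b' = 1) (hd : d * d' = 1) :
    a * b' = c * d' ↔ a * d = c * b := by
  constructor
  · intro h
    linear_combination (b * d) * h - a * d * hb + c * b * hd
  · intro h
    linear_combination (b' * d') * h - a * b' * hd + c * d' * hb

lemma block_energy {q : ℕ} [NeZero q] {M D : ℕ} (S B : Finset ℕ)
    (hS : ∀ m ∈ S, 1 ≤ m ∧ m ≤ M ∧ Nat.Coprime m q) (hB : ∀ m ∈ B, 1 ≤ m ∧ m ≤ D ∧ Nat.Coprime m q) {T : ℝ}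
    (hT1 : ∀ n, 1 ≤ n → n ≤ M ^ 2 → (n.divisors.card : ℝ) ≤ T)
    (hT2 : ∀ n, 1 ≤ n → n ≤ D ^ 2 → (n.divisors.card : ℝ) ≤ T) (hT0 : 0 ≤ T) :
    (∑ x ∈ S ×ˢ B, ∑ y ∈ S ×ˢ B,
      if (x.1 : ZMod q) * (x.2 : ZMod q) ^ 2 = (y.1 : ZMod q) * (y.2 : ZMod q) ^ 2 then (1 : ℝ) else 0) ^ 2 ≤
      (T ^ 2 * ((M : ℝ) ^ 2 * ((M : ℝ) ^ 2 / q + 1))) *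
      (T ^ 2 * (q.divisors.card * ((D : ℝ) ^ 2 * (2 * (D : ℝ) ^ 2 / q + 1)))) := by
  have uS : ∀ m ∈ S, (m : ZMod q) * (m : ZMod q)⁻¹ = 1 := fun m hm =>
    ZMod.coe_mul_inv_eq_one m (hS m hm).2.2
  have uB : ∀ m ∈ B, (m : ZMod q) ^ 2 * ((m : ZMod q)⁻¹) ^ 2 = 1 := fun m hm => by
    rw [← mul_pow, ZMod.coe_mul_inv_eq_one m (hB m hm).2.2, one_pow]
  have h1 : (∑ x ∈ S ×ˢ B, ∑ y ∈ S ×ˢ B,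
      if (x.1 : ZMod q) * (x.2 : ZMod q) ^ 2 = (y.1 : ZMod q) * (y.2 : ZMod q) ^ 2 then (1 : ℝ) else 0) =
      ∑ x ∈ S ×ˢ S, ∑ y ∈ B ×ˢ B,
        if (x.1 : ZMod q) * (x.2 : ZMod q)⁻¹ = (y.2 : ZMod q) ^ 2 * ((y.1 : ZMod q)⁻¹) ^ 2
        then (1 : ℝ) else 0 := by
    simp only [Finset.sum_product]
    refine Finset.sum_congr rfl fun a ha => ?_
    rw [Finset.sum_comm]
    refine Finset.sum_congr rfl fun b hb => ?_
    refine Finset.sum_congr rfl fun c hc => ?_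
    refine Finset.sum_congr rfl fun d hd => ?_
    refine if_congr ?_ rfl rfl
    rw [div_iff (uS b hb) (uB c hc), mul_comm (b : ZMod q)]
  rw [h1]
  refine (cs_fiber (S ×ˢ S) (B ×ˢ B) (fun x => (x.1 : ZMod q) * (x.2 : ZMod q)⁻¹)
    (fun y => (y.2 : ZMod q) ^ 2 * ((y.1 : ZMod q)⁻¹) ^ 2)).trans ?_
  refine mul_le_mul ?_ ?_ (Finset.sum_nonneg fun _ _ => Finset.sum_nonneg fun _ _ => by split_ifs <;> norm_num)
    (by positivity)
  · have h2 : ∑ x ∈ S ×ˢ S, ∑ x' ∈ S ×ˢ S,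
        (if (x.1 : ZMod q) * (x.2 : ZMod q)⁻¹ = (x'.1 : ZMod q) * (x'.2 : ZMod q)⁻¹ then (1 : ℝ) else 0) =
        ∑ x ∈ S ×ˢ S, ∑ y ∈ S ×ˢ S, (fun n n' : ℕ => if (n : ZMod q) = (n' : ZMod q) then (1 : ℝ) else 0)
          (x.1 * y.2) (y.1 * x.2) := by
      refine Finset.sum_congr rfl fun x hx => Finset.sum_congr rfl fun y hy => ?_
      rw [Finset.mem_product] at hx hy
      simp only [Nat.cast_mul]
      exact if_congr (div_iff (uS _ hx.2) (uS _ hy.2)) rfl rfl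
    rw [h2]
    refine (quad_le S hS hT1 hT0 (fun n n' : ℕ => if (n : ZMod q) = (n' : ZMod q) then (1 : ℝ) else 0)
      (fun a b => by split_ifs <;> norm_num)).trans ?_
    refine mul_le_mul_of_nonneg_left ?_ (by positivity)
    have := count_eq (q := q) (K := M ^ 2)
    push_cast at this
    exact this
  · have h2 : ∑ x ∈ B ×ˢ B, ∑ x' ∈ B ×ˢ B,
        (if (x.2 : ZMod q) ^ 2 * ((x.1 : ZMod q)⁻¹) ^ 2 = (x'.2 : ZMod q) ^ 2 * ((x'.1 : ZMod q)⁻¹) ^ 2 then (1 : ℝ) else 0) =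
        ∑ x ∈ B ×ˢ B, ∑ y ∈ B ×ˢ B, (fun n n' : ℕ => if (n : ZMod q) ^ 2 = (n' : ZMod q) ^ 2 then (1 : ℝ) else 0)
          (x.1 * y.2) (y.1 * x.2) := by
      refine Finset.sum_congr rfl fun x hx => Finset.sum_congr rfl fun y hy => ?_
      rw [Finset.mem_product] at hx hy
      simp only [Nat.cast_mul]
      refine if_congr ?_ rfl rfl
      rw [div_iff (uB _ hx.1) (uB _ hy.1), mul_pow, mul_pow, eq_comm, mul_comm ((y.2 : ZMod q) ^ 2),
        mul_comm ((x.2 : ZMod q) ^ 2)]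
    rw [h2]
    refine (quad_le B hB hT2 hT0 (fun n n' : ℕ => if (n : ZMod q) ^ 2 = (n' : ZMod q) ^ 2 then (1 : ℝ) else 0)
      (fun a b => by split_ifs <;> norm_num)).trans ?_
    refine mul_le_mul_of_nonneg_left ?_ (by positivity)
    have := count_sq (q := q) (K := D ^ 2)
    push_cast at this
    exact this

lemma Nd_nonneg (N q D a : ℕ) : 0 ≤ Nd N q D a := by
  unfold Nd
  exact Finset.sum_nonneg fun _ _ => by split_ifs <;> norm_num

lemma Nd_le {N q D a M : ℕ} (ha : Nat.Coprime a q) (hD : 0 < D) (hM : N / D ≤ M) :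
    Nd N q D a ≤ ∑ m ∈ (Finset.Icc 1 M).filter (fun m => Nat.Coprime m q),
      if (m * D) % q = a then (1 : ℝ) else 0 := by
  unfold Nd
  rw [← Finset.sum_filter, ← Finset.sum_filter, ← Finset.sum_filter]
  rw [Finset.sum_const, Finset.sum_const, nsmul_eq_mul, nsmul_eq_mul, mul_one, mul_one]
  have : ((((Finset.Icc 1 N).filter (fun n => n % q = a)).filter (fun n => D ∣ n))).card ≤
      ((((Finset.Icc 1 M).filter (fun m => Nat.Coprime m q)).filter (fun m => (m * D) % q = a))).card := by
    refine Finset.card_le_card_of_injOn (fun n => n / D) ?_ ?_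
    · intro n hn
      simp only [Finset.coe_filter, Set.mem_ofPred_eq, Finset.mem_filter, Finset.mem_Icc] at hn ⊢
      obtain ⟨⟨⟨h1, h2⟩, h3⟩, k, rfl⟩ := hn
      rw [Nat.mul_div_cancel_left _ hD]
      have hk : 0 < k := Nat.pos_of_mul_pos_left h1
      refine ⟨⟨⟨hk, ?_⟩, ?_⟩, by rw [mul_comm]; exact h3⟩
      · refine le_trans ?_ hM
        rw [Nat.le_div_iff_mul_le hD, mul_comm]; exact h2
      · rw [← h3] at ha
        have : Nat.Coprime (D * k) q := by
          rw [Nat.coprime_iff_gcd_eq_one] at ha ⊢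
          rwa [← Nat.gcd_rec, Nat.gcd_comm] at ha
        exact Nat.Coprime.coprime_mul_left this
    · intro x hx y hy hxy
      simp only [Finset.coe_filter, Set.mem_ofPred_eq] at hx hy
      simp only at hxy
      rw [← Nat.div_mul_cancel hx.2, ← Nat.div_mul_cancel hy.2, hxy]
  exact_mod_cast this

lemma sum_sq_fiber {α : Type*} (U : Finset ℕ) (P : Finset α) (f : α → ℕ) :
    ∑ a ∈ U, (∑ x ∈ P, if f x = a then (1 : ℝ) else 0) ^ 2 ≤
      ∑ x ∈ P, ∑ y ∈ P, if f x = f y then (1 : ℝ) else 0 := by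
  simp_rw [pow_two, Finset.sum_mul_sum]
  rw [Finset.sum_comm]
  refine Finset.sum_le_sum fun x _ => ?_
  rw [Finset.sum_comm]
  refine Finset.sum_le_sum fun y _ => ?_
  by_cases h : f x = f y
  · simp only [h, if_true]
    calc _ = ∑ a ∈ U, if f y = a then (1 : ℝ) else 0 := by
          refine Finset.sum_congr rfl fun a _ => ?_
          split_ifs <;> norm_num
      _ ≤ 1 := by
          rw [Finset.sum_ite_eq]; split_ifs <;> norm_num
  · rw [if_neg h]
    refine le_of_eq (Finset.sum_eq_zero fun a _ => ?_)
    split_ifs with h1 h2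
    · exact absurd (h1.trans h2.symm) h
    all_goals norm_num

lemma block_bound {q : ℕ} [NeZero q] {N M D : ℕ} (B : Finset ℕ)
    (hB : ∀ m ∈ B, 1 ≤ m ∧ m ≤ D ∧ Nat.Coprime m q ∧ N / m ^ 2 ≤ M) {T : ℝ}
    (hT1 : ∀ n, 1 ≤ n → n ≤ M ^ 2 → (n.divisors.card : ℝ) ≤ T)
    (hT2 : ∀ n, 1 ≤ n → n ≤ D ^ 2 → (n.divisors.card : ℝ) ≤ T) (hT0 : 0 ≤ T) :
    (∑ a ∈ Us q, (∑ d ∈ B, Nd N q (d ^ 2) a) ^ 2) ^ 2 ≤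
      (T ^ 2 * ((M : ℝ) ^ 2 * ((M : ℝ) ^ 2 / q + 1))) *
      (T ^ 2 * (q.divisors.card * ((D : ℝ) ^ 2 * (2 * (D : ℝ) ^ 2 / q + 1)))) := by
  set S := (Finset.Icc 1 M).filter (fun m => Nat.Coprime m q) with hS
  refine le_trans ?_ (block_energy S B (fun m hm => by
    simp only [hS, Finset.mem_filter, Finset.mem_Icc] at hm; exact ⟨hm.1.1, hm.1.2, hm.2⟩)
    (fun m hm => ⟨(hB m hm).1, (hB m hm).2.1, (hB m hm).2.2.1⟩) hT1 hT2 hT0)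
  refine pow_le_pow_left₀ (Finset.sum_nonneg fun _ _ => sq_nonneg _) ?_ 2
  calc _ ≤ ∑ a ∈ Us q, (∑ x ∈ S ×ˢ B, if (x.1 * x.2 ^ 2) % q = a then (1 : ℝ) else 0) ^ 2 := by
        refine Finset.sum_le_sum fun a ha => ?_
        refine pow_le_pow_left₀ (Finset.sum_nonneg fun _ _ => Nd_nonneg _ _ _ _) ?_ 2
        rw [Finset.sum_product, Finset.sum_comm]
        refine Finset.sum_le_sum fun d hd => ?_
        obtain ⟨h1, h2, h3, h4⟩ := hB d hd
        exact Nd_le (Finset.mem_filter.1 ha).2 (by positivity) h4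
    _ ≤ _ := sum_sq_fiber _ _ _
    _ = _ := by
        refine Finset.sum_congr rfl fun x _ => Finset.sum_congr rfl fun y _ => ?_
        refine if_congr ?_ rfl rfl
        rw [← ZMod.natCast_eq_natCast_iff']
        push_cast
        rfl

end Nun


namespace Nun

noncomputable def Rl (N q z a : ℕ) : ℝ :=
  ∑ d ∈ (Finset.Ioc z N).filter (fun d => Nat.Coprime d q), Nd N q (d ^ 2) a

noncomputable def VV (X : ℝ) (q z : ℕ) : ℝ :=
  X ^ 2 / ((z : ℝ) ^ 2 * q) + X ^ 2 / ((z : ℝ) ^ 3 * Real.sqrt q) + X / Real.sqrt q + X / z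

lemma block_final {q : ℕ} (hq : 0 < q) {X : ℝ} (hX : (q : ℝ) ≤ X) {z : ℕ} (hz : 1 ≤ z) {T : ℝ} (hT1 : 1 ≤ T)
    (hT : ∀ n, 1 ≤ n → n ≤ 4 * ⌊X⌋₊ ^ 2 → (n.divisors.card : ℝ) ≤ T) (i : ℕ) :
    ∑ a ∈ Us q, (∑ d ∈ ((Finset.Ioc z ⌊X⌋₊).filter (fun d => Nat.Coprime d q)).filter
      (fun d => Nat.log 2 d = i), Nd ⌊X⌋₊ q (d ^ 2) a) ^ 2 ≤ 32 * T ^ 3 * VV X q z := by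
  haveI : NeZero q := ⟨hq.ne'⟩
  have hX0 : 0 < X := lt_of_lt_of_le (by exact_mod_cast hq) hX
  have hz0 : (0 : ℝ) < z := by exact_mod_cast hz
  have hq0 : (0 : ℝ) < q := by exact_mod_cast hq
  set N := ⌊X⌋₊ with hN
  have hNX : (N : ℝ) ≤ X := Nat.floor_le hX0.le
  have hqN : q ≤ N := Nat.le_floor hX
  have hV : 0 ≤ VV X q z := by unfold VV; positivity
  set B := ((Finset.Ioc z N).filter (fun d => Nat.Coprime d q)).filter (fun d => Nat.log 2 d = i) with hB
  rcases B.eq_empty_or_nonempty with hBe | ⟨d0, hd0⟩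
  · rw [hBe]; simp; positivity
  have hBm : ∀ d ∈ B, z < d ∧ d ≤ N ∧ Nat.Coprime d q ∧ 2 ^ i ≤ d ∧ d < 2 ^ (i + 1) := by
    intro d hd
    simp only [hB, Finset.mem_filter, Finset.mem_Ioc] at hd
    obtain ⟨⟨⟨h1, h2⟩, h3⟩, h4⟩ := hd
    refine ⟨h1, h2, h3, ?_, ?_⟩
    · rw [← h4]; exact Nat.pow_log_le_self 2 (by omega)
    · rw [← h4]; exact Nat.lt_pow_succ_log_self (by norm_num) d
  set D := 2 ^ (i + 1) with hD
  set M := N / (2 ^ i) ^ 2 with hM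
  obtain ⟨e1, e2, e3, e4, e5⟩ := hBm d0 hd0
  have hD2 : D ≤ 2 * N := by rw [hD, pow_succ]; omega
  have hNpos : 1 ≤ N := by omega
  have hMN : M ≤ N := Nat.div_le_self _ _
  have hbb := block_bound (q := q) (N := N) (M := M) (D := D) B (fun d hd => by
    obtain ⟨h1, h2, h3, h4, h5⟩ := hBm d hd
    refine ⟨by omega, h5.le, h3, ?_⟩
    exact Nat.div_le_div_left (Nat.pow_le_pow_left h4 2) (by positivity)) (T := T)
    (fun n h1 h2 => hT n h1 (by nlinarith)) (fun n h1 h2 => hT n h1 (by nlinarith)) (by linarith)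
  set W := ∑ a ∈ Us q, (∑ d ∈ B, Nd N q (d ^ 2) a) ^ 2 with hW
  have hdq : (q.divisors.card : ℝ) ≤ T := hT q hq (by nlinarith)
  have hDz : (z : ℝ) ≤ D := by
    have : z ≤ D := by omega
    exact_mod_cast this
  have hD0 : (0 : ℝ) < D := lt_of_lt_of_le hz0 hDz
  have hMX : (M : ℝ) ≤ 4 * X / (D : ℝ) ^ 2 := by
    have h1 : (M : ℝ) ≤ (N : ℝ) / (((2 ^ i) ^ 2 : ℕ) : ℝ) := Nat.cast_div_le
    have h2 : (D : ℝ) ^ 2 = 4 * (((2 ^ i) ^ 2 : ℕ) : ℝ) := by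
      rw [hD]; push_cast; ring
    rw [h2, mul_div_mul_left _ _ (by norm_num)]
    exact h1.trans (div_le_div_of_nonneg_right hNX (by positivity))
  set s := 1 / Real.sqrt q with hs
  have hsq : 0 < Real.sqrt q := Real.sqrt_pos.2 hq0
  have hs0 : 0 < s := by positivity
  have hs2 : s ^ 2 = 1 / q := by rw [hs, div_pow, Real.sq_sqrt hq0.le, one_pow]
  have hM0 : (0 : ℝ) ≤ M := by positivity
  have h1 : W ≤ T ^ 3 * ((M : ℝ) * D * ((M * s + 1) * (2 * D * s + 1))) := by
    refine le_of_sq_le_sq ?_ (by positivity)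
    refine hbb.trans ?_
    have a1 : (M : ℝ) ^ 2 / q + 1 ≤ (M * s + 1) ^ 2 := by
      have : (M * s + 1) ^ 2 = M ^ 2 * s ^ 2 + 2 * (M * s) + 1 := by ring
      rw [this, hs2]
      have : 0 ≤ M * s := by positivity
      have e : (M : ℝ) ^ 2 / q = M ^ 2 * (1 / q) := by ring
      linarith
    have a2 : 2 * (D : ℝ) ^ 2 / q + 1 ≤ (2 * D * s + 1) ^ 2 := by
      have : (2 * D * s + 1) ^ 2 = 4 * (D ^ 2 * s ^ 2) + 4 * (D * s) + 1 := by ring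
      rw [this, hs2]
      have : 0 ≤ D * s := by positivity
      have e : 2 * (D : ℝ) ^ 2 / q = 2 * (D ^ 2 * (1 / q)) := by ring
      have e' : 0 ≤ (D : ℝ) ^ 2 * (1 / q) := by positivity
      linarith
    calc (T ^ 2 * ((M : ℝ) ^ 2 * ((M : ℝ) ^ 2 / q + 1))) *
      (T ^ 2 * (q.divisors.card * ((D : ℝ) ^ 2 * (2 * (D : ℝ) ^ 2 / q + 1)))) ≤
        (T ^ 2 * ((M : ℝ) ^ 2 * (M * s + 1) ^ 2)) *
      (T ^ 2 * (T ^ 2 * ((D : ℝ) ^ 2 * (2 * D * s + 1) ^ 2))) := by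
          have : (q.divisors.card : ℝ) ≤ T ^ 2 := by nlinarith
          gcongr
      _ = _ := by ring
  have h2 : (M : ℝ) * D ≤ 4 * X / D := by
    calc (M : ℝ) * D ≤ 4 * X / (D : ℝ) ^ 2 * D := by gcongr
      _ = _ := by field_simp
  have h3 : (M : ℝ) * D * ((M * s + 1) * (2 * D * s + 1)) ≤ 32 * VV X q z := by
    have e : (M * s + 1) * (2 * D * s + 1) = 2 * (M * D) * s ^ 2 + M * s + 2 * D * s + 1 := by ring
    calc (M : ℝ) * D * ((M * s + 1) * (2 * D * s + 1)) ≤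
          4 * X / D * (2 * (4 * X / D) * s ^ 2 + 4 * X / (D : ℝ) ^ 2 * s + 2 * D * s + 1) := by
          rw [e]; gcongr
      _ = 32 * (X ^ 2 * s ^ 2 / (D : ℝ) ^ 2) + 16 * (X ^ 2 * s / (D : ℝ) ^ 3) + 8 * (X * s) + 4 * (X / D) := by
          field_simp; ring
      _ ≤ 32 * (X ^ 2 * s ^ 2 / (z : ℝ) ^ 2) + 16 * (X ^ 2 * s / (z : ℝ) ^ 3) + 8 * (X * s) + 4 * (X / z) := by
          gcongr
      _ ≤ 32 * (X ^ 2 * s ^ 2 / (z : ℝ) ^ 2) + 32 * (X ^ 2 * s / (z : ℝ) ^ 3) + 32 * (X * s) + 32 * (X / z) := by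
          have := (by positivity : 0 ≤ X ^ 2 * s / (z : ℝ) ^ 3)
          have := (by positivity : 0 ≤ X * s)
          have := (by positivity : 0 ≤ X / z)
          linarith
      _ = _ := by
          unfold VV
          rw [hs2, hs]
          field_simp
  calc W ≤ _ := h1
    _ ≤ T ^ 3 * (32 * VV X q z) := by gcongr
    _ = _ := by ring

lemma R_bound {q : ℕ} (hq : 0 < q) {X : ℝ} (hX : (q : ℝ) ≤ X) {z : ℕ} (hz : 1 ≤ z) {T : ℝ} (hT1 : 1 ≤ T)
    (hT : ∀ n, 1 ≤ n → n ≤ 4 * ⌊X⌋₊ ^ 2 → (n.divisors.card : ℝ) ≤ T) :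
    ∑ a ∈ Us q, Rl ⌊X⌋₊ q z a ^ 2 ≤ ((Nat.log 2 ⌊X⌋₊ + 1 : ℕ) : ℝ) ^ 2 * (32 * T ^ 3 * VV X q z) := by
  set N := ⌊X⌋₊ with hN
  set B := (Finset.Ioc z N).filter (fun d => Nat.Coprime d q) with hB
  have hm : ∀ d ∈ B, Nat.log 2 d ∈ Finset.range (Nat.log 2 N + 1) := by
    intro d hd
    simp only [hB, Finset.mem_filter, Finset.mem_Ioc] at hd
    have := Nat.log_mono_right (b := 2) hd.1.2
    simp; omega
  have h1 : ∀ a, Rl N q z a ^ 2 ≤ ((Nat.log 2 N + 1 : ℕ) : ℝ) * ∑ i ∈ Finset.range (Nat.log 2 N + 1),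
      (∑ d ∈ B.filter (fun d => Nat.log 2 d = i), Nd N q (d ^ 2) a) ^ 2 := by
    intro a
    unfold Rl
    rw [← hB, ← Finset.sum_fiberwise_of_maps_to hm]
    have := sq_sum_le_card_mul_sum_sq (s := Finset.range (Nat.log 2 N + 1))
      (f := fun i => ∑ d ∈ B.filter (fun d => Nat.log 2 d = i), Nd N q (d ^ 2) a)
    rw [Finset.card_range] at this
    exact this
  calc _ ≤ _ := Finset.sum_le_sum fun a _ => h1 a
    _ = ((Nat.log 2 N + 1 : ℕ) : ℝ) * ∑ i ∈ Finset.range (Nat.log 2 N + 1), ∑ a ∈ Us q,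
      (∑ d ∈ B.filter (fun d => Nat.log 2 d = i), Nd N q (d ^ 2) a) ^ 2 := by
        rw [← Finset.mul_sum, Finset.sum_comm]
    _ ≤ ((Nat.log 2 N + 1 : ℕ) : ℝ) * ∑ i ∈ Finset.range (Nat.log 2 N + 1), (32 * T ^ 3 * VV X q z) := by
        refine mul_le_mul_of_nonneg_left (Finset.sum_le_sum fun i _ => ?_) (by positivity)
        exact block_final hq hX hz hT1 hT i
    _ = _ := by
        rw [Finset.sum_const, Finset.card_range, nsmul_eq_mul]; ring

lemma R_bound' : ∃ C : ℝ, 0 < C ∧ ∀ (q : ℕ) (X : ℝ) (z : ℕ), 0 < q → (q : ℝ) ≤ X → 1 ≤ z →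
    ∑ a ∈ Us q, Rl ⌊X⌋₊ q z a ^ 2 ≤ C * X ^ (1 / 100 : ℝ) * VV X q z := by
  obtain ⟨C, hC1, hC⟩ := divisor_bound (1 / 1000) (by norm_num)
  refine ⟨4000000 * 32 * (C * 4) ^ 3, by positivity, ?_⟩
  intro q X z hq hX hz
  have hX1 : 1 ≤ X := le_trans (by exact_mod_cast hq) hX
  have hX0 : 0 < X := by linarith
  set N := ⌊X⌋₊ with hN
  have hNX : (N : ℝ) ≤ X := Nat.floor_le hX0.le
  have hN1 : 1 ≤ N := Nat.le_floor (by simpa using hX1)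
  have hN1' : (1 : ℝ) ≤ N := by exact_mod_cast hN1
  set t := X ^ (1 / 1000 : ℝ) with ht
  have ht1 : 1 ≤ t := Real.one_le_rpow hX1 (by norm_num)
  set T := C * 4 * t ^ 2 with hTd
  have hT1 : 1 ≤ T := by nlinarith [mul_le_mul hC1 (one_le_pow₀ ht1 (n := 2)) (by norm_num) (by linarith)]
  have hb := R_bound hq hX hz hT1 (fun n h1 h2 => by
    refine (hC n (by omega)).trans ?_
    have h3 : (n : ℝ) ≤ 4 * (X * X) := by
      have : (n : ℝ) ≤ 4 * (N : ℝ) ^ 2 := by exact_mod_cast h2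
      nlinarith
    have h4 : (n : ℝ) ^ (1 / 1000 : ℝ) ≤ 4 * t ^ 2 := by
      calc (n : ℝ) ^ (1 / 1000 : ℝ) ≤ (4 * (X * X)) ^ (1 / 1000 : ℝ) :=
            Real.rpow_le_rpow (by positivity) h3 (by norm_num)
        _ = (4 : ℝ) ^ (1 / 1000 : ℝ) * (t * t) := by
            rw [Real.mul_rpow (by norm_num) (by positivity), Real.mul_rpow hX0.le hX0.le]
        _ ≤ (4 : ℝ) ^ (1 : ℝ) * (t * t) := by
            refine mul_le_mul_of_nonneg_right ?_ (by positivity)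
            exact Real.rpow_le_rpow_of_exponent_le (by norm_num) (by norm_num)
        _ = _ := by rw [Real.rpow_one]; ring
    calc C * (n : ℝ) ^ (1 / 1000 : ℝ) ≤ C * (4 * t ^ 2) := by gcongr
      _ = T := by rw [hTd]; ring)
  refine hb.trans ?_
  have hV : 0 ≤ VV X q z := by
    have : (0 : ℝ) < q := by exact_mod_cast hq
    unfold VV; positivity
  have hlog : ((Nat.log 2 N + 1 : ℕ) : ℝ) ≤ 2000 * t := by
    have h1 : ((2 ^ (Nat.log 2 N) : ℕ) : ℝ) ≤ N := by exact_mod_cast Nat.pow_log_le_self 2 (by omega)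
    have h2 : (Nat.log 2 N : ℝ) * Real.log 2 ≤ Real.log X := by
      rw [← Real.log_pow]
      refine Real.log_le_log (by positivity) ?_
      push_cast at h1
      linarith
    have h3 : Real.log X ≤ X ^ (1 / 1000 : ℝ) / (1 / 1000) := Real.log_le_rpow_div hX0.le (by norm_num)
    have h4 : (0.69 : ℝ) < Real.log 2 := by have := Real.log_two_gt_d9; linarith
    rw [← ht] at h3
    have h5 : (Nat.log 2 N : ℝ) * 0.69 ≤ (Nat.log 2 N : ℝ) * Real.log 2 := by gcongr
    push_cast
    have h6 : t / (1 / 1000) = 1000 * t := by ring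
    rw [h6] at h3
    linarith
  have ht8 : t ^ 8 ≤ X ^ (1 / 100 : ℝ) := by
    rw [ht, ← Real.rpow_natCast, ← Real.rpow_mul hX0.le]
    exact Real.rpow_le_rpow_of_exponent_le hX1 (by norm_num)
  calc ((Nat.log 2 N + 1 : ℕ) : ℝ) ^ 2 * (32 * T ^ 3 * VV X q z)
      ≤ (2000 * t) ^ 2 * (32 * T ^ 3 * VV X q z) := by gcongr
    _ = 4000000 * 32 * (C * 4) ^ 3 * t ^ 8 * VV X q z := by rw [hTd]; ring
    _ ≤ _ := by gcongr

end Nun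


namespace Nun

lemma Nd_zero_of_lt {N q D a : ℕ} (h : N < D) : Nd N q D a = 0 := by
  unfold Nd
  refine Finset.sum_eq_zero fun n hn => ?_
  rw [Finset.mem_Icc] at hn
  have : ¬ D ∣ n := fun hd => by have := Nat.le_of_dvd hn.1 hd; omega
  simp [this]

lemma Nd_zero_of_ncop {N q d a : ℕ} (ha : Nat.Coprime a q) (h : ¬ Nat.Coprime d q) : Nd N q (d ^ 2) a = 0 := by
  unfold Nd
  refine Finset.sum_eq_zero fun n hn => ?_
  by_cases h1 : n % q = a
  · have : ¬ d ^ 2 ∣ n := fun hd => by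
      apply h
      rw [← h1] at ha
      have hc : Nat.Coprime n q := by
        rw [Nat.coprime_iff_gcd_eq_one] at ha ⊢
        rwa [← Nat.gcd_rec, Nat.gcd_comm] at ha
      exact Nat.Coprime.coprime_dvd_left ((Dvd.intro_left (d ^ 1) (by ring)).trans hd) hc
    simp [this]
  · simp [h1]

lemma sum_sqfree {N q a K : ℕ} (hK : N ≤ K) (ha : Nat.Coprime a q) (haq : a < q) :
    (∑ n ∈ (Finset.Icc 1 N).filter (fun n => n % q = a % q),
      ((ArithmeticFunction.moebius n : ℤ) : ℝ) ^ 2) =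
      ∑ d ∈ Finset.Icc 1 K, cp q d * mu d * Nd N q (d ^ 2) a := by
  rw [Nat.mod_eq_of_lt haq]
  have h1 : ∀ d, cp q d * mu d * Nd N q (d ^ 2) a = mu d * Nd N q (d ^ 2) a := by
    intro d
    by_cases h : Nat.Coprime d q
    · simp [cp, h]
    · rw [Nd_zero_of_ncop ha h]; simp
  simp_rw [h1]
  unfold Nd
  simp_rw [Finset.mul_sum]
  rw [Finset.sum_comm, Finset.sum_filter]
  refine Finset.sum_congr rfl fun n hn => ?_
  rw [Finset.mem_Icc] at hn
  by_cases h : n % q = a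
  · simp only [h, if_true]
    have := sq_identity (n := n) (K := K) (by omega) (by omega)
    rw [Finset.sum_filter] at this
    change mu n ^ 2 = _
    rw [← this]
    refine Finset.sum_congr rfl fun d _ => ?_
    simp
  · simp [h]

lemma tail_mu (q : ℕ) (hq : q ≠ 0) {z : ℕ} (hz : 1 ≤ z) :
    |∑' d : ℕ, cp q d * (mu d / (d : ℝ) ^ 2) - ∑ d ∈ Finset.Icc 1 z, cp q d * (mu d / (d : ℝ) ^ 2)| ≤ 2 / z := by
  have hb : ∀ d, |cp q d * (mu d / (d : ℝ) ^ 2)| ≤ ((d : ℝ) ^ 2)⁻¹ := by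
    intro d
    rw [abs_mul, abs_of_nonneg (cp_nonneg _ _), abs_div, abs_of_nonneg (sq_nonneg (d : ℝ)), ← one_div]
    calc _ ≤ 1 * (|mu d| / (d : ℝ) ^ 2) := by
          gcongr; exact cp_le_one _ _
      _ ≤ _ := by rw [one_mul]; gcongr; exact mu_abs_le d
  have hs : Summable (fun d : ℕ => cp q d * (mu d / (d : ℝ) ^ 2)) := by
    refine Summable.of_norm_bounded (g := fun d : ℕ => ((d : ℝ) ^ 2)⁻¹) ?_ hb
    exact Real.summable_nat_pow_inv.2 (by norm_num)
  have ht := hs.hasSum.tendsto_sum_nat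
  have ht2 := (ht.sub_const (∑ d ∈ Finset.Icc 1 z, cp q d * (mu d / (d : ℝ) ^ 2))).abs
  refine le_of_tendsto ht2 ?_
  filter_upwards [Filter.eventually_ge_atTop (z + 1)] with K hK
  have h1 : ∑ d ∈ Finset.range K, cp q d * (mu d / (d : ℝ) ^ 2) =
      ∑ d ∈ Finset.Icc 1 z, cp q d * (mu d / (d : ℝ) ^ 2) + ∑ d ∈ Finset.Ioo z K, cp q d * (mu d / (d : ℝ) ^ 2) := by
    rw [← Finset.sum_union]
    · symm
      refine Finset.sum_subset ?_ ?_
      · intro d hd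
        simp only [Finset.mem_union, Finset.mem_Icc, Finset.mem_Ioo, Finset.mem_range] at *
        omega
      · intro d hd hd2
        simp only [Finset.mem_union, Finset.mem_Icc, Finset.mem_Ioo, Finset.mem_range] at *
        have : d = 0 := by omega
        subst this; simp
    · rw [Finset.disjoint_left]
      intro d h1 h2
      simp only [Finset.mem_Icc, Finset.mem_Ioo] at *
      omega
  rw [h1, add_sub_cancel_left]
  refine (Finset.abs_sum_le_sum_abs _ _).trans ?_
  refine (Finset.sum_le_sum fun d _ => hb d).trans ?_
  refine (sum_Ioo_inv_sq_le z K).trans ?_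
  have hz0 : (0 : ℝ) < z := by exact_mod_cast hz
  gcongr
  linarith

lemma E_split {q : ℕ} (hq : 0 < q) {X : ℝ} (hX : (q : ℝ) ≤ X) {z : ℕ} (hz : 1 ≤ z) {a : ℕ} (ha : a ∈ Us q) :
    |Eterm X q a - Es X q z a| ≤ Rl ⌊X⌋₊ q z a + 2 * (X / q) / z := by
  have ha2 := Finset.mem_filter.1 ha
  have haq : a < q := Finset.mem_range.1 ha2.1
  have hX0 : 0 ≤ X := le_trans (by positivity) hX
  set N := ⌊X⌋₊ with hN
  set Y := X / q with hY
  have hY0 : 0 ≤ Y := by positivity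
  have e1 : Eterm X q a = ∑ d ∈ Finset.Icc 1 (max N z), cp q d * mu d * Nd N q (d ^ 2) a -
      Y * ∑' d : ℕ, cp q d * (mu d / (d : ℝ) ^ 2) := by
    unfold Eterm Cq
    rw [sum_sqfree (le_max_left N z) ha2.2 haq, tsum_cp_mu_sq hq.ne', hY]
    ring
  have e2 : Es X q z a = ∑ d ∈ Finset.Icc 1 z, cp q d * mu d * Nd N q (d ^ 2) a -
      Y * ∑ d ∈ Finset.Icc 1 z, cp q d * (mu d / (d : ℝ) ^ 2) := by
    unfold Es
    rw [Finset.mul_sum, ← Finset.sum_sub_distrib]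
    refine Finset.sum_congr rfl fun d _ => ?_
    push_cast
    rw [← hY, ← hN]
    ring
  have e3 : ∑ d ∈ Finset.Icc 1 (max N z), cp q d * mu d * Nd N q (d ^ 2) a =
      ∑ d ∈ Finset.Icc 1 z, cp q d * mu d * Nd N q (d ^ 2) a + ∑ d ∈ Finset.Ioc z N, cp q d * mu d * Nd N q (d ^ 2) a := by
    rw [← Finset.sum_union]
    · symm
      refine Finset.sum_subset ?_ ?_
      · intro d hd
        simp only [Finset.mem_union, Finset.mem_Icc, Finset.mem_Ioc] at *
        omega
      · intro d hd hd2
        simp only [Finset.mem_union, Finset.mem_Icc, Finset.mem_Ioc] at *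
        rw [Nd_zero_of_lt (by nlinarith [show N < d by omega]), mul_zero]
    · rw [Finset.disjoint_left]
      intro d h1 h2
      simp only [Finset.mem_Icc, Finset.mem_Ioc] at *
      omega
  have e4 : |∑ d ∈ Finset.Ioc z N, cp q d * mu d * Nd N q (d ^ 2) a| ≤ Rl N q z a := by
    unfold Rl
    rw [Finset.sum_filter]
    refine (Finset.abs_sum_le_sum_abs _ _).trans (Finset.sum_le_sum fun d _ => ?_)
    rw [abs_mul, abs_mul, abs_of_nonneg (Nd_nonneg _ _ _ _)]
    unfold cp
    split_ifs
    · simp only [abs_one, one_mul]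
      exact mul_le_of_le_one_left (Nd_nonneg _ _ _ _) (mu_abs_le d)
    · simp
  have e5 := tail_mu q hq.ne' hz
  rw [e1, e2, e3]
  set u := ∑ d ∈ Finset.Ioc z N, cp q d * mu d * Nd N q (d ^ 2) a
  set v := ∑' d : ℕ, cp q d * (mu d / (d : ℝ) ^ 2)
  set w := ∑ d ∈ Finset.Icc 1 z, cp q d * (mu d / (d : ℝ) ^ 2)
  set r := ∑ d ∈ Finset.Icc 1 z, cp q d * mu d * Nd N q (d ^ 2) a
  have : r + u - Y * v - (r - Y * w) = u - Y * (v - w) := by ring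
  rw [this]
  calc |u - Y * (v - w)| ≤ |u| + |Y * (v - w)| := abs_sub _ _
    _ ≤ Rl N q z a + Y * (2 / z) := by
        rw [abs_mul, abs_of_nonneg hY0]; gcongr
    _ = _ := by ring

lemma L_bound : ∃ C : ℝ, 0 < C ∧ ∀ (q : ℕ) (X : ℝ) (z : ℕ), 0 < q → (q : ℝ) ≤ X → 1 ≤ z →
    ∑ a ∈ Us q, (Eterm X q a - Es X q z a) ^ 2 ≤ C * X ^ (1 / 100 : ℝ) * VV X q z := by
  obtain ⟨C, hC0, hC⟩ := R_bound'
  refine ⟨2 * C + 8, by positivity, ?_⟩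
  intro q X z hq hX hz
  have hX1 : 1 ≤ X := le_trans (by exact_mod_cast hq) hX
  have hq0 : (0 : ℝ) < q := by exact_mod_cast hq
  have hz0 : (0 : ℝ) < z := by exact_mod_cast hz
  have h1 := hC q X z hq hX hz
  have h2 : ∑ a ∈ Us q, (2 * (X / q) / z) ^ 2 ≤ 4 * X ^ (1 / 100 : ℝ) * VV X q z := by
    rw [Finset.sum_const, Us_card, nsmul_eq_mul]
    have h3 : (q.totient : ℝ) ≤ q := by exact_mod_cast Nat.totient_le q
    have h4 : 1 ≤ X ^ (1 / 100 : ℝ) := Real.one_le_rpow hX1 (by norm_num)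
    have h5 : X ^ 2 / ((z : ℝ) ^ 2 * q) ≤ VV X q z := by
      have : 0 ≤ X ^ 2 / ((z : ℝ) ^ 3 * Real.sqrt q) + X / Real.sqrt q + X / z := by positivity
      unfold VV; linarith
    have h6 : 0 ≤ X ^ 2 / ((z : ℝ) ^ 2 * q) := by positivity
    calc (q.totient : ℝ) * (2 * (X / q) / z) ^ 2 ≤ q * (2 * (X / q) / z) ^ 2 := by gcongr
      _ = 4 * 1 * (X ^ 2 / ((z : ℝ) ^ 2 * q)) := by field_simp; ring
      _ ≤ _ := by gcongr
  calc _ ≤ ∑ a ∈ Us q, (2 * Rl ⌊X⌋₊ q z a ^ 2 + 2 * (2 * (X / q) / z) ^ 2) := by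
        refine Finset.sum_le_sum fun a ha => ?_
        have h3 := E_split hq hX hz ha
        have h4 := pow_le_pow_left₀ (abs_nonneg _) h3 2
        rw [sq_abs] at h4
        refine h4.trans ?_
        nlinarith [sq_nonneg (Rl ⌊X⌋₊ q z a - 2 * (X / q) / z)]
    _ ≤ _ := by
        rw [Finset.sum_add_distrib, ← Finset.mul_sum, ← Finset.mul_sum]
        linarith

end Nun


namespace Nun

noncomputable def mo (Q Y a b : ℝ) : ℝ := Q ^ a * Y ^ b

lemma mo_mul {Q Y : ℝ} (hQ : 1 ≤ Q) (hY : 1 ≤ Y) (a b c d : ℝ) :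
    mo Q Y a b * mo Q Y c d = mo Q Y (a + c) (b + d) := by
  unfold mo
  rw [Real.rpow_add (by linarith), Real.rpow_add (by linarith)]; ring

lemma mo_pos {Q Y : ℝ} (hQ : 1 ≤ Q) (hY : 1 ≤ Y) (a b : ℝ) : 0 < mo Q Y a b := by
  unfold mo; have := Real.rpow_pos_of_pos (show 0 < Q by linarith) a
  have := Real.rpow_pos_of_pos (show 0 < Y by linarith) b
  positivity

lemma mo_one {Q Y : ℝ} (hQ : 1 ≤ Q) (hY : 1 ≤ Y) {a b : ℝ} (ha : 0 ≤ a) (hb : 0 ≤ b) : 1 ≤ mo Q Y a b := by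
  unfold mo
  have h1 := Real.one_le_rpow hQ ha
  have h2 := Real.one_le_rpow hY hb
  nlinarith

lemma mo_rpow {Q Y : ℝ} (hQ : 1 ≤ Q) (hY : 1 ≤ Y) (a b t : ℝ) : mo Q Y a b ^ t = mo Q Y (a * t) (b * t) := by
  unfold mo
  have := Real.rpow_pos_of_pos (show 0 < Q by linarith) a
  have := Real.rpow_pos_of_pos (show 0 < Y by linarith) b
  rw [Real.mul_rpow (by positivity) (by positivity), ← Real.rpow_mul (by linarith), ← Real.rpow_mul (by linarith)]

lemma mo_le {Q Y : ℝ} (hQ : 1 ≤ Q) (hY : 1 ≤ Y) {a b : ℝ} (t : ℝ) (ht0 : 0 ≤ t) (ht1 : t ≤ 1)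
    (ha : a ≤ t + (1 - t) * (2 / 3)) (hb : b ≤ t / 3 + (1 - t) * (23 / 15)) :
    mo Q Y a b ≤ mo Q Y 1 (1 / 3) + mo Q Y (2 / 3) (23 / 15) := by
  have p1 := mo_pos hQ hY 1 (1 / 3)
  have p2 := mo_pos hQ hY (2 / 3) (23 / 15)
  have h := Real.geom_mean_le_arith_mean2_weighted (w₁ := t) (w₂ := 1 - t) ht0 (by linarith) p1.le p2.le (by ring)
  rw [mo_rpow hQ hY, mo_rpow hQ hY, mo_mul hQ hY] at h
  have h2 : mo Q Y a b ≤ mo Q Y (1 * t + 2 / 3 * (1 - t)) (1 / 3 * t + 23 / 15 * (1 - t)) := by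
    unfold mo
    refine mul_le_mul (Real.rpow_le_rpow_of_exponent_le hQ (by linarith))
      (Real.rpow_le_rpow_of_exponent_le hY (by linarith)) (Real.rpow_nonneg (by linarith) _)
      (Real.rpow_nonneg (by linarith) _)
  nlinarith

lemma mo_sq_le {Q Y : ℝ} (hQ : 1 ≤ Q) (hY : 1 ≤ Y) {a b : ℝ} (t : ℝ) (ht0 : 0 ≤ t) (ht1 : t ≤ 1)
    (ha : a ≤ 2 * (t + (1 - t) * (2 / 3))) (hb : b ≤ 2 * (t / 3 + (1 - t) * (23 / 15))) :
    mo Q Y a b ≤ (mo Q Y 1 (1 / 3) + mo Q Y (2 / 3) (23 / 15)) ^ 2 := by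
  have h := mo_le hQ hY (a := a / 2) (b := b / 2) t ht0 ht1 (by linarith) (by linarith)
  have h2 := pow_le_pow_left₀ (mo_pos hQ hY (a / 2) (b / 2)).le h 2
  rw [pow_two (mo Q Y (a / 2) (b / 2)), mo_mul hQ hY, add_halves, add_halves] at h2
  exact h2

/-- bounds for the choice of `z`. -/
lemma choose_z {Q Y : ℝ} (hQ : 1 ≤ Q) (hY : 1 ≤ Y) : ∃ z : ℕ, 1 ≤ z ∧ (z : ℝ) ≤ mo Q Y 0.32 0.25 ∧
    (z : ℝ)⁻¹ ≤ 2 * mo Q Y (-0.32) (-0.25) := by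
  have h1 := mo_one hQ hY (a := 0.32) (b := 0.25) (by norm_num) (by norm_num)
  refine ⟨⌊mo Q Y 0.32 0.25⌋₊, Nat.le_floor (by simpa using h1), Nat.floor_le (by linarith), ?_⟩
  set w := mo Q Y 0.32 0.25 with hw
  have h2 : w < ⌊w⌋₊ + 1 := Nat.lt_floor_add_one w
  have h3 : (1 : ℝ) ≤ ⌊w⌋₊ := by exact_mod_cast Nat.le_floor (by simpa using h1)
  have h4 : w * mo Q Y (-0.32) (-0.25) = 1 := by
    rw [hw, mo_mul hQ hY]; unfold mo; norm_num
  have h5 := mo_pos hQ hY (-0.32) (-0.25)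
  rw [inv_le_iff_one_le_mul₀ (by linarith)]
  nlinarith

lemma VV_le {Q Y : ℝ} (hQ : 1 ≤ Q) (hY : 1 ≤ Y) {q z : ℕ} (hqQ : (q : ℝ) = Q) (hz : 1 ≤ z)
    (hzi : (z : ℝ)⁻¹ ≤ 2 * mo Q Y (-0.32) (-0.25)) :
    (Q * Y) ^ (1 / 100 : ℝ) * VV (Q * Y) q z ≤ 8 * (mo Q Y 0.37 1.51 + mo Q Y 0.55 1.26 + mo Q Y 0.51 1.01 + mo Q Y 0.69 0.76) := by
  have hz0 : (0 : ℝ) < z := by exact_mod_cast hz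
  have hi0 : 0 < (z : ℝ)⁻¹ := by positivity
  have hQ0 : 0 < Q := by linarith
  have hY0 : 0 < Y := by linarith
  have hsq : Real.sqrt q = Q ^ (1 / 2 : ℝ) := by rw [hqQ, Real.sqrt_eq_rpow]
  have e0 : (Q * Y) ^ (1 / 100 : ℝ) = mo Q Y 0.01 0.01 := by
    unfold mo; rw [Real.mul_rpow hQ0.le hY0.le]; norm_num
  have m2 : mo Q Y (-0.32) (-0.25) ^ 2 = mo Q Y (-0.64) (-0.5) := by
    rw [pow_two, mo_mul hQ hY]; norm_num
  have m3 : mo Q Y (-0.32) (-0.25) ^ 3 = mo Q Y (-0.96) (-0.75) := by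
    rw [pow_succ, m2, mo_mul hQ hY]; norm_num
  have p := mo_pos hQ hY
  have a1 : (Q * Y) ^ 2 / ((z : ℝ) ^ 2 * q) ≤ 4 * mo Q Y 0.36 1.5 := by
    have e : (Q * Y) ^ 2 / ((z : ℝ) ^ 2 * q) = mo Q Y 1 2 * ((z : ℝ)⁻¹) ^ 2 := by
      rw [hqQ]; unfold mo; rw [Real.rpow_one, Real.rpow_two]; field_simp
    rw [e]
    calc _ ≤ mo Q Y 1 2 * (2 * mo Q Y (-0.32) (-0.25)) ^ 2 := by
          gcongr; exact (p _ _).le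
      _ = 4 * (mo Q Y 1 2 * mo Q Y (-0.64) (-0.5)) := by rw [mul_pow, m2]; ring
      _ = _ := by rw [mo_mul hQ hY]; norm_num
  have a2 : (Q * Y) ^ 2 / ((z : ℝ) ^ 3 * Real.sqrt q) ≤ 8 * mo Q Y 0.54 1.25 := by
    have e : (Q * Y) ^ 2 / ((z : ℝ) ^ 3 * Real.sqrt q) = mo Q Y 1.5 2 * ((z : ℝ)⁻¹) ^ 3 := by
      rw [hsq]; unfold mo
      have : Q ^ 2 = Q ^ (1.5 : ℝ) * Q ^ (1 / 2 : ℝ) := by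
        rw [← Real.rpow_add hQ0, ← Real.rpow_two]; norm_num
      rw [mul_pow, this, Real.rpow_two]
      have : 0 < Q ^ (1 / 2 : ℝ) := by positivity
      field_simp
    rw [e]
    calc _ ≤ mo Q Y 1.5 2 * (2 * mo Q Y (-0.32) (-0.25)) ^ 3 := by
          gcongr; exact (p _ _).le
      _ = 8 * (mo Q Y 1.5 2 * mo Q Y (-0.96) (-0.75)) := by rw [mul_pow, m3]; ring
      _ = _ := by rw [mo_mul hQ hY]; norm_num
  have a3 : (Q * Y) / Real.sqrt q = mo Q Y 0.5 1 := by
    rw [hsq]; unfold mo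
    have : Q = Q ^ (0.5 : ℝ) * Q ^ (1 / 2 : ℝ) := by
      rw [← Real.rpow_add hQ0]; norm_num
    have h2 : 0 < Q ^ (1 / 2 : ℝ) := by positivity
    rw [Real.rpow_one, div_eq_iff h2.ne']
    nth_rewrite 1 [this]
    ring
  have a4 : (Q * Y) / z ≤ 2 * mo Q Y 0.68 0.75 := by
    have e : (Q * Y) / z = mo Q Y 1 1 * (z : ℝ)⁻¹ := by
      unfold mo; rw [Real.rpow_one, Real.rpow_one]; rfl
    rw [e]
    calc _ ≤ mo Q Y 1 1 * (2 * mo Q Y (-0.32) (-0.25)) := by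
          gcongr; exact (p _ _).le
      _ = 2 * (mo Q Y 1 1 * mo Q Y (-0.32) (-0.25)) := by ring
      _ = _ := by rw [mo_mul hQ hY]; norm_num
  have hV : VV (Q * Y) q z ≤ 8 * (mo Q Y 0.36 1.5 + mo Q Y 0.54 1.25 + mo Q Y 0.5 1 + mo Q Y 0.68 0.75) := by
    unfold VV
    rw [a3]
    linarith [p 0.36 1.5, p 0.54 1.25, p 0.5 1, p 0.68 0.75]
  rw [e0]
  calc _ ≤ mo Q Y 0.01 0.01 * (8 * (mo Q Y 0.36 1.5 + mo Q Y 0.54 1.25 + mo Q Y 0.5 1 + mo Q Y 0.68 0.75)) := by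
        gcongr; exact (p _ _).le
    _ = 8 * (mo Q Y 0.01 0.01 * mo Q Y 0.36 1.5 + mo Q Y 0.01 0.01 * mo Q Y 0.54 1.25 +
        mo Q Y 0.01 0.01 * mo Q Y 0.5 1 + mo Q Y 0.01 0.01 * mo Q Y 0.68 0.75) := by ring
    _ = _ := by
        simp only [mo_mul hQ hY]; norm_num

/-- Cauchy--Schwarz comparison of second moments. -/
lemma moment_compare (U : Finset ℕ) (f g : ℕ → ℝ) :
    |∑ a ∈ U, f a ^ 2 - ∑ a ∈ U, g a ^ 2| ≤
      2 * Real.sqrt ((∑ a ∈ U, g a ^ 2) * ∑ a ∈ U, (f a - g a) ^ 2) + ∑ a ∈ U, (f a - g a) ^ 2 := by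
  have h1 : ∑ a ∈ U, f a ^ 2 - ∑ a ∈ U, g a ^ 2 =
      2 * ∑ a ∈ U, g a * (f a - g a) + ∑ a ∈ U, (f a - g a) ^ 2 := by
    rw [Finset.mul_sum, ← Finset.sum_sub_distrib, ← Finset.sum_add_distrib]
    refine Finset.sum_congr rfl fun a _ => ?_
    ring
  have h2 : |∑ a ∈ U, g a * (f a - g a)| ≤ Real.sqrt ((∑ a ∈ U, g a ^ 2) * ∑ a ∈ U, (f a - g a) ^ 2) := by
    refine Real.abs_le_sqrt ?_
    exact Finset.sum_mul_sq_le_sq_mul_sq _ _ _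
  have h3 : 0 ≤ ∑ a ∈ U, (f a - g a) ^ 2 := Finset.sum_nonneg fun _ _ => sq_nonneg _
  rw [h1]
  refine (abs_add_le _ _).trans ?_
  rw [abs_of_nonneg h3, abs_mul, abs_two]
  linarith

end Nun


namespace Nun

lemma main_bound : ∃ C : ℝ, 0 < C ∧ ∀ (q : ℕ) (X : ℝ), 0 < q → (q : ℝ) ≤ X →
    |M2 X q - Cmain * (∏ p ∈ q.primeFactors, (1 + 2 * ((p : ℝ))⁻¹)⁻¹) * q * Real.sqrt (X / q)| ≤
      C * (q.divisors.card * mo q (X / q) 1 (1 / 3) + mo q (X / q) (2 / 3) (23 / 15)) := by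
  obtain ⟨C1, hC1, h1⟩ := Tinf_approx
  obtain ⟨C2, hC2, h2⟩ := Tz_approx
  obtain ⟨C3, hC3, h3⟩ := L_bound
  obtain ⟨C4, hC4, h4⟩ := divisor_bound 0.01 (by norm_num)
  set K := |Cmain| with hK
  have hK0 : 0 ≤ K := abs_nonneg _
  set C5 := 10 * C4 + 2 * C2 + C1 with hC5
  have hC50 : 0 < C5 := by positivity
  set C6 := 32 * K * C3 + 32 * C5 * C3 with hC6
  have hC60 : 0 < C6 := by positivity
  refine ⟨C5 + 2 * Real.sqrt C6 + 32 * C3, by positivity, ?_⟩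
  intro q X hq hX
  have hQ : (1 : ℝ) ≤ q := by exact_mod_cast hq
  have hQ0 : (0 : ℝ) < q := by linarith
  set Q : ℝ := (q : ℝ) with hQd
  set Y := X / Q with hYd
  have hY : 1 ≤ Y := by rw [hYd, one_le_div hQ0]; exact hX
  have hY0 : 0 < Y := by linarith
  have hXQ : X = Q * Y := by rw [hYd]; field_simp
  obtain ⟨z, hz1, hz2, hz3⟩ := choose_z hQ hY
  have p := mo_pos hQ hY
  set dq : ℝ := (q.divisors.card : ℝ) with hdq
  have hd1 : 1 ≤ dq := one_le_card_div hq
  set E1 := mo Q Y 1 (1 / 3) with hE1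
  set E2 := mo Q Y (2 / 3) (23 / 15) with hE2
  set S := dq * E1 + E2 with hS
  have hE1p : 0 < E1 := p _ _
  have hE2p : 0 < E2 := p _ _
  have hES : E1 + E2 ≤ S := by rw [hS]; nlinarith
  have hS0 : 0 < S := by linarith
  set P := ∏ p ∈ q.primeFactors, (1 + 2 * ((p : ℝ))⁻¹)⁻¹ with hP
  have hP0 : 0 ≤ P := Finset.prod_nonneg fun p _ => by positivity
  have hP1 : P ≤ 1 := Finset.prod_le_one (fun p _ => by positivity) fun p _ => by
    refine inv_le_one_of_one_le₀ ?_
    have : (0 : ℝ) ≤ (p : ℝ)⁻¹ := by positivity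
    linarith
  have hz0 : (0 : ℝ) < z := by exact_mod_cast hz1
  have hph : (q.totient : ℝ) ≤ Q := by rw [hQd]; exact_mod_cast Nat.totient_le q
  set main := Cmain * P * Q * Real.sqrt Y with hmain
  have g1 : |(q.totient : ℝ) * Tinf q Y - main| ≤ C1 * S := by
    have := h1 q hq.ne' Y hY0
    rw [cF_eq] at this
    refine this.trans ?_
    calc C1 * (q.totient : ℝ) * dq * Y ^ (1 / 3 : ℝ) ≤ C1 * Q * dq * Y ^ (1 / 3 : ℝ) := by
          have hy3 : 0 < Y ^ (1 / 3 : ℝ) := Real.rpow_pos_of_pos hY0 _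
          have hd0 : 0 ≤ dq := by linarith
          exact mul_le_mul_of_nonneg_right (mul_le_mul_of_nonneg_right (mul_le_mul_of_nonneg_left hph hC1.le) hd0) hy3.le
      _ = C1 * (dq * E1) := by rw [hE1]; unfold mo; rw [Real.rpow_one]; ring
      _ ≤ C1 * S := by gcongr; rw [hS]; linarith
  have g2 : |(q.totient : ℝ) * Tz q Y z - (q.totient : ℝ) * Tinf q Y| ≤ 2 * C2 * S := by
    rw [← mul_sub, abs_mul, abs_of_nonneg (Nat.cast_nonneg _)]
    have e1 : (z : ℝ) ^ (-(1 / 2) : ℝ) ≤ 2 * mo Q Y (-0.16) (-0.125) := by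
      rw [Real.rpow_neg hz0.le, ← Real.inv_rpow hz0.le]
      calc ((z : ℝ)⁻¹) ^ (1 / 2 : ℝ) ≤ (2 * mo Q Y (-0.32) (-0.25)) ^ (1 / 2 : ℝ) :=
            Real.rpow_le_rpow (by positivity) hz3 (by norm_num)
        _ = (2 : ℝ) ^ (1 / 2 : ℝ) * mo Q Y (-0.16) (-0.125) := by
            rw [Real.mul_rpow (by norm_num) (p _ _).le, mo_rpow hQ hY]; norm_num
        _ ≤ (2 : ℝ) ^ (1 : ℝ) * mo Q Y (-0.16) (-0.125) := by
            refine mul_le_mul_of_nonneg_right ?_ (p _ _).le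
            exact Real.rpow_le_rpow_of_exponent_le (by norm_num) (by norm_num)
        _ = _ := by rw [Real.rpow_one]
    have e2 : mo Q Y 0.84 0.875 ≤ E1 + E2 := mo_le hQ hY 0.52 (by norm_num) (by norm_num) (by norm_num) (by norm_num)
    calc (q.totient : ℝ) * |Tz q Y z - Tinf q Y| ≤ Q * (C2 * Y * (2 * mo Q Y (-0.16) (-0.125))) := by
          refine mul_le_mul hph ((h2 q Y z hY0.le hz1).trans ?_) (abs_nonneg _) hQ0.le
          gcongr
      _ = 2 * C2 * (mo Q Y 1 1 * mo Q Y (-0.16) (-0.125)) := by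
          have : mo Q Y 1 1 = Q * Y := by unfold mo; rw [Real.rpow_one, Real.rpow_one]
          rw [this]; ring
      _ = 2 * C2 * mo Q Y 0.84 0.875 := by rw [mo_mul hQ hY]; norm_num
      _ ≤ 2 * C2 * S := by gcongr; linarith
  set A := ∑ a ∈ Us q, Es X q z a ^ 2 with hA
  have g3 : |A - (q.totient : ℝ) * Tz q Y z| ≤ 10 * C4 * S := by
    refine (Es_var hq hX z).trans ?_
    have e1 : dq ≤ C4 * Q ^ (0.01 : ℝ) := h4 q hq.ne'
    have e2 : mo Q Y 0.65 1.5 ≤ E1 + E2 := mo_le hQ hY 0 (by norm_num) (by norm_num) (by norm_num) (by norm_num)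
    have e3 : (z : ℝ) ^ 2 ≤ mo Q Y 0.64 0.5 := by
      calc (z : ℝ) ^ 2 ≤ (mo Q Y 0.32 0.25) ^ 2 := by gcongr
        _ = _ := by rw [pow_two, mo_mul hQ hY]; norm_num
    calc 10 * dq * Y * (z : ℝ) ^ 2 ≤ 10 * (C4 * Q ^ (0.01 : ℝ)) * Y * mo Q Y 0.64 0.5 := by gcongr
      _ = 10 * C4 * (mo Q Y 0.01 1 * mo Q Y 0.64 0.5) := by
          have : mo Q Y 0.01 1 = Q ^ (0.01 : ℝ) * Y := by unfold mo; rw [Real.rpow_one]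
          rw [this]; ring
      _ = 10 * C4 * mo Q Y 0.65 1.5 := by rw [mo_mul hQ hY]; norm_num
      _ ≤ 10 * C4 * S := by gcongr; linarith
  have g4 : |A - main| ≤ C5 * S := by
    rw [hC5]
    rw [abs_le] at *
    constructor <;> linarith [g1.1, g1.2, g2.1, g2.2, g3.1, g3.2]
  have g5 : main ≤ K * mo Q Y 1 0.5 := by
    have e : mo Q Y 1 0.5 = Q * Real.sqrt Y := by
      unfold mo; rw [Real.rpow_one, Real.sqrt_eq_rpow]; norm_num
    rw [e, hmain]
    calc Cmain * P * Q * Real.sqrt Y ≤ |Cmain| * 1 * Q * Real.sqrt Y := by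
          gcongr
          exact le_abs_self _
      _ = _ := by rw [hK]; ring
  set L := ∑ a ∈ Us q, (Eterm X q a - Es X q z a) ^ 2 with hL
  have hL0 : 0 ≤ L := Finset.sum_nonneg fun _ _ => sq_nonneg _
  have hA0 : 0 ≤ A := Finset.sum_nonneg fun _ _ => sq_nonneg _
  have g6 : L ≤ C3 * (8 * (mo Q Y 0.37 1.51 + mo Q Y 0.55 1.26 + mo Q Y 0.51 1.01 + mo Q Y 0.69 0.76)) := by
    refine (h3 q X z hq hX hz1).trans ?_
    rw [mul_assoc]
    refine mul_le_mul_of_nonneg_left ?_ hC3.le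
    rw [hXQ]
    exact VV_le hQ hY hQd.symm hz1 hz3
  have g7 : L ≤ 32 * C3 * S := by
    have e1 : mo Q Y 0.37 1.51 ≤ E1 + E2 := mo_le hQ hY 0 (by norm_num) (by norm_num) (by norm_num) (by norm_num)
    have e2 : mo Q Y 0.55 1.26 ≤ E1 + E2 := mo_le hQ hY 0 (by norm_num) (by norm_num) (by norm_num) (by norm_num)
    have e3 : mo Q Y 0.51 1.01 ≤ E1 + E2 := mo_le hQ hY 0 (by norm_num) (by norm_num) (by norm_num) (by norm_num)
    have e4 : mo Q Y 0.69 0.76 ≤ E1 + E2 := mo_le hQ hY 0.1 (by norm_num) (by norm_num) (by norm_num) (by norm_num)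
    calc L ≤ _ := g6
      _ ≤ C3 * (8 * (S + S + S + S)) := by gcongr <;> linarith
      _ = _ := by ring
  have g8 : L * mo Q Y 1 0.5 ≤ 32 * C3 * S ^ 2 := by
    have eS : (E1 + E2) ^ 2 ≤ S ^ 2 := by gcongr
    have e1 : mo Q Y 1.37 2.01 ≤ S ^ 2 := le_trans (mo_sq_le hQ hY 0.1 (by norm_num) (by norm_num) (by norm_num) (by norm_num)) eS
    have e2 : mo Q Y 1.55 1.76 ≤ S ^ 2 := le_trans (mo_sq_le hQ hY 0.4 (by norm_num) (by norm_num) (by norm_num) (by norm_num)) eS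
    have e3 : mo Q Y 1.51 1.51 ≤ S ^ 2 := le_trans (mo_sq_le hQ hY 0.3 (by norm_num) (by norm_num) (by norm_num) (by norm_num)) eS
    have e4 : mo Q Y 1.69 1.26 ≤ S ^ 2 := le_trans (mo_sq_le hQ hY 0.55 (by norm_num) (by norm_num) (by norm_num) (by norm_num)) eS
    calc L * mo Q Y 1 0.5 ≤ C3 * (8 * (mo Q Y 0.37 1.51 + mo Q Y 0.55 1.26 + mo Q Y 0.51 1.01 + mo Q Y 0.69 0.76)) * mo Q Y 1 0.5 :=
          mul_le_mul_of_nonneg_right g6 (p _ _).le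
      _ = C3 * (8 * (mo Q Y 0.37 1.51 * mo Q Y 1 0.5 + mo Q Y 0.55 1.26 * mo Q Y 1 0.5 +
          mo Q Y 0.51 1.01 * mo Q Y 1 0.5 + mo Q Y 0.69 0.76 * mo Q Y 1 0.5)) := by ring
      _ = C3 * (8 * (mo Q Y 1.37 2.01 + mo Q Y 1.55 1.76 + mo Q Y 1.51 1.51 + mo Q Y 1.69 1.26)) := by
          simp only [mo_mul hQ hY]; norm_num
      _ ≤ C3 * (8 * (S ^ 2 + S ^ 2 + S ^ 2 + S ^ 2)) := by gcongr
      _ = _ := by ring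
  have g9 : A * L ≤ C6 * S ^ 2 := by
    have : A ≤ K * mo Q Y 1 0.5 + C5 * S := by
      have := (abs_le.1 g4).2
      linarith
    calc A * L ≤ (K * mo Q Y 1 0.5 + C5 * S) * L := mul_le_mul_of_nonneg_right this hL0
      _ = K * (L * mo Q Y 1 0.5) + C5 * S * L := by ring
      _ ≤ K * (32 * C3 * S ^ 2) + C5 * S * (32 * C3 * S) :=
          add_le_add (mul_le_mul_of_nonneg_left g8 hK0)
            (mul_le_mul_of_nonneg_left g7 (mul_pos hC50 hS0).le)
      _ = _ := by rw [hC6]; ring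
  have g10 : Real.sqrt (A * L) ≤ Real.sqrt C6 * S := by
    calc Real.sqrt (A * L) ≤ Real.sqrt (C6 * S ^ 2) := Real.sqrt_le_sqrt g9
      _ = _ := by rw [Real.sqrt_mul hC60.le, Real.sqrt_sq hS0.le]
  have g11 : |M2 X q - A| ≤ 2 * Real.sqrt (A * L) + L := moment_compare (Us q) (Eterm X q) (Es X q z)
  calc |M2 X q - main| ≤ |M2 X q - A| + |A - main| := abs_sub_le _ _ _
    _ ≤ (2 * (Real.sqrt C6 * S) + 32 * C3 * S) + C5 * S := by linarith
    _ = _ := by ring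

end Nun

theorem statement0 :
    ∃ A : ℝ, 0 < A ∧ ∀ (X : ℝ) (q : ℕ), 2 ≤ X → 1 ≤ q → (q : ℝ) ≤ X →
      |M2 X q - Cmain * (∏ p ∈ q.primeFactors, (1 + 2 * ((p : ℝ))⁻¹)⁻¹) *
          X ^ ((1 : ℝ)/2) * (q : ℝ) ^ ((1 : ℝ)/2)|
        ≤ A * ((q.divisors.card : ℝ) * X ^ ((1 : ℝ)/3) * (q : ℝ) ^ ((2 : ℝ)/3)
            + X ^ ((23 : ℝ)/15) * (q : ℝ) ^ (-(13 : ℝ)/15) * Real.log X ^ 15) := by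
  obtain ⟨C, hC, h⟩ := Nun.main_bound
  have hl2 : 0 < Real.log 2 := Real.log_pos (by norm_num)
  have hl21 : Real.log 2 ≤ 1 := by have := Real.log_two_lt_d9; linarith
  refine ⟨C / Real.log 2 ^ 15, by positivity, ?_⟩
  intro X q hX2 hq hqX
  have hQ0 : (0 : ℝ) < q := by exact_mod_cast hq
  have hX0 : 0 < X := by linarith
  have hb := h q X hq hqX
  have e0 : (q : ℝ) * Real.sqrt (X / q) = X ^ ((1 : ℝ)/2) * (q : ℝ) ^ ((1 : ℝ)/2) := by
    rw [Real.sqrt_eq_rpow, Real.div_rpow hX0.le hQ0.le]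
    have : (q : ℝ) = (q : ℝ) ^ ((1 : ℝ)/2) * (q : ℝ) ^ ((1 : ℝ)/2) := by
      rw [← Real.rpow_add hQ0]; norm_num
    have h2 : 0 < (q : ℝ) ^ ((1 : ℝ)/2) := by positivity
    nth_rewrite 1 [this]
    field_simp
  have e1 : Nun.mo q (X / q) 1 (1 / 3) = X ^ ((1 : ℝ)/3) * (q : ℝ) ^ ((2 : ℝ)/3) := by
    unfold Nun.mo
    rw [Real.div_rpow hX0.le hQ0.le, mul_div_assoc', mul_comm, mul_div_assoc, ← Real.rpow_sub hQ0]
    norm_num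
  have e2 : Nun.mo q (X / q) (2 / 3) (23 / 15) = X ^ ((23 : ℝ)/15) * (q : ℝ) ^ (-(13 : ℝ)/15) := by
    unfold Nun.mo
    rw [Real.div_rpow hX0.le hQ0.le, mul_div_assoc', mul_comm, mul_div_assoc, ← Real.rpow_sub hQ0]
    norm_num
  have e3 : Cmain * (∏ p ∈ q.primeFactors, (1 + 2 * ((p : ℝ))⁻¹)⁻¹) * X ^ ((1 : ℝ)/2) * (q : ℝ) ^ ((1 : ℝ)/2) =
      Cmain * (∏ p ∈ q.primeFactors, (1 + 2 * ((p : ℝ))⁻¹)⁻¹) * q * Real.sqrt (X / q) := by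
    rw [mul_assoc, ← e0]; ring
  rw [e3]
  refine hb.trans ?_
  rw [e1, e2, ← mul_assoc]
  set u := (q.divisors.card : ℝ) * X ^ ((1 : ℝ)/3) * (q : ℝ) ^ ((2 : ℝ)/3) with hu
  set v := X ^ ((23 : ℝ)/15) * (q : ℝ) ^ (-(13 : ℝ)/15) with hv
  have hu0 : 0 ≤ u := by positivity
  have hv0 : 0 ≤ v := by positivity
  have hl : Real.log 2 ^ 15 ≤ Real.log X ^ 15 := by
    gcongr
  have hl1 : Real.log 2 ^ 15 ≤ 1 := pow_le_one₀ hl2.le hl21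
  rw [div_mul_eq_mul_div, le_div_iff₀ (by positivity), mul_assoc]
  refine mul_le_mul_of_nonneg_left ?_ hC.le
  rw [add_mul]
  have := mul_le_mul_of_nonneg_left hl1 hu0
  have := mul_le_mul_of_nonneg_left hl hv0
  linarith
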